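/- Let k/k₀ be a quadratic extension of finite fields of characteristic p, σ the nontrivial k₀-automorphism of k acting entrywise on GL_n(k), and R an algebraically closed field of characteristic different from p. Let n ≥ 1 be odd and let ρ be a supercuspidal irreducible R-representation of GL_n(k). Then the following are equivalent: (1) ρ is σ-selfdual, i.e. ρ ∘ σ ≅ ρ^∨; (2) ρ is GL_n(k₀)-distinguished, i.e. Hom_{GL_n(k₀)}(ρ, 1) ≠ 0; (3) the R-vector space Hom_{GL_n(k₀)}(ρ, 1) has dimension 1. -/

import Mathlib

open Matrix

section InvariantForms

variable {R : Type} [CommRing R] {G : Type} [Monoid G] {V : Type} [AddCommGroup V] [Module R V]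

/-- The space of `H`-invariant `R`-linear forms on a representation `ρ`. -/
def invariantForms (ρ : Representation R G V) (H : Set G) : Submodule R (V →ₗ[R] R) where
  carrier := {φ | ∀ g ∈ H, ∀ v : V, φ (ρ g v) = φ v}
  add_mem' := by
    intro φ ψ hφ hψ g hg v
    simp only [LinearMap.add_apply, hφ g hg v, hψ g hg v]
  zero_mem' := by intro g hg v; simp
  smul_mem' := by
    intro c φ hφ g hg v
    simp only [LinearMap.smul_apply, hφ g hg v]

/-- A representation is irreducible if it is nonzero and its only invariant submodules
are `⊥` and `⊤`. -/
def IsIrreducibleRep (ρ : Representation R G V) : Prop :=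
  (⊥ : Submodule R V) ≠ ⊤ ∧
    ∀ W : Submodule R V, (∀ g : G, ∀ v ∈ W, ρ g v ∈ W) → W = ⊥ ∨ W = ⊤

/-- Two representations are isomorphic if there is an equivariant linear equivalence. -/
def RepIso {W : Type} [AddCommGroup W] [Module R W]
    (ρ : Representation R G V) (τ : Representation R G W) : Prop :=
  ∃ e : V ≃ₗ[R] W, ∀ (g : G) (v : V), e (ρ g v) = τ g (e v)

/-- `ρ` is (isomorphic to) a subquotient of `τ`:  there is a `τ`-invariant submodule `q`
together with an equivariant surjection from `q` onto the space of `ρ`. -/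
def IsSubquotientOf {W : Type} [AddCommGroup W] [Module R W]
    (ρ : Representation R G V) (τ : Representation R G W) : Prop :=
  ∃ (q : Submodule R W) (hq : ∀ g : G, ∀ w ∈ q, τ g w ∈ q) (f : ↥q →ₗ[R] V),
    Function.Surjective f ∧
      ∀ (g : G) (w : ↥q), f ⟨τ g w.1, hq g w.1 w.2⟩ = ρ g (f w)

end InvariantForms
section RightRegular

variable {R : Type} [CommRing R] {G : Type} [Group G] {V : Type} [AddCommGroup V] [Module R V]

/-- The right-translation representation of `G` on a translation-invariant submodule of
the space of `V`-valued functions on `G`. -/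
def rightRegular (C : Submodule R (G → V))
    (hC : ∀ g : G, ∀ f ∈ C, (fun x => f (x * g)) ∈ C) :
    Representation R G ↥C where
  toFun g := LinearMap.restrict
    { toFun := fun (f : G → V) => (fun x => f (x * g))
      map_add' := fun _ _ => rfl
      map_smul' := fun _ _ => by rfl } (fun f hf => hC g f hf)
  map_one' := by
    apply LinearMap.ext
    intro f
    apply Subtype.ext
    funext x
    simp [LinearMap.restrict_apply]
  map_mul' := by
    intro g g'
    apply LinearMap.ext
    intro f
    apply Subtype.ext
    funext x
    simp [LinearMap.restrict_apply, mul_assoc]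

/-- The space of the representation of `G` induced from a representation `τ` of a
subgroup `P`. -/
def indCarrier {W : Type} [AddCommGroup W] [Module R W]
    (P : Subgroup G) (τ : Representation R ↥P W) : Submodule R (G → W) where
  carrier := {f | ∀ (p : ↥P) (g : G), f (↑p * g) = τ p (f g)}
  add_mem' := by
    intro f₁ f₂ h₁ h₂ p g
    simp [h₁ p g, h₂ p g]
  zero_mem' := by intro p g; simp
  smul_mem' := by
    intro c f hf p g
    simp [hf p g]

/-- The representation of `G` induced from a representation `τ` of a subgroup `P`,
realized on functions `f : G → W` with `f (p * g) = τ p (f g)`, with `G` acting by right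
translation. -/
def inducedRep {W : Type} [AddCommGroup W] [Module R W]
    (P : Subgroup G) (τ : Representation R ↥P W) :
    Representation R G ↥(indCarrier P τ) :=
  rightRegular (indCarrier P τ) (by
    intro g f hf p x
    simpa [mul_assoc] using hf p (x * g))

end RightRegular
section GLdefs

variable (k₀ k : Type) [Field k₀] [Field k] [Algebra k₀ k]

/-- `GL n k₀` as a subgroup of `GL n k`:  the image of the entrywise inclusion. -/
def glBase (n : ℕ) : Subgroup (GL (Fin n) k) :=
  (Units.map ((algebraMap k₀ k).mapMatrix.toMonoidHom :
      Matrix (Fin n) (Fin n) k₀ →* Matrix (Fin n) (Fin n) k)).range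

/-- The entrywise action of a field automorphism on `GL n k`. -/
def glAut (σ : k ≃ₐ[k₀] k) (n : ℕ) : GL (Fin n) k →* GL (Fin n) k :=
  Units.map (((σ : k →+* k).mapMatrix).toMonoidHom :
      Matrix (Fin n) (Fin n) k →* Matrix (Fin n) (Fin n) k)

end GLdefs
section Parabolic

variable (k : Type) [Field k]

/-- The block upper-triangular parabolic subgroup of `GL n k` attached to a
block function `B`. -/
def parabolic (n r : ℕ) (B : Fin n → Fin r) : Subgroup (GL (Fin n) k) where
  carrier := {g | Matrix.BlockTriangular (g : Matrix (Fin n) (Fin n) k) B}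
  one_mem' := by
    simpa using Matrix.blockTriangular_one (b := B)
  mul_mem' := by
    intro a b ha hb
    have h : ((a * b : GL (Fin n) k) : Matrix (Fin n) (Fin n) k)
        = (a : Matrix (Fin n) (Fin n) k) * (b : Matrix (Fin n) (Fin n) k) := rfl
    simpa [Set.mem_setOf_eq, h] using Matrix.BlockTriangular.mul ha hb
  inv_mem' := by
    intro a ha
    have h : ((a⁻¹ : GL (Fin n) k) : Matrix (Fin n) (Fin n) k)
        = (a : Matrix (Fin n) (Fin n) k)⁻¹ := by
      simp [Matrix.coe_units_inv]
    haveI : Invertible (a : Matrix (Fin n) (Fin n) k) := a.invertible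
    simpa [Set.mem_setOf_eq, h] using Matrix.blockTriangular_inv_of_blockTriangular ha

/-- A representation of `GL n k` is supercuspidal if it does not occur as a subquotient of
any representation induced from a proper parabolic subgroup, from a representation inflated
from the corresponding block-diagonal Levi subgroup (i.e. trivial on the unipotent radical). -/
def IsSupercuspidal {R : Type} [CommRing R] {n : ℕ} {V : Type} [AddCommGroup V] [Module R V]
    (ρ : Representation R (GL (Fin n) k) V) : Prop :=
  ∀ (r : ℕ), 2 ≤ r → ∀ B : Fin n → Fin r, Monotone B → Function.Surjective B →
    ∀ (W : Type) [AddCommGroup W] [Module R W],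
      ∀ τ : Representation R ↥(parabolic k n r B) W,
        (∀ u : ↥(parabolic k n r B),
            (∀ i j : Fin n, B i = B j →
              ((u : GL (Fin n) k) : Matrix (Fin n) (Fin n) k) i j
                = (1 : Matrix (Fin n) (Fin n) k) i j) → τ u = 1) →
        ¬ IsSubquotientOf ρ (inducedRep (parabolic k n r B) τ)

/-- A representation of `GL n k` is cuspidal if it has no nonzero vector invariant under the
unipotent radical of a proper (maximal) parabolic subgroup. -/
def IsCuspidal {R : Type} [CommRing R] {n : ℕ} {V : Type} [AddCommGroup V] [Module R V]
    (ρ : Representation R (GL (Fin n) k) V) : Prop :=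
  ∀ a b : ℕ, 0 < a → 0 < b → a + b = n →
    ∀ v : V,
      (∀ g : GL (Fin n) k,
        (∀ i j : Fin n, ¬((i : ℕ) < a ∧ a ≤ (j : ℕ)) →
          (g : Matrix (Fin n) (Fin n) k) i j = (1 : Matrix (Fin n) (Fin n) k) i j) →
        ρ g v = v) → v = 0

end Parabolic

section GroupAlgebra

open scoped MonoidAlgebra

variable {A B G : Type*} [CommRing A] [CommRing B]

/-- Transport of an element of a group algebra along a map of groups and a map of coefficients. -/
noncomputable def pushHom (f : A →+* B) (φ : G → G) : A[G] →+ B[G] where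
  toFun x := MonoidAlgebra.map f.toAddMonoidHom (MonoidAlgebra.mapDomain φ x)
  map_zero' := by simp
  map_add' x y := by rw [MonoidAlgebra.mapDomain_add, MonoidAlgebra.map_add]

@[simp]
lemma pushHom_single (f : A →+* B) (φ : G → G) (g : G) (a : A) :
    pushHom f φ (MonoidAlgebra.single g a) = MonoidAlgebra.single (φ g) (f a) := by
  simp [pushHom]

variable [Group G]

lemma pushHom_smul (f : A →+* B) (φ : G → G) (a : A) (x : A[G]) :
    pushHom f φ (a • x) = f a • pushHom f φ x := by
  induction x using MonoidAlgebra.induction_linear with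
  | zero => simp
  | add x y hx hy => rw [smul_add, map_add, hx, hy, map_add, smul_add]
  | single g b => simp [pushHom_single]

lemma pushHom_mul (f : A →+* B) {φ : G → G} (hφ : ∀ g h, φ (g * h) = φ h * φ g) (x y : A[G]) :
    pushHom f φ (x * y) = pushHom f φ y * pushHom f φ x := by
  induction x using MonoidAlgebra.induction_linear with
  | zero => simp
  | add x x' hx hx' => simp [add_mul, mul_add, hx, hx']
  | single g a =>
    induction y using MonoidAlgebra.induction_linear with
    | zero => simp
    | add y y' hy hy' => simp [add_mul, mul_add, hy, hy']
    | single h b => simp [hφ, mul_comm]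

lemma pushHom_pushHom {C : Type*} [CommRing C] (f : A →+* B) (f' : B →+* C) (φ φ' : G → G)
    (x : A[G]) : pushHom f' φ' (pushHom f φ x) = pushHom (f'.comp f) (φ' ∘ φ) x := by
  induction x using MonoidAlgebra.induction_linear with
  | zero => simp
  | add x x' hx hx' => simp [hx, hx']
  | single g a => simp

lemma pushHom_id_id (x : A[G]) : pushHom (RingHom.id A) id x = x := by
  induction x using MonoidAlgebra.induction_linear with
  | zero => simp
  | add x x' hx hx' => simp [hx, hx']
  | single g a => simp

/-- The coefficient of the identity, the canonical trace on a group algebra. -/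
noncomputable def coeffOne : A[G] →ₗ[A] A where
  toFun x := x.coeff 1
  map_add' x y := by rw [MonoidAlgebra.coeff_add, Finsupp.add_apply]
  map_smul' c x := by rw [MonoidAlgebra.coeff_smul, Finsupp.smul_apply, RingHom.id_apply]

lemma coeffOne_apply (x : A[G]) : coeffOne x = x.coeff 1 := rfl

lemma coeffOne_single (g : G) (a : A) [Decidable (g = 1)] :
    coeffOne (MonoidAlgebra.single g a) = if g = 1 then a else 0 := by
  rw [coeffOne_apply, MonoidAlgebra.coeff_single, Finsupp.single_apply]

lemma coeffOne_mul_comm (x y : A[G]) : coeffOne (x * y) = coeffOne (y * x) := by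
  classical
  induction x using MonoidAlgebra.induction_linear with
  | zero => simp
  | add x x' hx hx' => simp [add_mul, mul_add, hx, hx']
  | single g a =>
    induction y using MonoidAlgebra.induction_linear with
    | zero => simp
    | add y y' hy hy' => simp [add_mul, mul_add, hy, hy']
    | single h b =>
      have : g * h = 1 ↔ h * g = 1 := mul_eq_one_comm
      simp only [MonoidAlgebra.single_mul_single, coeffOne_single, this, mul_comm a b]

lemma coeffOne_of_inv_mul (g : G) (x : A[G]) :
    coeffOne (MonoidAlgebra.of A G g⁻¹ * x) = x.coeff g := by
  classical
  rw [coeffOne_apply, MonoidAlgebra.of_apply, MonoidAlgebra.coeff_single_mul_apply]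
  simp

variable [Fintype G] (s : G →* G)

/-- The number of solutions of `x * s x = g`, extended linearly to the group algebra. -/
noncomputable def normCount : A[G] →+ A where
  toFun z := ∑ x : G, coeffOne
    (MonoidAlgebra.of A G x⁻¹ * z * MonoidAlgebra.of A G (s x)⁻¹)
  map_zero' := by simp
  map_add' x y := by simp [mul_add, add_mul, Finset.sum_add_distrib]

lemma normCount_apply (z : A[G]) : normCount s z =
    ∑ x : G, coeffOne (MonoidAlgebra.of A G x⁻¹ * z * MonoidAlgebra.of A G (s x)⁻¹) := rfl

lemma normCount_mul_push (a b : A[G]) :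
    normCount s (a * pushHom (RingHom.id A) (fun g => (s g)⁻¹) b) =
      ∑ x : G, coeffOne
        (MonoidAlgebra.of A G x⁻¹ * a * MonoidAlgebra.of A G (s x)⁻¹ * b) := by
  induction b using MonoidAlgebra.induction_linear with
  | zero => simp
  | add b b' h h' => simp only [map_add, mul_add, h, h', Finset.sum_add_distrib]
  | single h c =>
    rw [normCount_apply, ← Equiv.sum_comp (Equiv.mulRight h) (fun x => coeffOne
        (MonoidAlgebra.of A G x⁻¹ * a * MonoidAlgebra.of A G (s x)⁻¹ * MonoidAlgebra.single h c))]
    refine Finset.sum_congr rfl fun x _ => ?_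
    have e : MonoidAlgebra.single h c = c • MonoidAlgebra.of A G h := by simp
    have e' : MonoidAlgebra.single (s h)⁻¹ c = c • MonoidAlgebra.of A G (s h)⁻¹ := by simp
    rw [pushHom_single, RingHom.id_apply, Equiv.coe_mulRight, e, e']
    simp only [mul_smul_comm, smul_mul_assoc, map_smul]
    congr 1
    rw [coeffOne_mul_comm _ (MonoidAlgebra.of A G h)]
    have e1 : MonoidAlgebra.of A G (x * h)⁻¹ =
        MonoidAlgebra.of A G h⁻¹ * MonoidAlgebra.of A G x⁻¹ := by
      rw [← MonoidHom.map_mul, _root_.mul_inv_rev]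
    have e2 : MonoidAlgebra.of A G (s (x * h))⁻¹ =
        MonoidAlgebra.of A G (s h)⁻¹ * MonoidAlgebra.of A G (s x)⁻¹ := by
      rw [← MonoidHom.map_mul, MonoidHom.map_mul s, _root_.mul_inv_rev]
    have e3 : MonoidAlgebra.of A G h * MonoidAlgebra.of A G h⁻¹ = 1 := by
      rw [← MonoidHom.map_mul, mul_inv_cancel, MonoidHom.map_one]
    rw [e1, e2]
    simp only [← mul_assoc, e3, one_mul]

lemma normCount_single [DecidableEq G] (g : G) (a : A) :
    normCount s (MonoidAlgebra.single g a) = Nat.card {y : G // y * s y = g} * a := by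
  rw [normCount_apply, Nat.card_eq_fintype_card, Fintype.card_subtype, Finset.card_filter,
    Nat.cast_sum, Finset.sum_mul]
  refine Finset.sum_congr rfl fun x _ => ?_
  have : x⁻¹ * g * (s x)⁻¹ = 1 ↔ x * s x = g := by
    rw [mul_inv_eq_one, inv_mul_eq_iff_eq_mul, eq_comm]
  simp [MonoidAlgebra.single_mul_single, coeffOne_single, this]

variable {X : Type*} [Fintype X] [DecidableEq X] [MulAction G X]

/-- The permutation representation on `X`, as a map from the group algebra to matrices. -/
noncomputable def permMat (A G X : Type*) [CommRing A] [Group G] [Fintype X] [DecidableEq X]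
    [MulAction G X] : A[G] →ₐ[A] Matrix X X A :=
  MonoidAlgebra.lift A _ G
    { toFun := fun g => Matrix.of fun x y => if x = g • y then 1 else 0
      map_one' := by ext; simp [Matrix.one_apply]
      map_mul' := fun g h => by
        ext x y
        simp [Matrix.mul_apply, mul_smul] }

omit [Fintype G] in
lemma permMat_single (g : G) (a : A) (x y : X) :
    permMat A G X (MonoidAlgebra.single g a) x y = if x = g • y then a else 0 := by
  simp [permMat]

omit [Fintype G] in
lemma trace_permMat_single (g : G) (a : A) :
    (permMat A G X (MonoidAlgebra.single g a)).trace = Nat.card {x : X // g • x = x} * a := by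
  rw [Matrix.trace, Nat.card_eq_fintype_card, Fintype.card_subtype, Finset.card_filter,
    Nat.cast_sum, Finset.sum_mul]
  refine Finset.sum_congr rfl fun x _ => ?_
  simp [permMat_single, eq_comm]

lemma trace_permMat (hX : ∀ g : G, Nat.card {y : G // y * s y = g} =
    Nat.card {x : X // g • x = x}) (z : A[G]) : (permMat A G X z).trace = normCount s z := by
  classical
  induction z using MonoidAlgebra.induction_linear with
  | zero => simp
  | add b b' h h' => simp [h, h']
  | single g a => rw [trace_permMat_single, normCount_single, hX]

omit [Fintype G] in
lemma permMat_pushHom (f : A →+* B) (z : A[G]) :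
    permMat B G X (pushHom f id z) = (permMat A G X z).map f := by
  induction z using MonoidAlgebra.induction_linear with
  | zero => ext; simp
  | add b b' h h' => ext; simp [h, h']
  | single g a =>
    ext x y
    simp [permMat_single, apply_ite f]

omit [Fintype G] in
lemma permMat_conj (z : ℂ[G]) :
    permMat ℂ G X (pushHom (starRingEnd ℂ) (fun g => g⁻¹) z) = (permMat ℂ G X z)ᴴ := by
  induction z using MonoidAlgebra.induction_linear with
  | zero => simp
  | add b b' h h' => simp [h, h']
  | single g a =>
    ext x y
    simp [permMat_single, apply_ite (starRingEnd ℂ), eq_inv_smul_iff, eq_comm]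

lemma coeffOne_conj_mul (w z : ℂ[G]) :
    coeffOne (pushHom (starRingEnd ℂ) (fun g => g⁻¹) w * z) =
      ∑ g : G, starRingEnd ℂ (w.coeff g) * z.coeff g := by
  classical
  induction w using MonoidAlgebra.induction_linear with
  | zero => simp
  | add b b' h h' => simp [add_mul, h, h', Finset.sum_add_distrib]
  | single g a =>
    have e : MonoidAlgebra.single g⁻¹ (starRingEnd ℂ a) =
      starRingEnd ℂ a • MonoidAlgebra.of ℂ G g⁻¹ := by simp
    rw [pushHom_single, e, smul_mul_assoc, map_smul, coeffOne_of_inv_mul,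
      Finset.sum_eq_single g]
    · simp
    · intro b _ hb
      simp [hb.symm]
    · simp

lemma eq_zero_of_sum_coeffOne_conj_mul {ι : Type*} [Fintype ι] (h : ι → ℂ[G])
    (h0 : ∑ x, coeffOne (pushHom (starRingEnd ℂ) (fun g => g⁻¹) (h x) * h x) = 0) (x : ι) :
    h x = 0 := by
  simp_rw [coeffOne_conj_mul, ← Complex.normSq_eq_conj_mul_self, ← Complex.ofReal_sum] at h0
  rw [Complex.ofReal_eq_zero, Finset.sum_eq_zero_iff_of_nonneg
    (fun _ _ => Finset.sum_nonneg fun _ _ => Complex.normSq_nonneg _)] at h0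
  have h1 := h0 x (Finset.mem_univ _)
  rw [Finset.sum_eq_zero_iff_of_nonneg (fun _ _ => Complex.normSq_nonneg _)] at h1
  ext g
  simpa using h1 g (Finset.mem_univ _)

end GroupAlgebra

section GelfandTrick

open scoped MonoidAlgebra

variable {G : Type*} [Group G]

/-- The linear extension of `g ↦ (s g)⁻¹`. -/
noncomputable abbrev thetaMap (A : Type*) [CommRing A] (s : G →* G) : A[G] →+ A[G] :=
  pushHom (RingHom.id A) (fun g => (s g)⁻¹)

/-- The conjugate-linear extension of the inversion. -/
noncomputable abbrev conjMap : ℂ[G] →+ ℂ[G] := pushHom (starRingEnd ℂ) (fun g => g⁻¹)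

/-- An idempotent of the complex group algebra, stable under the relevant anti-involutions, for
which the Gelfand trick shows that the Hecke algebra is commutative. -/
structure GelfandIdempotent (s : G →* G) (st : G → G) (e : ℂ[G]) : Prop where
  map_map : ∀ g, s (s g) = g
  st_mul : ∀ g h, st (g * h) = st h * st g
  map_st : ∀ g, s (st g) = st (s g)
  st_st : ∀ g, st (st g) = g
  idem : e * e = e
  conj : conjMap e = e
  theta : thetaMap ℂ s e = e
  star : pushHom (RingHom.id ℂ) st e = e
  sandwich : ∀ z, e * z * e = e * pushHom (RingHom.id ℂ) st z * e

namespace GelfandIdempotent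

variable {s : G →* G} {st : G → G} {e : ℂ[G]} (D : GelfandIdempotent s st e)
include D

lemma left_eq {a : ℂ[G]} (ha : e * a * e = a) : e * a = a := by
  rw [← ha, ← mul_assoc, ← mul_assoc, D.idem]

lemma right_eq {a : ℂ[G]} (ha : e * a * e = a) : a * e = a := by
  rw [← ha, mul_assoc, D.idem]

lemma mem_sandwich (z : ℂ[G]) : e * (e * z * e) * e = e * z * e := by
  simp only [← mul_assoc, D.idem]
  rw [mul_assoc _ e e, D.idem]

lemma mem_mul {a b : ℂ[G]} (ha : e * a * e = a) (hb : e * b * e = b) :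
    e * (a * b) * e = a * b := by
  rw [← mul_assoc, D.left_eq ha, mul_assoc, D.right_eq hb]

lemma star_eq {a : ℂ[G]} (ha : e * a * e = a) : pushHom (RingHom.id ℂ) st a = a := by
  nth_rw 1 [← ha]
  rw [pushHom_mul _ D.st_mul, pushHom_mul _ D.st_mul, D.star, ← mul_assoc, ← D.sandwich, ha]

lemma comm {a b : ℂ[G]} (ha : e * a * e = a) (hb : e * b * e = b) : a * b = b * a := by
  rw [← D.star_eq (D.mem_mul ha hb), pushHom_mul _ D.st_mul, D.star_eq ha, D.star_eq hb]

omit D in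
lemma conjMap_mul (a b : ℂ[G]) : conjMap (a * b) = conjMap b * conjMap a :=
  pushHom_mul _ (fun g h => _root_.mul_inv_rev g h) a b

omit D in
lemma conjMap_conjMap (a : ℂ[G]) : conjMap (conjMap a) = a := by
  have h1 : (starRingEnd ℂ).comp (starRingEnd ℂ) = RingHom.id ℂ := by ext; simp
  have h2 : (fun g : G => g⁻¹) ∘ (fun g : G => g⁻¹) = id := by ext; simp
  rw [conjMap, pushHom_pushHom, h1, h2, pushHom_id_id]

omit D in
lemma thetaMap_mul (A : Type*) [CommRing A] (a b : A[G]) :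
    thetaMap A s (a * b) = thetaMap A s b * thetaMap A s a :=
  pushHom_mul _ (fun g h => by rw [map_mul, _root_.mul_inv_rev]) a b

omit D in
lemma thetaMap_of (A : Type*) [CommRing A] (g : G) :
    thetaMap A s (MonoidAlgebra.of A G g) = MonoidAlgebra.of A G (s g)⁻¹ := by
  simp

lemma mem_conj {a : ℂ[G]} (ha : e * a * e = a) : e * conjMap a * e = conjMap a := by
  nth_rw 2 [← ha]
  rw [conjMap_mul, conjMap_mul, D.conj, mul_assoc]

lemma mem_theta {a : ℂ[G]} (ha : e * a * e = a) : e * thetaMap ℂ s a * e = thetaMap ℂ s a := by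
  nth_rw 2 [← ha]
  rw [thetaMap_mul, thetaMap_mul, D.theta, mul_assoc]

variable [Fintype G]

lemma normCount_theta {a b : ℂ[G]} (ha : e * a * e = a) (hb : e * b * e = b) :
    normCount s (a * thetaMap ℂ s b) = normCount s (a * b) := by
  have h1 : a * b = a * b * thetaMap ℂ s e := by rw [D.theta, mul_assoc, D.right_eq hb]
  rw [h1, normCount_mul_push, normCount_mul_push]
  refine Finset.sum_congr rfl fun x _ => ?_
  set u := MonoidAlgebra.of ℂ G (s x)⁻¹
  have h2 : a * u * b = a * b * u * e := by
    calc a * u * b = a * (e * u * e * b) := by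
          rw [mul_assoc (e * u), D.left_eq hb, mul_assoc e, ← mul_assoc a, D.right_eq ha, mul_assoc]
      _ = a * (b * (e * u * e)) := by rw [D.comm (D.mem_sandwich u) hb]
      _ = a * b * u * e := by
          simp only [← mul_assoc]
          rw [mul_assoc a b e, D.right_eq hb]
  simp only [mul_assoc] at h2 ⊢
  rw [h2]

variable {X : Type*} [Fintype X] [DecidableEq X] [MulAction G X]

open scoped ComplexOrder in
lemma permMat_sub_theta (hX : ∀ g : G, Nat.card {y : G // y * s y = g} =
    Nat.card {x : X // g • x = x}) {b : ℂ[G]} (hb : e * b * e = b) :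
    permMat ℂ G X (b - thetaMap ℂ s b) = 0 := by
  set w := b - thetaMap ℂ s b with hw
  have hwm : e * w * e = w := by rw [hw, mul_sub, sub_mul, hb, D.mem_theta hb]
  have h0 : normCount s (conjMap w * w) = 0 := by
    rw [hw, mul_sub, map_sub, ← hw, D.normCount_theta (D.mem_conj hwm) hb, sub_self]
  rw [← trace_permMat s hX, map_mul, permMat_conj] at h0
  exact Matrix.trace_conjTranspose_mul_self_eq_zero_iff.1 h0

set_option maxHeartbeats 800000 in
lemma sum_coeff_twisted_eq_zero (hX : ∀ g : G, Nat.card {y : G // y * s y = g} =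
    Nat.card {x : X // g • x = x}) {y : ℂ[G]} (hy : e * y * e = y)
    (h0 : permMat ℂ G X y = 0) (g : G) :
    ∑ x : G, y.coeff ((s (st x))⁻¹ * g * x⁻¹) = 0 := by
  let c₀ : ℂ[G] := ∑ x : G, MonoidAlgebra.of ℂ G ((s (st x))⁻¹ * g * x⁻¹)⁻¹
  have hc₀ : ∀ b : ℂ[G], c₀ * thetaMap ℂ s (pushHom (RingHom.id ℂ) st b) = b * c₀ := by
    intro b
    induction b using MonoidAlgebra.induction_linear with
    | zero => simp
    | add b b' h h' => simp [mul_add, add_mul, h, h']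
    | single h a =>
      have e1 : MonoidAlgebra.single h a = a • MonoidAlgebra.of ℂ G h := by simp
      have e2 : MonoidAlgebra.single (s (st h))⁻¹ a = a • MonoidAlgebra.of ℂ G (s (st h))⁻¹ := by
        simp
      rw [pushHom_single, pushHom_single, RingHom.id_apply, RingHom.id_apply, e1, e2,
        mul_smul_comm, smul_mul_assoc, Finset.sum_mul, Finset.mul_sum]
      congr 1
      refine Fintype.sum_equiv (Equiv.mulLeft h⁻¹) _ _ fun x => ?_
      rw [Equiv.coe_mulLeft, D.st_mul]
      have hi : s (st h⁻¹) = (s (st h))⁻¹ := by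
        have : st h⁻¹ * st h = 1 := by
          rw [← D.st_mul, mul_inv_cancel]
          have := D.st_mul 1 1
          rw [one_mul] at this
          exact left_eq_mul.1 this
        rw [eq_inv_iff_mul_eq_one, ← map_mul, this, map_one]
      rw [map_mul s, hi, ← map_mul, ← map_mul]
      congr 1
      group
  let c := e * c₀ * e
  have hc : e * c * e = c := D.mem_sandwich c₀
  have hyc : coeffOne (y * c) = ∑ x : G, y.coeff ((s (st x))⁻¹ * g * x⁻¹) := by
    have h1 : coeffOne (y * c) = coeffOne (y * c₀) := by
      rw [← mul_assoc, ← mul_assoc, coeffOne_mul_comm, ← mul_assoc, ← mul_assoc, hy]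
    rw [h1, Finset.mul_sum, map_sum]
    refine Finset.sum_congr rfl fun x _ => ?_
    rw [coeffOne_mul_comm, coeffOne_of_inv_mul]
  have hcb : ∀ b, e * b * e = b → c * thetaMap ℂ s b = c * b := by
    intro b hb
    have h1 := hc₀ b
    rw [D.star_eq hb] at h1
    calc c * thetaMap ℂ s b = e * (c₀ * thetaMap ℂ s b) * e := by
          rw [mul_assoc (e * c₀), D.left_eq (D.mem_theta hb), mul_assoc, mul_assoc, mul_assoc,
            D.right_eq (D.mem_theta hb)]
      _ = b * c := by rw [h1, ← mul_assoc, D.left_eq hb, ← mul_assoc, ← mul_assoc, D.right_eq hb]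
      _ = c * b := D.comm hb hc
  set f := y * c with hf
  have hfm : e * f * e = f := D.mem_mul hy hc
  have hcf : conjMap f * f = f * conjMap f := D.comm (D.mem_conj hfm) hfm
  have key : ∑ x : G, coeffOne (conjMap (conjMap f * MonoidAlgebra.of ℂ G x * e) *
      (conjMap f * MonoidAlgebra.of ℂ G x * e)) = normCount s (f * conjMap f) := by
    have h1 : f * conjMap f = f * conjMap f * thetaMap ℂ s e := by
      rw [D.theta]
      exact ((mul_assoc f _ _).trans (by rw [D.right_eq (D.mem_conj hfm)])).symm
    rw [h1, normCount_mul_push]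
    refine Finset.sum_congr rfl fun x _ => ?_
    have hff : f * conjMap f = y * conjMap f * c := by
      rw [hf, mul_assoc, D.comm hc (by rw [← hf]; exact D.mem_conj hfm), mul_assoc]
    have hffe : f * conjMap f * e = f * conjMap f := by
      rw [mul_assoc, D.right_eq (D.mem_conj hfm)]
    have hb := hcb _ (D.mem_sandwich (MonoidAlgebra.of ℂ G x))
    rw [thetaMap_mul, thetaMap_mul, D.theta, thetaMap_of] at hb
    have h2 : f * conjMap f * MonoidAlgebra.of ℂ G (s x)⁻¹ * e =
        f * conjMap f * MonoidAlgebra.of ℂ G x * e := by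
      have h3 : ∀ z, f * conjMap f * z = y * conjMap f * (c * (e * z)) := fun z => by
        rw [← mul_assoc c, D.right_eq hc, ← mul_assoc, ← hff]
      rw [mul_assoc (f * conjMap f), mul_assoc (f * conjMap f), h3, h3, ← mul_assoc e (MonoidAlgebra.of ℂ G x),
        ← hb]
    have h4 : conjMap (conjMap f * MonoidAlgebra.of ℂ G x * e) =
        e * (MonoidAlgebra.of ℂ G x⁻¹ * f) := by
      rw [conjMap_mul, conjMap_mul, conjMap_conjMap, D.conj]
      congr 2
      simp
    have h5 : conjMap (conjMap f * MonoidAlgebra.of ℂ G x * e) *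
        (conjMap f * MonoidAlgebra.of ℂ G x * e) =
        e * (MonoidAlgebra.of ℂ G x⁻¹ * (f * conjMap f * MonoidAlgebra.of ℂ G x * e)) := by
      rw [h4]
      simp only [mul_assoc]
    rw [h5, coeffOne_mul_comm e, ← h2]
    simp only [mul_assoc, D.idem]
  have hz : normCount s (f * conjMap f) = 0 := by
    rw [← trace_permMat s hX, hf, mul_assoc, map_mul, h0, zero_mul, Matrix.trace_zero]
  have h1 := eq_zero_of_sum_coeffOne_conj_mul _ (key.trans hz) 1
  rw [map_one, mul_one, D.right_eq (D.mem_conj hfm)] at h1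
  rw [← hyc, ← conjMap_conjMap f, h1, map_zero, map_zero]

end GelfandIdempotent

end GelfandTrick

section QuadraticExtension

variable {k₀ k : Type} [Field k₀] [Field k] [Fintype k] [Algebra k₀ k]

lemma aut_sq_of_finrank_two (hquad : Module.finrank k₀ k = 2) (σ : k ≃ₐ[k₀] k) (x : k) :
    σ (σ x) = x := by
  have hc : Nat.card (k ≃ₐ[k₀] k) = 2 := by rw [IsGalois.card_aut_eq_finrank, hquad]
  have h : σ ^ 2 = 1 := by rw [← hc]; exact pow_card_eq_one'
  have := DFunLike.congr_fun h x
  simpa [pow_two] using this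

lemma mem_range_of_fixed (hquad : Module.finrank k₀ k = 2) (σ : k ≃ₐ[k₀] k)
    (hσ : σ ≠ AlgEquiv.refl) {x : k} (hx : σ x = x) : x ∈ Set.range (algebraMap k₀ k) := by
  have hc : Nat.card (k ≃ₐ[k₀] k) = 2 := by rw [IsGalois.card_aut_eq_finrank, hquad]
  rw [IsGalois.mem_range_algebraMap_iff_fixed]
  intro f
  have h := (Nat.card_eq_two_iff' (1 : k ≃ₐ[k₀] k)).1 hc
  by_cases hf : f = 1
  · simp [hf]
  · rw [h.unique hf hσ, hx]

end QuadraticExtension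

section NormForm

/-- The norm form of a quadratic algebra represents every unit of a finite commutative algebra. -/
lemma exists_quadForm_eq_of_field {F : Type*} [Field F] [Finite F] (s d b : F)
    (h : s ^ 2 - 4 * d ≠ 0) : ∃ α β : F, α ^ 2 + s * α * β + d * β ^ 2 = b := by
  classical
  have := Fintype.ofFinite F
  by_cases h2 : ringChar F = 2
  · obtain ⟨a, ha⟩ := FiniteField.isSquare_of_char_two h2 b
    exact ⟨a, 0, by rw [ha]; ring⟩
  · have h4 : (2 : F) ≠ 0 := Ring.two_ne_zero h2
    open Polynomial in
    obtain ⟨x, y, hxy⟩ := FiniteField.exists_root_sum_quadratic (R := F)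
      (f := C 1 * X ^ 2 + C 0 * X + C (-4 * b)) (g := C (4 * d - s ^ 2) * X ^ 2 + C 0 * X + C 0)
      (degree_quadratic one_ne_zero)
      (degree_quadratic (by intro h'; apply h; linear_combination - h'))
      (FiniteField.odd_card_of_char_ne_two h2)
    simp only [Polynomial.eval_add, Polynomial.eval_mul, Polynomial.eval_C, Polynomial.eval_pow,
      Polynomial.eval_X] at hxy
    refine ⟨(x - s * y) / 2, y, ?_⟩
    field_simp
    linear_combination hxy

lemma exists_sub_mem_maximalIdeals {B : Type*} [CommRing B] [Finite B]
    (a : MaximalSpectrum B → B) : ∃ α : B, ∀ I : MaximalSpectrum B, α - a I ∈ I.asIdeal := by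
  obtain ⟨q, hq⟩ := (IsArtinianRing.quotNilradicalEquivPi B).surjective
    (fun I => Ideal.Quotient.mk _ (a I))
  obtain ⟨α, rfl⟩ := Ideal.Quotient.mk_surjective q
  refine ⟨α, fun I => ?_⟩
  rw [← Ideal.Quotient.eq]
  exact congrFun hq I

lemma exists_quadForm_eq_one_add {B : Type*} [CommRing B] [IsArtinianRing B] {s d ν : B}
    (h : IsUnit s ∨ IsUnit (2 : B)) (hν : IsNilpotent ν) :
    ∃ α β : B, α ^ 2 + s * α * β + d * β ^ 2 = 1 + ν := by
  open Polynomial in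
  rcases h with h | h
  · obtain ⟨r, ⟨-, hr⟩, -⟩ := existsUnique_nilpotent_sub_and_aeval_eq_zero
      (P := C d * X ^ 2 + C s * X - C ν) (x := (0 : B)) (by simpa) (by simpa)
    refine ⟨1, r, ?_⟩
    simp at hr
    linear_combination hr
  · obtain ⟨r, ⟨-, hr⟩, -⟩ := existsUnique_nilpotent_sub_and_aeval_eq_zero
      (P := X ^ 2 - C (1 + ν)) (x := (1 : B)) (by simpa [sub_add_eq_sub_sub]) (by simpa [one_add_one_eq_two] using h)
    refine ⟨r, 0, ?_⟩
    simp at hr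
    linear_combination hr

lemma exists_quadForm_eq {B : Type*} [CommRing B] [Finite B] {s d b : B}
    (h : IsUnit (s ^ 2 - 4 * d)) (hs : IsUnit s ∨ IsUnit (2 : B)) (hb : IsUnit b) :
    ∃ α β : B, α ^ 2 + s * α * β + d * β ^ 2 = b := by
  have key : ∀ I : MaximalSpectrum B, ∃ α β : B,
      α ^ 2 + s * α * β + d * β ^ 2 - b ∈ I.asIdeal := by
    intro I
    let _ := Ideal.Quotient.field I.asIdeal
    have : Finite (B ⧸ I.asIdeal) := Quotient.finite _
    obtain ⟨α, β, e⟩ := exists_quadForm_eq_of_field (Ideal.Quotient.mk I.asIdeal s)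
      (Ideal.Quotient.mk I.asIdeal d) (Ideal.Quotient.mk I.asIdeal b)
      (by simpa [map_ofNat] using (h.map (Ideal.Quotient.mk I.asIdeal)).ne_zero)
    obtain ⟨α, rfl⟩ := Ideal.Quotient.mk_surjective α
    obtain ⟨β, rfl⟩ := Ideal.Quotient.mk_surjective β
    exact ⟨α, β, by rw [← Ideal.Quotient.eq]; simpa using e⟩
  choose α β hαβ using key
  obtain ⟨α', hα⟩ := exists_sub_mem_maximalIdeals α
  obtain ⟨β', hβ⟩ := exists_sub_mem_maximalIdeals β
  obtain ⟨c, hc⟩ : ∃ c, α' ^ 2 + s * α' * β' + d * β' ^ 2 = c := ⟨_, rfl⟩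
  have hnil : IsNilpotent (b - c) := by
    rw [← mem_nilradical, IsArtinianRing.nilradical_eq_iInf, Submodule.mem_iInf]
    intro I
    have h1 := hαβ I
    have h2 := hα I
    have h3 := hβ I
    rw [← Ideal.Quotient.eq] at *
    simp only [map_add, map_mul, map_pow, ← hc] at *
    rw [h2, h3, h1]
  have hcu : IsUnit c := by
    have : IsUnit (b + -(b - c)) :=
      IsNilpotent.isUnit_add_left_of_commute hnil.neg hb (Commute.all _ _)
    simpa using this
  obtain ⟨u, rfl⟩ := hcu
  obtain ⟨x, y, hxy⟩ := exists_quadForm_eq_one_add (d := d) hs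
    ((Commute.all (b - u) (↑u⁻¹ : B)).isNilpotent_mul_right hnil)
  refine ⟨α' * x - d * β' * y, α' * y + β' * x + s * β' * y, ?_⟩
  have hb' : b = u * (1 + (b - u) * (↑u⁻¹ : B)) := by
    linear_combination (b - u) * (-(u.mul_inv))
  rw [hb', ← hxy, ← hc]
  ring

end NormForm

section NormFibres

variable {k₀ k : Type} [Field k₀] [Field k] [Algebra k₀ k]

lemma mul_map_eq_of_mem_adjoin (σ : k ≃ₐ[k₀] k) {n : ℕ} {g x a : Matrix (Fin n) (Fin n) k}
    (hx : g * x = x * g.map σ) (ha : a ∈ Algebra.adjoin k₀ {g}) : x * a.map σ = a * x := by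
  induction ha using Algebra.adjoin_induction with
  | mem a ha => rw [Set.mem_singleton_iff.1 ha, hx]
  | algebraMap r =>
    have : (algebraMap k₀ (Matrix (Fin n) (Fin n) k) r).map σ = algebraMap k₀ _ r := by
      ext i j
      simp [Matrix.algebraMap_eq_diagonal, Matrix.diagonal_apply]
      split_ifs <;> simp
    rw [this, Algebra.commutes]
  | add a b _ _ iha ihb => rw [Matrix.map_add _ (map_add σ), mul_add, add_mul, iha, ihb]
  | mul a b _ _ iha ihb =>
    have : (a * b).map σ = a.map σ * b.map σ := Matrix.map_mul (f := (σ : k →+* k))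
    rw [this, ← mul_assoc, iha, mul_assoc, ihb, mul_assoc]

variable [Fintype k]

lemma exists_factorization_twisted (hquad : Module.finrank k₀ k = 2) (σ : k ≃ₐ[k₀] k)
    (hσ : σ ≠ AlgEquiv.refl) {n : ℕ} (g : GL (Fin n) k) :
    ∃ r r' : GL (Fin n) k, r * r' = g ∧ r' * r = g ∧
      ∀ x : GL (Fin n) k, g * x = x * glAut k₀ k σ n g → x * glAut k₀ k σ n r = r' * x := by
  obtain ⟨δ, hδ⟩ : ∃ δ : k, σ δ ≠ δ := by
    by_contra! h
    exact hσ (AlgEquiv.ext h)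
  have hσσ := aut_sq_of_finrank_two hquad σ
  obtain ⟨s, hs⟩ := mem_range_of_fixed hquad σ hσ (x := δ + σ δ) (by simp [hσσ, add_comm])
  obtain ⟨d, hd⟩ := mem_range_of_fixed hquad σ hσ (x := δ * σ δ) (by simp [hσσ, mul_comm])
  have hdisc : s ^ 2 - 4 * d ≠ 0 := by
    intro h
    apply hδ
    have := congrArg (algebraMap k₀ k) h
    simp only [map_sub, map_pow, map_mul, hs, hd, map_ofNat, map_zero] at this
    have : (σ δ - δ) ^ 2 = 0 := by linear_combination this
    exact sub_eq_zero.1 (pow_eq_zero_iff two_ne_zero |>.1 this)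
  have hs2 : s ≠ 0 ∨ (2 : k₀) ≠ 0 := by
    by_contra! h
    apply hdisc
    rw [h.1]
    linear_combination (- 2 * d) * h.2
  let B := Algebra.adjoin k₀ {(g : Matrix (Fin n) (Fin n) k)}
  have hcomm := Algebra.isMulCommutative_adjoin k₀ (s := {(g : Matrix (Fin n) (Fin n) k)}) (by
    intro a ha b hb
    rw [Set.mem_singleton_iff.1 ha, Set.mem_singleton_iff.1 hb])
  open scoped IsMulCommutative in
  let gB : B := ⟨g, Algebra.self_mem_adjoin_singleton k₀ _⟩
  have hgB : IsUnit gB := by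
    refine (isUnit_iff_mem_nonZeroDivisors_of_finite).2 ?_
    rw [mem_nonZeroDivisors_iff_right]
    intro x hx
    have h1 : (x : Matrix (Fin n) (Fin n) k) * (g : Matrix (Fin n) (Fin n) k) = 0 :=
      congrArg Subtype.val hx
    exact Subtype.ext ((Units.mul_left_eq_zero g).1 h1)
  have hu : ∀ c : k₀, c ≠ 0 → IsUnit (algebraMap k₀ B c) := fun c hc => hc.isUnit.map _
  obtain ⟨α, β, hαβ⟩ := exists_quadForm_eq (B := B) (s := algebraMap k₀ B s)
    (d := algebraMap k₀ B d) (b := gB) (by simpa [map_ofNat] using hu _ hdisc)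
    (by rcases hs2 with h | h
        · exact Or.inl (hu _ h)
        · right; simpa [map_ofNat] using hu _ h) hgB
  have hαβ' := congrArg Subtype.val hαβ
  have hcαβ : (α : Matrix (Fin n) (Fin n) k) * β = β * α := congrArg Subtype.val (mul_comm α β)
  obtain ⟨a, ha⟩ := α
  obtain ⟨b, hb⟩ := β
  replace hcαβ : b * a = a * b := hcαβ.symm
  have hαβ'' : a ^ 2 + s • (a * b) + d • b ^ 2 = g := by
    simpa [Algebra.smul_def, mul_assoc] using hαβ'
  have hsk : ∀ M : Matrix (Fin n) (Fin n) k, s • M = (δ + σ δ) • M := by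
    intro M; rw [← hs, algebraMap_smul]
  have hdk : ∀ M : Matrix (Fin n) (Fin n) k, d • M = (δ * σ δ) • M := by
    intro M; rw [← hd, algebraMap_smul]
  rw [hsk, hdk] at hαβ''
  have h1 : (a + δ • b) * (a + σ δ • b) = g := by
    rw [← hαβ'']
    simp only [mul_add, add_mul, smul_mul_assoc, mul_smul_comm, hcαβ, pow_two, add_smul, smul_add,
      smul_smul, mul_comm (σ δ) δ]
    abel
  have h2 : (a + σ δ • b) * (a + δ • b) = g := by
    rw [← hαβ'']
    simp only [mul_add, add_mul, smul_mul_assoc, mul_smul_comm, hcαβ, pow_two, add_smul, smul_add,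
      smul_smul]
    abel
  have hdet : IsUnit ((a + δ • b) * (a + σ δ • b)).det := by
    rw [h1]; exact (Matrix.isUnit_iff_isUnit_det _).1 g.isUnit
  rw [Matrix.det_mul] at hdet
  let r : GL (Fin n) k := Matrix.GeneralLinearGroup.mk'' _ (isUnit_of_mul_isUnit_left hdet)
  let r' : GL (Fin n) k := Matrix.GeneralLinearGroup.mk'' _ (isUnit_of_mul_isUnit_right hdet)
  refine ⟨r, r', Units.ext h1, Units.ext h2, fun x hx => Units.ext ?_⟩
  have hx' := congrArg Units.val hx
  change (x : Matrix (Fin n) (Fin n) k) * (a + δ • b).map σ = (a + σ δ • b) * x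
  have e1 := mul_map_eq_of_mem_adjoin σ (x := (x : Matrix (Fin n) (Fin n) k)) hx' ha
  have e2 := mul_map_eq_of_mem_adjoin σ (x := (x : Matrix (Fin n) (Fin n) k)) hx' hb
  rw [Matrix.map_add _ (map_add σ), Matrix.map_smul' _ _ _ (map_mul σ), mul_add, add_mul, e1,
    mul_smul_comm, e2, smul_mul_assoc]

lemma glAut_glAut (hquad : Module.finrank k₀ k = 2) (σ : k ≃ₐ[k₀] k) {n : ℕ}
    (g : GL (Fin n) k) : glAut k₀ k σ n (glAut k₀ k σ n g) = g := by
  apply Units.ext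
  ext i j
  exact aut_sq_of_finrank_two hquad σ _

lemma card_norm_fibre_of_factorization {G : Type*} [Group G] (s : G →* G) (hs : ∀ g, s (s g) = g)
    {g r r' : G} (h1 : r * r' = g) (h2 : r' * r = g)
    (h3 : ∀ x, g * x = x * s g → x * s r = r' * x) :
    Nat.card {y : G // y * s y = g} = Nat.card {x : G // x * s x = 1 ∧ g * x = x * s g} := by
  refine Nat.card_congr
    { toFun := fun y => ⟨y.1 * (s r)⁻¹, ?_⟩, invFun := fun x => ⟨x.1 * s r, ?_⟩,
      left_inv := fun y => by simp, right_inv := fun x => by simp }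
  · obtain ⟨y, hy⟩ := y
    have hgy : g * y = y * s g := by
      rw [← hy, map_mul, hs, mul_assoc]
    have hry := h3 y hgy
    constructor
    · have e : y * (s r)⁻¹ = r'⁻¹ * y := by
        rw [eq_inv_mul_iff_mul_eq, ← mul_assoc, ← hry]; group
      have e2 : s (y * (s r)⁻¹) = s y * r⁻¹ := by rw [map_mul, map_inv, hs]
      rw [e2, e, mul_assoc, ← mul_assoc y, hy, ← h2]
      group
    · have e1 : s g = s r * s r' := by rw [← h1, map_mul]
      have e2 : s g = s r' * s r := by rw [← h2, map_mul]
      calc g * (y * (s r)⁻¹) = y * s g * (s r)⁻¹ := by rw [← hgy]; group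
        _ = y * s r' := by rw [e2]; group
        _ = y * (s r)⁻¹ * s g := by rw [e1]; group
  · obtain ⟨x, hx, hgx⟩ := x
    calc x * s r * s (x * s r) = r' * x * (s x * r) := by rw [h3 x hgx, ← h3 x hgx, map_mul, hs]
      _ = r' * (x * s x) * r := by group
      _ = g := by rw [hx, mul_one, h2]

lemma card_norm_fibre (hquad : Module.finrank k₀ k = 2) (σ : k ≃ₐ[k₀] k)
    (hσ : σ ≠ AlgEquiv.refl) {n : ℕ} (g : GL (Fin n) k) :
    Nat.card {y : GL (Fin n) k // y * glAut k₀ k σ n y = g} =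
      Nat.card {x : GL (Fin n) k // x * glAut k₀ k σ n x = 1 ∧ g * x = x * glAut k₀ k σ n g} := by
  obtain ⟨r, r', h1, h2, h3⟩ := exists_factorization_twisted hquad σ hσ g
  exact card_norm_fibre_of_factorization _ (glAut_glAut hquad σ) h1 h2 h3

end NormFibres

section CharSum

open scoped MonoidAlgebra

variable {A B : Type*} [CommRing A] [CommRing B] {G : Type*} [Group G] (N : Subgroup G) [Fintype N]

/-- The unnormalised idempotent of the group algebra attached to a character of a subgroup. -/
noncomputable def charSum (χ : N →* A) : A[G] := ∑ u : N, MonoidAlgebra.single (u : G) (χ u⁻¹)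

variable {N} (χ : N →* A)

lemma charSum_eq : charSum N χ = ∑ u : N, χ u⁻¹ • MonoidAlgebra.of A G u := by
  simp [charSum]

lemma of_mul_charSum (u : N) :
    MonoidAlgebra.of A G u * charSum N χ = χ u • charSum N χ := by
  rw [charSum_eq, Finset.mul_sum, Finset.smul_sum]
  refine Fintype.sum_equiv (Equiv.mulLeft u) _ _ fun x => ?_
  rw [mul_smul_comm, ← map_mul, smul_smul, Equiv.coe_mulLeft, _root_.mul_inv_rev, map_mul χ,
    mul_left_comm, ← map_mul χ, mul_inv_cancel, map_one, mul_one]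
  rfl

lemma charSum_mul_of (u : N) :
    charSum N χ * MonoidAlgebra.of A G u = χ u • charSum N χ := by
  rw [charSum_eq, Finset.sum_mul, Finset.smul_sum]
  refine Fintype.sum_equiv (Equiv.mulRight u) _ _ fun x => ?_
  rw [smul_mul_assoc, ← map_mul, smul_smul, ← map_mul, Equiv.coe_mulRight, _root_.mul_inv_rev,
    mul_inv_cancel_left]
  rfl

lemma charSum_mul_charSum : charSum N χ * charSum N χ = (Fintype.card N : A) • charSum N χ := by
  nth_rw 1 [charSum_eq]
  rw [Finset.sum_mul]
  simp_rw [smul_mul_assoc, of_mul_charSum, smul_smul, ← map_mul, inv_mul_cancel, map_one, one_smul]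
  rw [Finset.sum_const, Finset.card_univ, Nat.cast_smul_eq_nsmul]

lemma pushHom_charSum (f : A →+* B) (φ : G → G) (χ' : N →* B) (hφ : Function.Involutive φ)
    (hN : ∀ u ∈ N, φ u ∈ N) (hχ : ∀ u : N, f (χ u⁻¹) = χ' ⟨φ u, hN u u.2⟩⁻¹) :
    pushHom f φ (charSum N χ) = charSum N χ' := by
  rw [charSum, map_sum]
  have hi : Function.Involutive fun u : N => (⟨φ u, hN u u.2⟩ : N) := fun u =>
    Subtype.ext (hφ u)
  refine Fintype.sum_equiv hi.toPerm _ _ fun x => ?_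
  rw [pushHom_single, hχ]
  rfl

lemma charSum_of_charSum_eq_zero [IsDomain A] {x : G} {u v : N} (h : (u : G) * x = x * v)
    (huv : χ u ≠ χ v) : charSum N χ * MonoidAlgebra.of A G x * charSum N χ = 0 := by
  have h1 : χ u • (charSum N χ * MonoidAlgebra.of A G x * charSum N χ) =
      χ v • (charSum N χ * MonoidAlgebra.of A G x * charSum N χ) := by
    rw [← smul_mul_assoc, ← smul_mul_assoc, ← charSum_mul_of, mul_assoc (charSum N χ), ← map_mul,
      h, map_mul, ← mul_smul_comm, ← of_mul_charSum]
    simp only [mul_assoc]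
  rw [← sub_eq_zero, ← sub_smul] at h1
  exact (smul_eq_zero.1 h1).resolve_left (sub_ne_zero.2 huv)

lemma charSum_smul_smul (u v : N) (z : A[G]) :
    charSum N χ * (MonoidAlgebra.of A G u * z * MonoidAlgebra.of A G v) * charSum N χ =
      (χ u * χ v) • (charSum N χ * z * charSum N χ) := by
  calc _ = charSum N χ * MonoidAlgebra.of A G u * z * (MonoidAlgebra.of A G v * charSum N χ) := by
        simp only [mul_assoc]
    _ = _ := by rw [charSum_mul_of, of_mul_charSum, smul_mul_assoc, smul_mul_assoc, mul_smul_comm,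
        smul_smul]

end CharSum

section PermCombinatorics

variable {n : ℕ} {α : Type*} {π : Equiv.Perm (Fin n)} {t : Fin n → α}

lemma lt_or_forall_eq_add_of_ascents (h : ∀ c d : Fin n, (d : ℕ) = c + 1 → π c < π d →
    (π d : ℕ) = π c + 1 ∧ t d = t c) (c : Fin n) (m : ℕ) :
    ∀ d : Fin n, (d : ℕ) = c + m →
      π d < π c ∨ ∀ i ≤ m, ∀ x : Fin n, (x : ℕ) = c + i → (π x : ℕ) = π c + i ∧ t x = t c := by
  induction m with
  | zero =>
    intro d hd
    right
    intro i hi x hx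
    obtain rfl : x = c := Fin.ext (by omega)
    exact ⟨by omega, rfl⟩
  | succ m ih =>
    intro d hd
    let e : Fin n := ⟨c + m, by omega⟩
    have hde : (d : ℕ) = e + 1 := by simp only [e]; omega
    have hed : (π d : ℕ) ≠ π e := fun he => by
      have := congrArg Fin.val (π.injective (Fin.ext he))
      omega
    have hcd : (π d : ℕ) ≠ π c := fun he => by
      have := congrArg Fin.val (π.injective (Fin.ext he))
      omega
    rcases lt_or_ge (π d) (π e) with h1 | h1
    · left
      rcases ih e rfl with h2 | h2
      · exact h1.trans h2
      · rw [Fin.lt_def] at h1 ⊢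
        by_contra hlt
        have he := (h2 m le_rfl e rfl).1
        obtain ⟨j, hj⟩ : ∃ j : ℕ, (π d : ℕ) = π c + j := ⟨π d - π c, by omega⟩
        have hx := (h2 j (by omega) ⟨c + j, by omega⟩ rfl).1
        have := congrArg Fin.val (π.injective (Fin.ext (hj.trans hx.symm)))
        simp only at this
        omega
    · have hd1 := h e d hde (lt_of_le_of_ne h1 fun h => hed (congrArg Fin.val h).symm)
      rcases ih e rfl with h2 | h2
      · left
        rw [Fin.lt_def] at h2 ⊢
        omega
      · right
        intro i hi x hx
        rcases Nat.lt_or_ge m i with h3 | h3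
        · obtain rfl : x = d := Fin.ext (by omega)
          obtain ⟨h4, h5⟩ := h2 m le_rfl e rfl
          exact ⟨by omega, hd1.2.trans h5⟩
        · exact h2 i h3 x hx

lemma apply_rev_apply_of_ascents (h : ∀ c d : Fin n, (d : ℕ) = c + 1 → π c < π d →
    (π d : ℕ) = π c + 1 ∧ t d = t c) (c : Fin n) :
    π (π c).rev = c.rev ∧ t (π c).rev = t c := by
  have key : ∀ c d : Fin n, c ≤ d → π c ≤ π d → ∀ x, c ≤ x → x ≤ d →
      (π x : ℕ) = π c + (x - c) ∧ t x = t c := by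
    intro c d hcd hπ x hx hxd
    rw [Fin.le_def] at hx hxd hcd
    rcases lt_or_forall_eq_add_of_ascents h c (d - c) d (by omega) with h1 | h1
    · exact absurd h1 (not_lt.2 hπ)
    · exact h1 (x - c) (by omega) x (by omega)
  obtain ⟨b, hb, hbmax⟩ := Finset.exists_max_image
    (Finset.univ.filter fun d => c ≤ d ∧ π c ≤ π d) (fun d => d) ⟨c, by simp⟩
  obtain ⟨a, ha, hamin⟩ := Finset.exists_min_image
    (Finset.univ.filter fun d => d ≤ c ∧ π d ≤ π c) (fun d => d) ⟨c, by simp⟩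
  simp only [Finset.mem_filter, Finset.mem_univ, true_and, and_imp] at hb hbmax ha hamin
  have hset : Finset.univ.filter (fun d => π d < π c) = Finset.Ioi b ∪ Finset.Ico a c := by
    ext d
    simp only [Finset.mem_filter, Finset.mem_univ, true_and, Finset.mem_union, Finset.mem_Ioi,
      Finset.mem_Ico]
    constructor
    · intro hd
      rcases lt_or_ge d c with hdc | hdc
      · exact Or.inr ⟨hamin d hdc.le hd.le, hdc⟩
      · left
        by_contra hdb
        have := (key c b hb.1 hb.2 d hdc (not_lt.1 hdb)).1
        rw [Fin.lt_def] at hd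
        omega
    · rintro (hd | ⟨hd, hdc⟩)
      · by_contra hlt
        exact absurd (hbmax d (hb.1.trans hd.le) (not_lt.1 hlt)) (not_le.2 hd)
      · have h1 := (key a c ha.1 ha.2 d hd hdc.le).1
        have h2 := (key a c ha.1 ha.2 c ha.1 le_rfl).1
        rw [Fin.lt_def] at hdc ⊢
        rw [Fin.le_def] at hd
        omega
  have hcard := congrArg Finset.card hset
  have hd : Disjoint (Finset.Ioi b) (Finset.Ico a c) := by
    rw [Finset.disjoint_left]
    intro x hx hx'
    exact absurd ((Finset.mem_Ico.1 hx').2.trans_le hb.1) (not_lt.2 (Finset.mem_Ioi.1 hx).le)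
  have h0 : (Finset.univ.filter (fun d => π d < π c)).card = π c := by
    rw [← Fin.card_Iio (π c)]
    exact Finset.card_equiv π (by simp)
  rw [h0, Finset.card_union_of_disjoint hd, Fin.card_Ioi, Fin.card_Ico] at hcard
  obtain ⟨h1, h1t⟩ := key a c ha.1 ha.2 c ha.1 le_rfl
  have hac := Fin.le_def.1 ha.1
  have hcb := Fin.le_def.1 hb.1
  have hy : ((π c).rev : ℕ) = a + (b - c) := by
    rw [Fin.val_rev]
    omega
  rw [Fin.ext_iff, Fin.val_rev c]
  rcases le_total (π c).rev c with hyc | hyc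
  · obtain ⟨h2, h2t⟩ := key a c ha.1 ha.2 (π c).rev (Fin.le_def.2 (by omega)) hyc
    exact ⟨by omega, h2t.trans h1t.symm⟩
  · obtain ⟨h2, h2t⟩ := key c b hb.1 hb.2 (π c).rev hyc (Fin.le_def.2 (by omega))
    rw [Fin.le_def] at hyc
    exact ⟨by omega, h2t⟩

end PermCombinatorics

section Unipotent

variable (k : Type*) [Field k] (n : ℕ)

/-- The group of upper triangular unipotent matrices. -/
def upperUnip : Subgroup (GL (Fin n) k) where
  carrier := {g | ∀ i j, j ≤ i → (g : Matrix (Fin n) (Fin n) k) i j = (1 : Matrix _ _ k) i j}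
  one_mem' := by intro i j _; rfl
  mul_mem' := by
    intro g h hg hh i j hij
    rw [GeneralLinearGroup.coe_mul, Matrix.mul_apply, Finset.sum_eq_single i]
    · rw [hg i i le_rfl, hh i j hij, one_apply_eq, one_mul]
    · intro l _ hl
      rcases lt_or_gt_of_ne hl with h1 | h1
      · rw [hg i l h1.le, one_apply_ne h1.ne', zero_mul]
      · rw [hh l j (hij.trans h1.le), one_apply_ne (hij.trans_lt h1).ne', mul_zero]
    · simp
  inv_mem' := by
    intro g hg
    have hb : BlockTriangular ((g⁻¹ : GL (Fin n) k) : Matrix (Fin n) (Fin n) k) id := by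
      rw [Matrix.coe_units_inv]
      have : Invertible (g : Matrix (Fin n) (Fin n) k) := g.invertible
      refine Matrix.blockTriangular_inv_of_blockTriangular fun i j hij => ?_
      have hij : j < i := hij
      rw [hg i j hij.le, one_apply_ne hij.ne']
    intro i j hij
    rcases hij.lt_or_eq with h1 | rfl
    · rw [hb h1, one_apply_ne h1.ne']
    · have h1 : ((g * g⁻¹ : GL (Fin n) k) : Matrix (Fin n) (Fin n) k) j j = 1 := by
        rw [mul_inv_cancel, Units.val_one, one_apply_eq]
      rw [GeneralLinearGroup.coe_mul, Matrix.mul_apply, Finset.sum_eq_single j, hg j j le_rfl,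
        one_apply_eq, one_mul] at h1
      · rw [h1, one_apply_eq]
      · intro l _ hl
        rcases lt_or_gt_of_ne hl with h1 | h1
        · rw [hg j l h1.le, one_apply_ne h1.ne', zero_mul]
        · rw [hb h1, mul_zero]
      · simp

variable {k n}

/-- The sum of the entries just above the diagonal. -/
def superdiag (g : Matrix (Fin n) (Fin n) k) : k :=
  ∑ i : Fin n, ∑ j : Fin n, if (j : ℕ) = i + 1 then g i j else 0

lemma superdiag_mul (g h : upperUnip k n) :
    superdiag (((g * h : upperUnip k n) : GL (Fin n) k) : Matrix (Fin n) (Fin n) k) =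
      superdiag (g : GL (Fin n) k).val + superdiag (h : GL (Fin n) k).val := by
  simp only [superdiag, ← Finset.sum_add_distrib]
  refine Finset.sum_congr rfl fun i _ => Finset.sum_congr rfl fun j _ => ?_
  split_ifs with hij
  · have hlt : i < j := Fin.lt_def.2 (by omega)
    rw [Subgroup.coe_mul, GeneralLinearGroup.coe_mul, Matrix.mul_apply,
      Finset.sum_eq_add i j hlt.ne _ (by simp) (by simp), g.2 i i le_rfl, h.2 j j le_rfl,
      one_apply_eq, one_apply_eq, one_mul, mul_one, add_comm]
    rintro l - ⟨h1, h2⟩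
    rcases lt_or_gt_of_ne h1 with h3 | h3
    · rw [g.2 i l h3.le, one_apply_ne h3.ne', zero_mul]
    · have h4 : j < l := by
        rw [Fin.lt_def] at h3 ⊢
        have : (l : ℕ) ≠ j := fun h => h2 (Fin.ext h)
        omega
      rw [h.2 l j h4.le, one_apply_ne h4.ne', mul_zero]
  · simp

/-- The generic character of the unipotent group attached to an additive character. -/
def genericChar {A : Type*} [CommRing A] (ψ : AddChar k A) : upperUnip k n →* A where
  toFun u := ψ (superdiag (u : GL (Fin n) k).val)
  map_one' := by
    have : superdiag (1 : Matrix (Fin n) (Fin n) k) = 0 := by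
      refine Finset.sum_eq_zero fun i _ => Finset.sum_eq_zero fun j _ => ?_
      split_ifs with h
      · exact one_apply_ne fun hij => by rw [hij] at h; omega
      · rfl
    change ψ (superdiag 1) = 1
    rw [this, AddChar.map_zero_eq_one]
  map_mul' g h := by rw [superdiag_mul, AddChar.map_add_eq_mul]

lemma genericChar_apply {A : Type*} [CommRing A] (ψ : AddChar k A) (u : upperUnip k n) :
    genericChar ψ u = ψ (superdiag (u : GL (Fin n) k).val) := rfl

/-- The upper unipotent matrix with given entries above the diagonal. -/
def unipMatrix (f : Fin n → Fin n → k) : Matrix (Fin n) (Fin n) k :=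
  Matrix.of fun i j => (1 : Matrix _ _ k) i j + if i < j then f i j else 0

lemma unipMatrix_apply (f : Fin n → Fin n → k) (i j : Fin n) :
    unipMatrix f i j = (1 : Matrix _ _ k) i j + if i < j then f i j else 0 := rfl

lemma det_unipMatrix (f : Fin n → Fin n → k) : (unipMatrix f).det = 1 := by
  rw [Matrix.det_of_isUpperTriangular]
  · exact Finset.prod_eq_one fun i _ => by simp [unipMatrix_apply]
  · intro i j hij
    have hij : j < i := hij
    simp [unipMatrix_apply, one_apply_ne hij.ne', hij.not_gt]

/-- The element of the unipotent group with given entries above the diagonal. -/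
noncomputable def unipMk (f : Fin n → Fin n → k) : upperUnip k n :=
  ⟨GeneralLinearGroup.mkOfDetNeZero (unipMatrix f) (by simp [det_unipMatrix]), fun i j hij => by
    change unipMatrix f i j = _
    simp [unipMatrix_apply, hij.not_gt]⟩

lemma coe_unipMk (f : Fin n → Fin n → k) : ((unipMk f : upperUnip k n) : GL (Fin n) k).val =
    unipMatrix f := rfl

lemma superdiag_unipMatrix (f : Fin n → Fin n → k) : superdiag (unipMatrix f) =
    ∑ i : Fin n, ∑ j : Fin n, if (j : ℕ) = i + 1 then f i j else 0 := by
  refine Finset.sum_congr rfl fun i _ => Finset.sum_congr rfl fun j _ => ?_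
  split_ifs with h
  · have : i < j := Fin.lt_def.2 (by omega)
    rw [unipMatrix_apply, one_apply_ne this.ne, zero_add, if_pos this]
  · rfl

lemma unipMatrix_mul_apply (f : Fin n → Fin n → k) (g : Matrix (Fin n) (Fin n) k) (i j : Fin n) :
    (unipMatrix f * g) i j = g i j + ∑ l, if i < l then f i l * g l j else 0 := by
  simp only [Matrix.mul_apply, unipMatrix_apply, add_mul, Finset.sum_add_distrib, ite_mul, zero_mul]
  rw [← Matrix.mul_apply, one_mul]

lemma mul_unipMatrix_apply (f : Fin n → Fin n → k) (g : Matrix (Fin n) (Fin n) k) (i j : Fin n) :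
    (g * unipMatrix f) i j = g i j + ∑ l, if l < j then g i l * f l j else 0 := by
  simp only [Matrix.mul_apply, unipMatrix_apply, mul_add, Finset.sum_add_distrib, mul_ite, mul_zero]
  rw [← Matrix.mul_apply, mul_one]

/-- The unipotent matrix whose only nontrivial column is `c`. -/
noncomputable def unipCol (c : Fin n) (w : Fin n → k) : upperUnip k n :=
  unipMk fun i j => if j = c then w i else 0

/-- The unipotent matrix whose only nontrivial row is `c`. -/
noncomputable def unipRow (c : Fin n) (w : Fin n → k) : upperUnip k n :=
  unipMk fun i j => if i = c then w j else 0

lemma unipCol_mul_apply (c : Fin n) (w : Fin n → k) (g : GL (Fin n) k) (i j : Fin n) :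
    (((unipCol c w : GL (Fin n) k) * g : GL (Fin n) k) : Matrix (Fin n) (Fin n) k) i j =
      g i j + if i < c then w i * g c j else 0 := by
  rw [GeneralLinearGroup.coe_mul, unipCol, coe_unipMk, unipMatrix_mul_apply,
    Finset.sum_eq_single c]
  · simp
  · intro l _ hl; simp [hl]
  · simp

lemma mul_unipRow_apply (c : Fin n) (w : Fin n → k) (g : GL (Fin n) k) (i j : Fin n) :
    ((g * (unipRow c w : GL (Fin n) k) : GL (Fin n) k) : Matrix (Fin n) (Fin n) k) i j =
      g i j + if c < j then g i c * w j else 0 := by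
  rw [GeneralLinearGroup.coe_mul, unipRow, coe_unipMk, mul_unipMatrix_apply,
    Finset.sum_eq_single c]
  · simp
  · intro l _ hl; simp [hl]
  · simp

/-- Reduction of an invertible matrix to a monomial one by unipotent matrices. -/
lemma exists_unip_mul_mul_monomial_aux (g : GL (Fin n) k) (m : ℕ) (hm : m ≤ n) :
    ∃ u v : upperUnip k n, ∀ c : Fin n, (c : ℕ) < m → ∃ r,
      ((u : GL (Fin n) k) * g * v : GL (Fin n) k).val r c ≠ 0 ∧
      (∀ i ≠ r, ((u : GL (Fin n) k) * g * v : GL (Fin n) k).val i c = 0) ∧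
      ∀ d ≠ c, ((u : GL (Fin n) k) * g * v : GL (Fin n) k).val r d = 0 := by
  induction m with
  | zero => exact ⟨1, 1, fun c hc => absurd hc (Nat.not_lt_zero _)⟩
  | succ m ih =>
    obtain ⟨u, v, huv⟩ := ih (by omega)
    set x : GL (Fin n) k := (u : GL (Fin n) k) * g * v with hx
    let c₀ : Fin n := ⟨m, hm⟩
    have hcol : ∃ i, x.val i c₀ ≠ 0 := by
      by_contra! h0
      have h1 : (x⁻¹ * x : GL (Fin n) k).val c₀ c₀ = 1 := by
        rw [inv_mul_cancel, Units.val_one, one_apply_eq]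
      rw [GeneralLinearGroup.coe_mul, Matrix.mul_apply] at h1
      simp [h0] at h1
    classical
    obtain ⟨r₀, hr₀, hmax⟩ := Finset.exists_max_image (Finset.univ.filter fun i => x.val i c₀ ≠ 0)
      (fun i => i) (by obtain ⟨i, hi⟩ := hcol; exact ⟨i, by simp [hi]⟩)
    simp only [Finset.mem_filter, Finset.mem_univ, true_and] at hr₀ hmax
    have hr₀c : ∀ d : Fin n, (d : ℕ) < m → x.val r₀ d = 0 := by
      intro d hd
      obtain ⟨r, h1, h2, h3⟩ := huv d hd
      refine h2 r₀ fun h => hr₀ ?_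
      rw [h]
      exact h3 c₀ fun h => by rw [← h] at hd; simp [c₀] at hd
    let a : Fin n → k := fun i => -(x.val i c₀ / x.val r₀ c₀)
    let b : Fin n → k := fun j => -(x.val r₀ j / x.val r₀ c₀)
    have hx' : ∀ i j, ((unipCol r₀ a : GL (Fin n) k) * x : GL (Fin n) k).val i j =
        x.val i j + if i < r₀ then a i * x.val r₀ j else 0 := unipCol_mul_apply r₀ a x
    have hy : ∀ i j, ((unipCol r₀ a : GL (Fin n) k) * x * (unipRow c₀ b : GL (Fin n) k)).val i j =
        ((unipCol r₀ a : GL (Fin n) k) * x : GL (Fin n) k).val i j + if c₀ < j then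
          ((unipCol r₀ a : GL (Fin n) k) * x : GL (Fin n) k).val i c₀ * b j else 0 :=
      mul_unipRow_apply c₀ b _
    have hx'c : ∀ i ≠ r₀, ((unipCol r₀ a : GL (Fin n) k) * x : GL (Fin n) k).val i c₀ = 0 := by
      intro i hi
      rw [hx']
      split_ifs with hlt
      · simp only [a]
        field_simp
        ring
      · rw [add_zero]
        by_contra h0
        exact hi (le_antisymm (hmax i h0) (not_lt.1 hlt))
    have hx'r : ∀ j, ((unipCol r₀ a : GL (Fin n) k) * x : GL (Fin n) k).val r₀ j = x.val r₀ j := by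
      intro j
      rw [hx', if_neg (lt_irrefl _), add_zero]
    refine ⟨unipCol r₀ a * u, v * unipRow c₀ b, fun c hc => ?_⟩
    rw [Subgroup.coe_mul, Subgroup.coe_mul, show ((unipCol r₀ a : GL (Fin n) k) * u) * g *
      (v * (unipRow c₀ b : GL (Fin n) k)) = (unipCol r₀ a : GL (Fin n) k) * x *
        (unipRow c₀ b : GL (Fin n) k) by rw [hx]; group]
    rcases Nat.lt_succ_iff_lt_or_eq.1 hc with hc | hc
    · obtain ⟨r, h1, h2, h3⟩ := huv c hc
      have hcc : c < c₀ := Fin.lt_def.2 hc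
      have hyc : ∀ i, ((unipCol r₀ a : GL (Fin n) k) * x *
          (unipRow c₀ b : GL (Fin n) k)).val i c = x.val i c := by
        intro i
        rw [hy, hx', hr₀c c hc, if_neg hcc.not_gt]
        simp
      have har : a r = 0 := by
        simp only [a]
        rw [h3 c₀ hcc.ne', zero_div, neg_zero]
      have hx'0 : ∀ d ≠ c, ((unipCol r₀ a : GL (Fin n) k) * x : GL (Fin n) k).val r d = 0 := by
        intro d hd
        rw [hx', h3 d hd, har]
        simp
      refine ⟨r, by rwa [hyc], fun i hi => by rw [hyc, h2 i hi], fun d hd => ?_⟩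
      rw [hy, hx'0 d hd, hx'0 c₀ hcc.ne']
      simp
    · obtain rfl : c = c₀ := Fin.ext hc
      refine ⟨r₀, ?_, fun i hi => ?_, fun d hd => ?_⟩
      · rwa [hy, if_neg (lt_irrefl _), add_zero, hx'r]
      · rw [hy, if_neg (lt_irrefl _), add_zero, hx'c i hi]
      · rw [hy, hx'r, hx'r]
        rcases lt_or_gt_of_ne hd with hlt | hlt
        · rw [hr₀c d hlt, if_neg hlt.not_gt, add_zero]
        · rw [if_pos hlt]
          simp only [b]
          field_simp
          ring

lemma exists_unip_mul_mul_monomial (g : GL (Fin n) k) :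
    ∃ (u v : upperUnip k n) (π : Equiv.Perm (Fin n)) (t : Fin n → k), (∀ c, t c ≠ 0) ∧ ∀ i c,
      ((u : GL (Fin n) k) * g * v : GL (Fin n) k).val i c = if i = π c then t c else 0 := by
  obtain ⟨u, v, h⟩ := exists_unip_mul_mul_monomial_aux g n le_rfl
  choose π h1 h2 h3 using fun c => h c c.2
  have hinj : Function.Injective π := by
    intro c d hcd
    by_contra hne
    exact h1 d (hcd ▸ h3 c d (Ne.symm hne))
  refine ⟨u, v, Equiv.ofBijective π (Finite.injective_iff_bijective.1 hinj),
    fun c => _, h1, fun i c => ?_⟩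
  rw [Equiv.ofBijective_apply]
  split_ifs with hi
  · rw [hi]
  · exact h2 c i hi

end Unipotent

section AntiTranspose

variable {k : Type*} [Field k] {n : ℕ}

/-- Transposition of an invertible matrix with respect to the antidiagonal. -/
def antiTranspose (g : GL (Fin n) k) : GL (Fin n) k where
  val := (g.val.submatrix Fin.revPerm Fin.revPerm)ᵀ
  inv := (g⁻¹.val.submatrix Fin.revPerm Fin.revPerm)ᵀ
  val_inv := by
    rw [← transpose_mul, submatrix_mul_equiv, ← GeneralLinearGroup.coe_mul, inv_mul_cancel]
    simp
  inv_val := by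
    rw [← transpose_mul, submatrix_mul_equiv, ← GeneralLinearGroup.coe_mul, mul_inv_cancel]
    simp

lemma antiTranspose_apply (g : GL (Fin n) k) (i j : Fin n) :
    (antiTranspose g).val i j = g.val j.rev i.rev := rfl

lemma antiTranspose_antiTranspose (g : GL (Fin n) k) : antiTranspose (antiTranspose g) = g := by
  ext i j
  rw [antiTranspose_apply, antiTranspose_apply, Fin.rev_rev, Fin.rev_rev]

lemma antiTranspose_mul (g h : GL (Fin n) k) :
    antiTranspose (g * h) = antiTranspose h * antiTranspose g := by
  ext i j
  rw [antiTranspose_apply, GeneralLinearGroup.coe_mul, GeneralLinearGroup.coe_mul,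
    Matrix.mul_apply, Matrix.mul_apply]
  refine Fintype.sum_equiv Fin.revPerm _ _ fun l => ?_
  rw [antiTranspose_apply, antiTranspose_apply, Fin.revPerm_apply, Fin.rev_rev, mul_comm]

lemma antiTranspose_mem {u : GL (Fin n) k} (hu : u ∈ upperUnip k n) :
    antiTranspose u ∈ upperUnip k n := by
  intro i j hij
  rw [antiTranspose_apply, hu _ _ (Fin.rev_le_rev.2 hij)]
  simp only [one_apply, Fin.rev_inj, eq_comm]

lemma superdiag_antiTranspose (g : GL (Fin n) k) :
    superdiag (antiTranspose g).val = superdiag g.val := by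
  rw [superdiag, superdiag, Finset.sum_comm]
  refine Fintype.sum_equiv Fin.revPerm _ _ fun i => Fintype.sum_equiv Fin.revPerm _ _ fun j => ?_
  rw [antiTranspose_apply, Fin.revPerm_apply, Fin.revPerm_apply, Fin.val_rev, Fin.val_rev]
  congr 1
  rw [eq_iff_iff]
  omega

lemma antiTranspose_eq_of_ascents {x : GL (Fin n) k} {π : Equiv.Perm (Fin n)} {t : Fin n → k}
    (hx : ∀ i c, x.val i c = if i = π c then t c else 0)
    (h : ∀ c d : Fin n, (d : ℕ) = c + 1 → π c < π d → (π d : ℕ) = π c + 1 ∧ t d = t c) :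
    antiTranspose x = x := by
  ext i j
  rw [antiTranspose_apply, hx, hx]
  obtain ⟨h1, h2⟩ := apply_rev_apply_of_ascents h j
  obtain ⟨h3, -⟩ := apply_rev_apply_of_ascents h i.rev
  by_cases hij : i = π j
  · rw [if_pos hij, hij, if_pos h1.symm, h2]
  · rw [if_neg hij, if_neg]
    intro h4
    rw [← h4, Fin.rev_rev, Fin.rev_rev] at h3
    exact hij h3.symm

end AntiTranspose

section Gelfand

open scoped MonoidAlgebra

variable {k : Type*} [Field k] {n : ℕ} [Fintype (upperUnip k n)]
  {A : Type*} [CommRing A] [IsDomain A] {ψ : AddChar k A}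

omit [IsDomain A] in
lemma pushHom_antiTranspose_charSum :
    pushHom (RingHom.id A) antiTranspose (charSum (upperUnip k n) (genericChar ψ)) =
      charSum (upperUnip k n) (genericChar ψ) := by
  refine pushHom_charSum _ _ _ _ antiTranspose_antiTranspose (fun u => antiTranspose_mem)
    fun u => ?_
  have h : ∀ u : upperUnip k n, genericChar ψ ⟨antiTranspose (u : GL (Fin n) k),
      antiTranspose_mem u.2⟩ = genericChar ψ u := fun u => by
    rw [genericChar_apply, genericChar_apply, superdiag_antiTranspose]
  have h1 : (⟨antiTranspose (u : GL (Fin n) k), antiTranspose_mem u.2⟩⁻¹ : upperUnip k n) =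
      ⟨antiTranspose ((u⁻¹ : upperUnip k n) : GL (Fin n) k), antiTranspose_mem (u⁻¹).2⟩ := by
    rw [inv_eq_iff_mul_eq_one]
    apply Subtype.ext
    rw [Subgroup.coe_mul, ← antiTranspose_mul, ← Subgroup.coe_mul, inv_mul_cancel]
    ext i j
    rw [antiTranspose_apply]
    simp [one_apply, eq_comm]
  rw [RingHom.id_apply, h1, h]

lemma charSum_mul_mul_charSum_eq_zero_or (hψ : ψ ≠ 1) (x : GL (Fin n) k)
    {π : Equiv.Perm (Fin n)} {t : Fin n → k} (ht : ∀ c, t c ≠ 0)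
    (hx : ∀ i c, x.val i c = if i = π c then t c else 0) :
    charSum (upperUnip k n) (genericChar ψ) * MonoidAlgebra.of A _ x *
      charSum (upperUnip k n) (genericChar ψ) = 0 ∨ antiTranspose x = x := by
  rw [or_iff_not_imp_left]
  intro hne
  refine antiTranspose_eq_of_ascents hx fun c d hcd hlt => ?_
  have hcd' : c < d := Fin.lt_def.2 (by omega)
  have hsd : ∀ (a b : Fin n) (s : k), superdiag (unipMatrix fun i j => if i = a ∧ j = b then s else 0)
      = if (b : ℕ) = a + 1 then s else 0 := by
    intro a b s
    rw [superdiag_unipMatrix, Finset.sum_eq_single a, Finset.sum_eq_single b]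
    · simp
    · intro j _ hj; simp [hj]
    · simp
    · intro i _ hi; exact Finset.sum_eq_zero fun j _ => by simp [hi]
    · simp
  have key : ∀ s : k, ψ (if (π d : ℕ) = π c + 1 then s * t c / t d else 0) = ψ s := by
    intro s
    let u : upperUnip k n := unipMk fun i j => if i = π c ∧ j = π d then s * t c / t d else 0
    let v : upperUnip k n := unipMk fun i j => if i = c ∧ j = d then s else 0
    have huv : (u : GL (Fin n) k) * x = x * v := by
      ext i j
      rw [GeneralLinearGroup.coe_mul, GeneralLinearGroup.coe_mul, coe_unipMk, coe_unipMk,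
        unipMatrix_mul_apply, mul_unipMatrix_apply, Finset.sum_eq_single (π d),
        Finset.sum_eq_single c]
      · simp only [hx]
        have := ht d
        by_cases h1 : i = π c <;> by_cases h2 : j = d
        · subst h1 h2
          simp only [hlt, hcd', if_true, and_self]
          field_simp
        · simp [h1, h2, Ne.symm h2]
        · simp [h1, h2]
        · simp [h1, h2]
      · intro l _ hl; simp [hl]
      · simp
      · intro l _ hl; simp [hl]
      · simp
    by_contra hne'
    refine hne (charSum_of_charSum_eq_zero _ huv ?_)
    rwa [genericChar_apply, genericChar_apply, coe_unipMk, coe_unipMk, hsd, hsd, if_pos hcd]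
  have hπ : (π d : ℕ) = π c + 1 := by
    by_contra h0
    refine hψ (DFunLike.ext _ _ fun s => ?_)
    rw [← key s, if_neg h0, AddChar.map_zero_eq_one, AddChar.one_apply]
  refine ⟨hπ, ?_⟩
  by_contra htne
  refine hψ (DFunLike.ext _ _ fun s => ?_)
  have h1 : t c / t d - 1 ≠ 0 := fun h => htne ((div_eq_one_iff_eq (ht d)).1 (sub_eq_zero.1 h)).symm
  have h2 := key (s / (t c / t d - 1))
  rw [if_pos hπ] at h2
  have h3 : s / (t c / t d - 1) * t c / t d = s + s / (t c / t d - 1) := by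
    field_simp
    ring
  rw [h3, AddChar.map_add_eq_mul] at h2
  rw [AddChar.one_apply]
  exact (mul_eq_right₀ (AddChar.val_isUnit _ _).ne_zero).1 h2

/-- Uniqueness of Whittaker models, in the form of an identity in the group algebra. -/
theorem charSum_mul_of_mul_charSum (hψ : ψ ≠ 1) (g : GL (Fin n) k) :
    charSum (upperUnip k n) (genericChar ψ) * MonoidAlgebra.of A _ g *
      charSum (upperUnip k n) (genericChar ψ) =
    charSum (upperUnip k n) (genericChar ψ) * MonoidAlgebra.of A _ (antiTranspose g) *
      charSum (upperUnip k n) (genericChar ψ) := by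
  obtain ⟨u, v, π, t, ht, hx⟩ := exists_unip_mul_mul_monomial g
  set x := (u : GL (Fin n) k) * g * v with hxdef
  set E := charSum (upperUnip k n) (genericChar ψ) with hE
  have hst : ∀ z, pushHom (RingHom.id A) antiTranspose (E * MonoidAlgebra.of A _ z * E) =
      E * MonoidAlgebra.of A _ (antiTranspose z) * E := by
    intro z
    rw [pushHom_mul _ antiTranspose_mul, pushHom_mul _ antiTranspose_mul,
      pushHom_antiTranspose_charSum, MonoidAlgebra.of_apply, pushHom_single, map_one, mul_assoc]
    rfl
  have hg : (MonoidAlgebra.of A _ g) = MonoidAlgebra.of A (GL (Fin n) k) (u⁻¹ : upperUnip k n) *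
      MonoidAlgebra.of A _ x * MonoidAlgebra.of A (GL (Fin n) k) (v⁻¹ : upperUnip k n) := by
    rw [← map_mul, ← map_mul, hxdef]
    congr 1
    simp only [Subgroup.coe_inv]
    group
  have h1 : E * MonoidAlgebra.of A _ g * E = (genericChar ψ u⁻¹ * genericChar ψ v⁻¹) •
      (E * MonoidAlgebra.of A _ x * E) := by
    rw [hg, hE, charSum_smul_smul]
  rw [← hst, h1]
  rcases charSum_mul_mul_charSum_eq_zero_or hψ x ht hx with h0 | h0
  · rw [h0, smul_zero, map_zero]
  · rw [pushHom_smul, hst, h0, RingHom.id_apply]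

end Gelfand

section UnipCol

variable {k : Type*} [Field k] {n : ℕ}

lemma unipCol_val (c : Fin n) (w : Fin n → k) : (unipCol c w : GL (Fin n) k).val =
    1 + vecMulVec (fun i => if i < c then w i else 0) (Pi.single c 1) := by
  ext i j
  rw [unipCol, coe_unipMk, unipMatrix_apply, Matrix.add_apply, vecMulVec_apply]
  congr 1
  by_cases h : j = c
  · subst h; simp
  · simp [h]

lemma unipCol_add (c : Fin n) (w w' : Fin n → k) :
    unipCol c (w + w') = unipCol c w * unipCol c w' := by
  ext1; ext1
  rw [Subgroup.coe_mul, Units.val_mul, unipCol_val, unipCol_val, unipCol_val, add_mul, mul_add,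
    mul_add, vecMulVec_mul_vecMulVec]
  have h1 : (fun i => if i < c then (w + w') i else 0) =
      (fun i => if i < c then w i else 0) + fun i => if i < c then w' i else 0 := by
    ext i
    by_cases h : i < c <;> simp [h]
  rw [h1, add_vecMulVec]
  simp only [mul_one, one_mul, single_dotProduct, lt_self_iff_false, if_false, mul_zero,
    zero_smul, vecMulVec_zero, add_zero]
  abel

lemma unipCol_zero (c : Fin n) : unipCol c (0 : Fin n → k) = 1 := by
  ext1; ext1
  rw [unipCol_val]
  simp [vecMulVec, ← Matrix.ext_iff]

lemma unipCol_eq_one_of_forall {c : Fin n} {w : Fin n → k} (h : ∀ i < c, w i = 0) :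
    unipCol c w = 1 := by
  rw [← unipCol_zero c]
  ext1; ext1
  rw [unipCol_val, unipCol_val]
  congr 2
  ext i
  by_cases hi : i < c
  · simp [hi, h i hi]
  · simp [hi]

lemma unipCol_mask (c : Fin n) (w : Fin n → k) :
    unipCol c (fun i => if i < c then w i else 0) = unipCol c w := by
  ext1; ext1
  rw [unipCol_val, unipCol_val]
  congr 2
  ext i
  by_cases hi : i < c <;> simp [hi]

lemma unipCol_mul_of_rows {c : Fin n} {g : GL (Fin n) k} (hg : ∀ j, g.val c j = (1 : Matrix _ _ k) c j)
    {w w' : Fin n → k} (hw : ∀ i, c ≤ i → w i = 0) (hw' : ∀ i, c ≤ i → w' i = 0)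
    (h : g.val *ᵥ w' = w) : (unipCol c w : GL (Fin n) k) * g = g * unipCol c w' := by
  have hm : ∀ w : Fin n → k, (∀ i, c ≤ i → w i = 0) → (fun i => if i < c then w i else 0) = w := by
    intro w hw
    ext i
    split_ifs with hi
    · rfl
    · exact (hw i (not_lt.1 hi)).symm
  ext1
  rw [Units.val_mul, Units.val_mul, unipCol_val, unipCol_val, hm w hw, hm w' hw', add_mul, mul_add,
    mul_vecMulVec, vecMulVec_mul, h, one_mul, mul_one]
  congr 2
  ext j
  rw [Matrix.single_one_vecMul, Matrix.row_apply, hg, one_apply, Pi.single_apply]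
  simp only [eq_comm]

lemma exists_unipCol_mul_eq {c : Fin n} {g : GL (Fin n) k}
    (hg : ∀ l, c ≤ l → ∀ j, g.val l j = (1 : Matrix _ _ k) l j) {d : Fin n} (hd : c ≤ d)
    {w : Fin n → k} (hw : ∀ i, d ≤ i → w i = 0) :
    ∃ w' : Fin n → k, (∀ i, d ≤ i → w' i = 0) ∧ g.val *ᵥ w' = w ∧ (∀ i, c ≤ i → w' i = w i) ∧
      (unipCol d w : GL (Fin n) k) * g = g * unipCol d w' := by
  have h1 : g.val *ᵥ (g⁻¹.val *ᵥ w) = w := by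
    rw [mulVec_mulVec, ← Units.val_mul, mul_inv_cancel, Units.val_one, one_mulVec]
  have h2 : ∀ i, c ≤ i → (g⁻¹.val *ᵥ w) i = w i := by
    intro i hi
    have h2 : ∀ x, (g.val *ᵥ x) i = x i := fun x =>
      (congrArg (· ⬝ᵥ x) (funext (hg i hi))).trans (congrFun (one_mulVec x) i)
    rw [← h2 (g⁻¹.val *ᵥ w), h1]
  have h3 : ∀ i, d ≤ i → (g⁻¹.val *ᵥ w) i = 0 := fun i hi => by rw [h2 i (hd.trans hi), hw i hi]
  exact ⟨_, h3, h1, h2, unipCol_mul_of_rows (hg d hd) hw h3 h1⟩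

lemma unipCol_row_eq {c l : Fin n} (hl : c ≤ l) (w : Fin n → k) (j : Fin n) :
    (unipCol c w : GL (Fin n) k).val l j = (1 : Matrix _ _ k) l j := by
  rw [unipCol_val, Matrix.add_apply, vecMulVec_apply, if_neg hl.not_gt, zero_mul, add_zero]

/-- A subgroup containing all columns of a unipotent matrix contains the matrix. -/
lemma mem_of_unipCol_mem (P : Subgroup (GL (Fin n) k)) (u : upperUnip k n)
    (h : ∀ c, (unipCol c (fun i => (u : GL (Fin n) k).val i c) : GL (Fin n) k) ∈ P) :
    (u : GL (Fin n) k) ∈ P := by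
  let T : ℕ → upperUnip k n := fun m =>
    unipMk fun i j => if (j : ℕ) < m then (u : GL (Fin n) k).val i j else 0
  have hT : ∀ m, m ≤ n → (T m : GL (Fin n) k) ∈ P := by
    intro m
    induction m with
    | zero =>
      intro _
      have : T 0 = 1 := by
        ext i j
        simp [T, coe_unipMk, unipMatrix_apply]
      rw [this]
      exact P.one_mem
    | succ m ih =>
      intro hm
      have : (T (m + 1) : GL (Fin n) k) =
          unipCol ⟨m, hm⟩ (fun i => (u : GL (Fin n) k).val i ⟨m, hm⟩) * (T m : GL (Fin n) k) := by
        ext i j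
        rw [unipCol_mul_apply, coe_unipMk, coe_unipMk, unipMatrix_apply, unipMatrix_apply,
          unipMatrix_apply]
        by_cases hij : i < j
        · by_cases hj : (j : ℕ) = m
          · obtain rfl : j = ⟨m, hm⟩ := Fin.ext hj
            simp [hij]
          · have h1 : ((j : ℕ) < m + 1) = (j < m) := by rw [eq_iff_iff]; omega
            have h2 : (⟨m, hm⟩ : Fin n) ≠ j := fun h => hj (by rw [← h])
            have h3 : ((⟨m, hm⟩ : Fin n) < j ∧ (j : ℕ) < m) = False := by
              rw [eq_iff_iff, Fin.lt_def, iff_false]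
              simp only [not_and, not_lt]
              exact fun h => h.le
            simp only [hij, h1, one_apply_ne h2, ← ite_and, h3, if_false,
              mul_zero, ite_self, add_zero]
        · have h2 : i < (⟨m, hm⟩ : Fin n) → (⟨m, hm⟩ : Fin n) ≠ j := fun h h' => hij (h' ▸ h)
          have h3 : i < (⟨m, hm⟩ : Fin n) → ¬ (⟨m, hm⟩ : Fin n) < j := fun h h' => hij (h.trans h')
          by_cases hi : i < (⟨m, hm⟩ : Fin n)
          · simp [hij, h2 hi, h3 hi, one_apply_ne]
          · simp [hij, hi]
      rw [this]
      exact P.mul_mem (h _) (ih (by omega))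
  have : u = T n := by
    ext i j
    rw [coe_unipMk, unipMatrix_apply]
    split_ifs with h1 h2
    · rw [one_apply_ne h1.ne, zero_add]
    · exact absurd j.2 h2
    · rw [add_zero, u.2 i j (not_lt.1 h1)]
  rw [this]
  exact hT n le_rfl

end UnipCol

section WhittakerInduction

variable {k : Type} [Field k] {n : ℕ} {R : Type} [Field R] {V : Type} [AddCommGroup V] [Module R V]

/-- The index preceding `c`. -/
def predIdx (c : Fin n) : Fin n := ⟨c - 1, by omega⟩

lemma predIdx_val (c : Fin n) : (predIdx c : ℕ) = c - 1 := rfl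

/-- A vector is generic from column `j` on if the columns with index at least `j` of unipotent
matrices act on it through the generic character. -/
def GenericFrom (ρ : Representation R (GL (Fin n) k) V) (ψ : AddChar k R) (j : ℕ) (v : V) : Prop :=
  ∀ c : Fin n, j ≤ c → 0 < (c : ℕ) → ∀ w, ρ (unipCol c w) v = ψ (w (predIdx c)) • v

variable {ρ : Representation R (GL (Fin n) k) V} {ψ : AddChar k R}

lemma genericChar_unipCol {c : Fin n} (hc : 0 < (c : ℕ)) (w : Fin n → k) :
    genericChar ψ (unipCol c w) = ψ (w (predIdx c)) := by
  have hp := predIdx_val c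
  rw [genericChar_apply, unipCol, coe_unipMk, superdiag_unipMatrix,
    Finset.sum_eq_single (predIdx c), Finset.sum_eq_single c]
  · rw [if_pos (by omega), if_pos rfl]
  · intro j _ hj; simp [hj]
  · simp
  · intro i _ hi
    refine Finset.sum_eq_zero fun j _ => ?_
    have : ¬ ((j : ℕ) = i + 1 ∧ j = c) := by
      rintro ⟨h1, rfl⟩
      exact hi (Fin.ext (by omega))
    rw [← ite_and, if_neg this]
  · simp

lemma apply_eq_of_genericFrom_zero {v : V} (hv : GenericFrom ρ ψ 0 v) (u : upperUnip k n) :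
    ρ u v = genericChar ψ u • v := by
  let Q : Subgroup (upperUnip k n) :=
    { carrier := {u | ρ u v = genericChar ψ u • v}
      one_mem' := by simp
      mul_mem' := by
        intro a b (ha : ρ a v = _) (hb : ρ b v = _)
        change ρ (a * b : upperUnip k n) v = _
        rw [Subgroup.coe_mul, map_mul, Module.End.mul_apply, hb, map_smul, ha, smul_smul, map_mul,
          mul_comm]
      inv_mem' := by
        intro a (ha : ρ a v = _)
        change ρ (a⁻¹ : upperUnip k n) v = _
        have h1 : genericChar ψ a⁻¹ * genericChar ψ a = 1 := by
          rw [← map_mul, inv_mul_cancel, map_one]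
        rw [← one_smul R (ρ _ v), ← h1, ← smul_smul, ← map_smul, ← ha, ← Module.End.mul_apply,
          ← map_mul, ← Subgroup.coe_mul, inv_mul_cancel]
        simp }
  have h := mem_of_unipCol_mem (Q.map (upperUnip k n).subtype) u fun c =>
    ⟨unipCol c _, ?_, rfl⟩
  · obtain ⟨u', hu', he⟩ := h
    rwa [← Subtype.ext he]
  · rcases Nat.eq_zero_or_pos (c : ℕ) with hc | hc
    · rw [unipCol_eq_one_of_forall]
      · exact Q.one_mem
      · intro i hi
        rw [Fin.lt_def] at hi
        omega
    · change ρ _ v = _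
      rw [hv c (Nat.zero_le _) hc, genericChar_unipCol hc]

lemma eq_zero_of_genericFrom (hcusp : IsCuspidal k ρ) {c : Fin n} (hc : 0 < (c : ℕ)) {v : V}
    (hv : GenericFrom ρ ψ (c + 1) v) (hfix : ∀ w : Fin n → k, ρ (unipCol c w) v = v) : v = 0 := by
  refine hcusp c (n - c) hc (by omega) (by omega) v fun g hg => ?_
  have hgN : g ∈ upperUnip k n := fun i j hij => hg i j fun h => by
    rw [Fin.le_def] at hij; omega
  let P : Subgroup (GL (Fin n) k) :=
    { carrier := {u | ρ u v = v}
      one_mem' := by simp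
      mul_mem' := by
        intro a b (ha : ρ a v = _) (hb : ρ b v = _)
        change ρ (a * b) v = _
        rw [map_mul, Module.End.mul_apply, hb, ha]
      inv_mem' := by
        intro a (ha : ρ a v = _)
        change ρ a⁻¹ v = _
        nth_rw 1 [← ha]
        rw [← Module.End.mul_apply, ← map_mul, inv_mul_cancel, map_one, Module.End.one_apply] }
  refine mem_of_unipCol_mem P ⟨g, hgN⟩ fun d => ?_
  rcases lt_trichotomy c d with hd | rfl | hd
  · rw [Fin.lt_def] at hd
    have hp := predIdx_val d
    change ρ _ v = v
    rw [hv d hd (by omega), hg _ _ (by omega), one_apply_ne, AddChar.map_zero_eq_one, one_smul]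
    intro h
    rw [h] at hp
    omega
  · exact hfix _
  · rw [unipCol_eq_one_of_forall]
    · exact P.one_mem
    · intro i hi
      rw [Fin.lt_def] at hd hi
      change g.val i d = 0
      rw [hg _ _ (by omega), one_apply_ne]
      intro h
      rw [h] at hi
      omega

variable [Fintype k]

/-- The unnormalised projection to an eigenspace of the group of unipotent matrices whose only
nontrivial column is `c`. -/
noncomputable def colProj (ρ : Representation R (GL (Fin n) k) V) (ψ : AddChar k R) (c : Fin n)
    (a : Fin n → k) (v : V) : V := ∑ w : Fin n → k, ψ (-(a ⬝ᵥ w)) • ρ (unipCol c w) v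

lemma apply_colProj (c : Fin n) (a w : Fin n → k) (v : V) :
    ρ (unipCol c w) (colProj ρ ψ c a v) = ψ (a ⬝ᵥ w) • colProj ρ ψ c a v := by
  rw [colProj, map_sum, Finset.smul_sum]
  refine Fintype.sum_equiv (Equiv.addLeft w) _ _ fun x => ?_
  rw [Equiv.coe_addLeft, unipCol_add, Subgroup.coe_mul, map_mul, Module.End.mul_apply, map_smul,
    smul_smul, ← AddChar.map_add_eq_mul, dotProduct_add]
  congr 2
  ring

omit [Fintype k] in
lemma exists_apply_mul_ne_one (hψ : ψ ≠ 1) {a : k} (ha : a ≠ 0) : ∃ s, ψ (a * s) ≠ 1 := by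
  by_contra! h
  refine hψ (DFunLike.ext _ _ fun s => ?_)
  rw [← mul_div_cancel₀ s ha, h, AddChar.one_apply]

lemma sum_colProj (hψ : ψ ≠ 1) (c : Fin n) (v : V) :
    ∑ a, colProj ρ ψ c a v = ((Fintype.card k : R) ^ n) • v := by
  classical
  have key : ∀ w : Fin n → k, ∑ a : Fin n → k, ψ (-(a ⬝ᵥ w)) =
      if w = 0 then (Fintype.card k : R) ^ n else 0 := by
    intro w
    split_ifs with hw
    · simp [hw]
    · obtain ⟨i, hi⟩ := Function.ne_iff.1 hw
      let χ : AddChar (Fin n → k) R :=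
        { toFun := fun a => ψ (-(a ⬝ᵥ w))
          map_zero_eq_one' := by simp
          map_add_eq_mul' := by intro a b; rw [add_dotProduct, neg_add, AddChar.map_add_eq_mul] }
      refine AddChar.sum_eq_zero_of_ne_one (ψ := χ) fun h => ?_
      obtain ⟨s, hs⟩ := exists_apply_mul_ne_one hψ hi
      refine hs ?_
      have h1 : χ (Pi.single i (-s)) = 1 := by rw [h]; rfl
      have h2 : χ (Pi.single i (-s)) = ψ (-(Pi.single i (-s) ⬝ᵥ w)) := rfl
      rw [single_dotProduct, h1, neg_mul, neg_neg, mul_comm] at h2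
      exact h2.symm
  simp only [colProj]
  rw [Finset.sum_comm]
  simp_rw [← Finset.sum_smul, key, ite_smul, zero_smul]
  rw [Finset.sum_ite_eq' Finset.univ 0]
  simp [unipCol_zero]

omit [Fintype k] in
lemma apply_unipCol_apply {c : Fin n} {g : GL (Fin n) k}
    (hg : ∀ l, c ≤ l → ∀ j, g.val l j = (1 : Matrix _ _ k) l j) {d : Fin n} (hd : c ≤ d)
    (hd0 : 0 < (d : ℕ)) (w : Fin n → k) (v : V) :
    ∃ w' : Fin n → k, (∀ i, d ≤ i → w' i = 0) ∧
      (∀ i < d, (g.val *ᵥ w') i = w i) ∧ (c < d → w' (predIdx d) = w (predIdx d)) ∧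
      ρ (unipCol d w) (ρ g v) = ρ g (ρ (unipCol d w') v) := by
  obtain ⟨w', h1, h2, h3, h4⟩ := exists_unipCol_mul_eq hg hd
    (w := fun i => if i < d then w i else 0) fun i hi => if_neg hi.not_gt
  have h5 := predIdx_val d
  refine ⟨w', h1, fun i hi => by rw [h2]; exact if_pos hi, fun hcd => ?_, ?_⟩
  · rw [h3 _ (Fin.le_def.2 (by rw [Fin.lt_def] at hcd; omega)),
      if_pos (Fin.lt_def.2 (by omega))]
  · rw [unipCol_mask] at h4
    rw [← Module.End.mul_apply, ← map_mul, h4, map_mul, Module.End.mul_apply]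

omit [Fintype k] in
lemma GenericFrom.apply {c : Fin n} {v : V} (hv : GenericFrom ρ ψ (c + 1) v) {g : GL (Fin n) k}
    (hg : ∀ l, c ≤ l → ∀ j, g.val l j = (1 : Matrix _ _ k) l j) :
    GenericFrom ρ ψ (c + 1) (ρ g v) := by
  intro d hd hd0 w
  obtain ⟨w', -, -, h, h'⟩ := apply_unipCol_apply (ρ := ρ) hg (Fin.le_def.2 (by omega)) hd0 w v
  rw [h', hv d hd hd0, h (Fin.lt_def.2 (by omega)), map_smul]

lemma GenericFrom.colProj {c : Fin n} {v : V} (hv : GenericFrom ρ ψ (c + 1) v) (a : Fin n → k) :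
    GenericFrom ρ ψ (c + 1) (colProj ρ ψ c a v) := by
  intro d hd hd0 w
  rw [_root_.colProj, map_sum, Finset.smul_sum]
  refine Finset.sum_congr rfl fun x _ => ?_
  rw [map_smul, (hv.apply fun l hl => unipCol_row_eq hl x) d hd hd0, smul_comm]

lemma exists_gl_row {K : Type*} [Field K] (a : Fin n → K) {c r i : Fin n} (hr : r < c)
    (hi : i < c) (ha : a i ≠ 0) : ∃ g : GL (Fin n) K, (∀ j, g.val r j = a j) ∧
      ∀ l, c ≤ l → ∀ j, g.val l j = (1 : Matrix _ _ K) l j := by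
  let s := Equiv.swap i r
  let M : Matrix (Fin n) (Fin n) K := (updateRow 1 r (a ∘ s)).submatrix id s
  have hdet : M.det ≠ 0 := by
    have h1 : (updateRow (1 : Matrix (Fin n) (Fin n) K) r (a ∘ s)).det = a i := by
      have := cramer_transpose_apply (1 : Matrix (Fin n) (Fin n) K) (a ∘ s) r
      rw [← this, transpose_one, cramer_one]
      simp [s]
    rw [det_permute', h1]
    refine mul_ne_zero ?_ ha
    rcases Int.units_eq_one_or (Equiv.Perm.sign s) with h | h <;> simp [h]
  refine ⟨GeneralLinearGroup.mkOfDetNeZero M hdet, fun j => ?_, fun l hl j => ?_⟩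
  · change (updateRow (1 : Matrix (Fin n) (Fin n) K) r (a ∘ s)) r (s j) = a j
    rw [updateRow_self]
    simp [s]
  · change (updateRow (1 : Matrix (Fin n) (Fin n) K) r (a ∘ s)) l (s j) = _
    rw [updateRow_ne (hr.trans_le hl).ne']
    have : s l = l := Equiv.swap_apply_of_ne_of_ne (hi.trans_le hl).ne' (hr.trans_le hl).ne'
    simp only [one_apply]
    congr 1
    rw [← this, EmbeddingLike.apply_eq_iff_eq, this]

/-- In a cuspidal representation, a subspace containing all Whittaker vectors which is stable
under rational translations, and contains the vectors on which some column acts through an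
irrational character, is everything. -/
theorem eq_top_of_whittaker_mem (hψ : ψ ≠ 1) (hk : (Fintype.card k : R) ≠ 0)
    (K : Type) [Field K] [Algebra K k] (hcusp : IsCuspidal k ρ) (S : Submodule R V)
    (hS1 : ∀ (c : Fin n) (a : Fin n → k) (v : V),
      (∀ w, ρ (unipCol c w) v = ψ (a ⬝ᵥ w) • v) →
      (∃ i < c, a i ∉ Set.range (algebraMap K k)) → v ∈ S)
    (hS2 : ∀ g ∈ glBase K k n, ∀ v, ρ g v ∈ S → v ∈ S)
    (hW : ∀ v, (∀ u : upperUnip k n, ρ u v = genericChar ψ u • v) → v ∈ S) : S = ⊤ := by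
  have main : ∀ j, j ≤ n → ∀ v, GenericFrom ρ ψ j v → v ∈ S := by
    intro j
    induction j with
    | zero => exact fun _ v hv => hW v (apply_eq_of_genericFrom_zero hv)
    | succ j ih =>
      intro hj v hv
      let c : Fin n := ⟨j, hj⟩
      rcases Nat.eq_zero_or_pos j with rfl | hj0
      · exact ih (Nat.zero_le _) v fun d _ hd0 => hv d hd0 hd0
      have hsum : ∑ a, colProj ρ ψ c a v ∈ S := by
        refine Submodule.sum_mem _ fun a _ => ?_
        set x := colProj ρ ψ c a v with hx
        have hxg : GenericFrom ρ ψ (c + 1) x := hv.colProj (c := c) a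
        have hxa : ∀ w, ρ (unipCol c w) x = ψ (a ⬝ᵥ w) • x := fun w => apply_colProj c a w v
        by_cases hsupp : ∃ i, c ≤ i ∧ a i ≠ 0
        · obtain ⟨i, hi, hai⟩ := hsupp
          obtain ⟨s, hs⟩ := exists_apply_mul_ne_one hψ hai
          have h1 := hxa (Pi.single i s)
          rw [unipCol_eq_one_of_forall fun l hl => Pi.single_eq_of_ne (hl.trans_le hi).ne _,
            dotProduct_single, Subgroup.coe_one, map_one, Module.End.one_apply] at h1
          have h2 : (ψ (a i * s) - 1) • x = 0 := by rw [sub_smul, ← h1, one_smul, sub_self]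
          rw [(smul_eq_zero.1 h2).resolve_left (sub_ne_zero.2 hs)]
          exact S.zero_mem
        push Not at hsupp
        by_cases ha0 : ∀ i, a i = 0
        · rw [eq_zero_of_genericFrom hcusp hj0 hxg fun w => ?_]
          · exact S.zero_mem
          · rw [hxa w, show a = 0 from funext ha0, zero_dotProduct, AddChar.map_zero_eq_one,
              one_smul]
        push Not at ha0
        obtain ⟨i, hi⟩ := ha0
        by_cases hrat : ∃ i < c, a i ∉ Set.range (algebraMap K k)
        · exact hS1 c a x hxa hrat
        push Not at hrat
        have hic : i < c := not_le.1 fun h => hi (hsupp i h)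
        have hall : ∀ i, ∃ b, algebraMap K k b = a i := fun i => by
          by_cases h : i < c
          · exact hrat i h
          · exact ⟨0, by rw [map_zero, hsupp i (not_lt.1 h)]⟩
        choose b hb using hall
        have hpc : predIdx c < c := Fin.lt_def.2 (by rw [predIdx_val]; omega)
        obtain ⟨g, hg1, hg2⟩ := exists_gl_row b hpc hic (fun h => hi (by rw [← hb, h, map_zero]))
        let g' : GL (Fin n) k := Units.map ((algebraMap K k).mapMatrix.toMonoidHom :
          Matrix (Fin n) (Fin n) K →* Matrix (Fin n) (Fin n) k) g
        have hg'v : ∀ i j, g'.val i j = algebraMap K k (g.val i j) := fun _ _ => rfl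
        have hg' : ∀ l, c ≤ l → ∀ j, g'.val l j = (1 : Matrix _ _ k) l j := by
          intro l hl j
          rw [hg'v, hg2 l hl, one_apply, one_apply]
          split_ifs <;> simp
        refine hS2 g' ⟨g, rfl⟩ x (ih (by omega) _ fun d hd hd0 w => ?_)
        rcases (Nat.eq_or_lt_of_le hd) with hd | hd
        · obtain rfl : d = c := Fin.ext hd.symm
          obtain ⟨w', -, h2, -, h4⟩ := apply_unipCol_apply (ρ := ρ) hg' le_rfl hd0 w x
          have h5 : a ⬝ᵥ w' = w (predIdx c) := by
            rw [← h2 _ hpc]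
            refine Finset.sum_congr rfl fun i _ => ?_
            change a i * w' i = g'.val (predIdx c) i * w' i
            rw [hg'v, hg1, hb]
          rw [h4, hxa, map_smul, h5]
        · exact hxg.apply hg' d hd hd0 w
      rw [sum_colProj hψ] at hsum
      exact (S.smul_mem_iff (pow_ne_zero n hk)).1 hsum
  rw [eq_top_iff]
  intro v _
  exact main n le_rfl v fun c hc _ => absurd c.2 (not_lt.2 hc)

end WhittakerInduction

section UnipotentCard

variable {k : Type*} [Field k] {n : ℕ}

lemma isPGroup_upperUnip (p : ℕ) [Fact p.Prime] [CharP k p] : IsPGroup p (upperUnip k n) := by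
  intro u
  rcases n with _ | n
  · exact ⟨0, Subtype.ext (Units.ext (Subsingleton.elim _ _))⟩
  set N : Matrix (Fin (n + 1)) (Fin (n + 1)) k := (u : GL (Fin (n + 1)) k).val - 1 with hN
  have hN0 : ∀ i j, j ≤ i → N i j = 0 := fun i j hij => by
    rw [hN, Matrix.sub_apply, u.2 i j hij, sub_self]
  have hchar : N.charpoly = Polynomial.X ^ (n + 1) := by
    rw [charpoly_of_isUpperTriangular N fun i j hij => hN0 i j (le_of_lt hij)]
    simp [hN0 _ _ le_rfl]
  have hnil : N ^ (n + 1) = 0 := by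
    have := aeval_self_charpoly N
    rwa [hchar, map_pow, Polynomial.aeval_X] at this
  have hle : n + 1 ≤ p ^ (n + 1) := (Nat.lt_pow_self (Fact.out : p.Prime).one_lt).le
  refine ⟨n + 1, Subtype.ext (Units.ext ?_)⟩
  have h1 : (u : GL (Fin (n + 1)) k).val = 1 + N := by rw [hN]; abel
  change (u : GL (Fin (n + 1)) k).val ^ p ^ (n + 1) = 1
  rw [h1, add_pow_char_pow_of_commute _ _ (Commute.one_left N), one_pow,
    pow_eq_zero_of_le hle hnil, add_zero]

lemma natCast_card_ne_zero_of_isPGroup (p : ℕ) [Fact p.Prime] {N : Type*} [Group N] [Fintype N]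
    (h : IsPGroup p N) (R : Type*) [Field R] (hR : (p : R) ≠ 0) : (Fintype.card N : R) ≠ 0 := by
  obtain ⟨m, hm⟩ := IsPGroup.iff_card.1 h
  rw [← Nat.card_eq_fintype_card, hm, Nat.cast_pow]
  exact pow_ne_zero _ hR

variable (k n) in
/-- The unipotent radical of a maximal standard parabolic subgroup. -/
def unipRadical (a : ℕ) : Subgroup (GL (Fin n) k) where
  carrier := {g | ∀ i j : Fin n, ¬((i : ℕ) < a ∧ a ≤ (j : ℕ)) → g.val i j = (1 : Matrix _ _ k) i j}
  one_mem' := fun _ _ _ => rfl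
  mul_mem' := by
    intro g h hg hh i j hij
    rw [not_and_or] at hij
    rw [GeneralLinearGroup.coe_mul, Matrix.mul_apply]
    rcases hij with hi | hj
    · rw [Finset.sum_eq_single i, hg i i fun h => hi h.1, one_apply_eq, one_mul,
        hh i j fun h => hi h.1]
      · intro l _ hl
        rw [hg i l fun h => hi h.1, one_apply_ne hl.symm, zero_mul]
      · simp
    · rw [Finset.sum_eq_single j, hh j j fun h => hj h.2, one_apply_eq, mul_one,
        hg i j fun h => hj h.2]
      · intro l _ hl
        rw [hh l j fun h => hj h.2, one_apply_ne hl, mul_zero]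
      · simp
  inv_mem' := by
    intro g hg i j hij
    rw [not_and_or] at hij
    rcases hij with hi | hj
    · have h1 : (g * g⁻¹).val i j = (1 : Matrix _ _ k) i j := by rw [mul_inv_cancel]; rfl
      rw [GeneralLinearGroup.coe_mul, Matrix.mul_apply, Finset.sum_eq_single i,
        hg i i fun h => hi h.1, one_apply_eq, one_mul] at h1
      · exact h1
      · intro l _ hl
        rw [hg i l fun h => hi h.1, one_apply_ne hl.symm, zero_mul]
      · simp
    · have h1 : (g⁻¹ * g).val i j = (1 : Matrix _ _ k) i j := by rw [inv_mul_cancel]; rfl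
      rw [GeneralLinearGroup.coe_mul, Matrix.mul_apply, Finset.sum_eq_single j,
        hg j j fun h => hj h.2, one_apply_eq, mul_one] at h1
      · exact h1
      · intro l _ hl
        rw [hg l j fun h => hj h.2, one_apply_ne hl, mul_zero]
      · simp

lemma unipRadical_le (a : ℕ) : unipRadical k n a ≤ upperUnip k n := by
  intro g hg i j hij
  refine hg i j fun h => ?_
  rw [Fin.le_def] at hij
  omega

/-- The two blocks of a maximal standard parabolic subgroup. -/
def twoBlocks (n a : ℕ) (i : Fin n) : Fin 2 := if (i : ℕ) < a then 0 else 1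

lemma twoBlocks_lt {a : ℕ} {i j : Fin n} :
    twoBlocks n a i < twoBlocks n a j ↔ (i : ℕ) < a ∧ a ≤ (j : ℕ) := by
  simp only [twoBlocks]
  split_ifs <;> simp <;> omega

lemma conj_mem_unipRadical {k : Type} [Field k] {a : ℕ} {q u : GL (Fin n) k}
    (hq : q ∈ parabolic k n 2 (twoBlocks n a)) (hu : u ∈ unipRadical k n a) :
    q * u * q⁻¹ ∈ unipRadical k n a := by
  have hq' := inv_mem hq
  intro i j hij
  have h1 : (q * u * q⁻¹).val = 1 + q.val * (u.val - 1) * q⁻¹.val := by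
    rw [mul_sub, sub_mul, mul_one, ← GeneralLinearGroup.coe_mul, ← GeneralLinearGroup.coe_mul,
      ← GeneralLinearGroup.coe_mul, mul_inv_cancel]
    simp
  rw [h1, Matrix.add_apply, add_eq_left, Matrix.mul_apply]
  refine Finset.sum_eq_zero fun m _ => ?_
  rw [Matrix.mul_apply]
  by_cases hm : twoBlocks n a j < twoBlocks n a m
  · rw [hq' hm, mul_zero]
  rw [Finset.sum_eq_zero, zero_mul]
  intro l _
  by_cases hl : twoBlocks n a l < twoBlocks n a i
  · rw [hq hl, zero_mul]
  rw [Matrix.sub_apply, hu l m, sub_self, mul_zero]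
  intro h
  rw [twoBlocks_lt] at hm hl
  omega

end UnipotentCard

section Supercuspidal

variable {k : Type} [Field k] [Fintype k] {n : ℕ} {R : Type} [Field R]
  {E V : Type} [AddCommGroup E] [Module R E] [AddCommGroup V] [Module R V]
  (η : Representation R (GL (Fin n) k) E) {ρ : Representation R (GL (Fin n) k) V}

/-- The kernel of the projection to the coinvariants of a unipotent radical. -/
def coinvariantsKer (a : ℕ) : Submodule R E :=
  Submodule.span R {x | ∃ u ∈ unipRadical k n a, ∃ w, x = η u w - w}

omit [Fintype k] in
lemma coinvariantsKer_le {a : ℕ} {q : GL (Fin n) k} (hq : q ∈ parabolic k n 2 (twoBlocks n a)) :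
    coinvariantsKer η a ≤ (coinvariantsKer η a).comap (η q) := by
  rw [coinvariantsKer, Submodule.span_le]
  rintro _ ⟨u, hu, w, rfl⟩
  refine Submodule.subset_span ⟨_, conj_mem_unipRadical hq hu, η q w, ?_⟩
  rw [map_sub, ← Module.End.mul_apply (η (q * u * q⁻¹)), ← map_mul, inv_mul_cancel_right, map_mul,
    Module.End.mul_apply]

/-- The representation of a maximal standard parabolic subgroup on coinvariants. -/
def coinvariantsRep (a : ℕ) :
    Representation R (parabolic k n 2 (twoBlocks n a)) (E ⧸ coinvariantsKer η a) where
  toFun q := Submodule.mapQ _ _ (η q) (coinvariantsKer_le η q.2)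
  map_one' := by
    refine LinearMap.ext fun x => ?_
    obtain ⟨w, rfl⟩ := Submodule.mkQ_surjective _ x
    simp
  map_mul' q q' := by
    refine LinearMap.ext fun x => ?_
    obtain ⟨w, rfl⟩ := Submodule.mkQ_surjective _ x
    simp

omit [Fintype k] in
lemma coinvariantsRep_mk {a : ℕ} (q : parabolic k n 2 (twoBlocks n a)) (w : E) :
    coinvariantsRep η a q ((coinvariantsKer η a).mkQ w) = (coinvariantsKer η a).mkQ (η q w) := rfl

lemma notMem_coinvariantsKer (p : ℕ) [Fact p.Prime] [CharP k p] (hp : (p : R) ≠ 0) {a : ℕ} {v : E}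
    (hv : ∀ u ∈ unipRadical k n a, η u v = v) (hv0 : v ≠ 0) : v ∉ coinvariantsKer η a := by
  classical
  have : Fintype (unipRadical k n a) := Fintype.ofFinite _
  have hcard := natCast_card_ne_zero_of_isPGroup p (((isPGroup_upperUnip p)).to_le
    (unipRadical_le (k := k) (n := n) a)) R hp
  let m : E →ₗ[R] E := ∑ u : unipRadical k n a, η u
  have hle : coinvariantsKer η a ≤ LinearMap.ker m := by
    rw [coinvariantsKer, Submodule.span_le]
    rintro _ ⟨u, hu, w, rfl⟩
    rw [SetLike.mem_coe, LinearMap.mem_ker, map_sub, sub_eq_zero, LinearMap.sum_apply,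
      LinearMap.sum_apply]
    refine Fintype.sum_equiv (Equiv.mulRight ⟨u, hu⟩) _ _ fun x => ?_
    rw [← Module.End.mul_apply, ← map_mul]
    rfl
  intro h
  have h1 : m v = 0 := hle h
  rw [LinearMap.sum_apply, Finset.sum_congr rfl fun (u : unipRadical k n a) _ => hv u.1 u.2,
    Finset.sum_const,
    Finset.card_univ, ← Nat.cast_smul_eq_nsmul R] at h1
  exact hv0 ((smul_eq_zero.1 h1).resolve_left hcard)

/-- A representation of which a supercuspidal representation is the cosocle is cuspidal. -/
theorem IsSupercuspidal.isCuspidal (p : ℕ) [Fact p.Prime] [CharP k p] (hp : (p : R) ≠ 0)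
    (hsc : IsSupercuspidal k ρ) (π : E →ₗ[R] V) (hπ : ∀ g w, π (η g w) = ρ g (π w))
    (hsurj : Function.Surjective π)
    (hmax : ∀ W : Submodule R E, (∀ g, ∀ w ∈ W, η g w ∈ W) → W ≠ ⊤ → W ≤ LinearMap.ker π) :
    IsCuspidal k η := by
  intro a b ha hb hab v hv
  by_contra hv0
  have hvK := notMem_coinvariantsKer η p hp (a := a) (fun u hu => hv u hu) hv0
  let τ := coinvariantsRep η a
  let Φ : E →ₗ[R] indCarrier (parabolic k n 2 (twoBlocks n a)) τ :=
    { toFun := fun w => ⟨fun g => (coinvariantsKer η a).mkQ (η g w), fun q g => by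
        change (coinvariantsKer η a).mkQ (η (q * g) w) = _
        rw [coinvariantsRep_mk, map_mul, Module.End.mul_apply]⟩
      map_add' := fun x y => Subtype.ext (funext fun g => by simp)
      map_smul' := fun c x => Subtype.ext (funext fun g => by simp) }
  have hΦ : ∀ g w, Φ (η g w) = inducedRep _ τ g (Φ w) := fun g w =>
    Subtype.ext (funext fun x => by
      change (coinvariantsKer η a).mkQ (η x (η g w)) = (coinvariantsKer η a).mkQ (η (x * g) w)
      rw [map_mul, Module.End.mul_apply])
  have hker : LinearMap.ker Φ ≤ LinearMap.ker π := by
    refine hmax _ (fun g w hw => ?_) fun htop => hvK ?_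
    · rw [LinearMap.mem_ker] at hw ⊢
      rw [hΦ, hw, map_zero]
    · have h1 : Φ v = 0 := by rw [← LinearMap.mem_ker, htop]; trivial
      have h2 : (coinvariantsKer η a).mkQ (η 1 v) = 0 := congrFun (congrArg Subtype.val h1) 1
      rwa [map_one, Module.End.one_apply, Submodule.mkQ_apply, Submodule.Quotient.mk_eq_zero] at h2
  refine hsc 2 le_rfl (twoBlocks n a) ?_ ?_ _ τ ?_ ⟨LinearMap.range Φ, ?_, ?_⟩
  · intro i j hij
    simp only [twoBlocks]
    rw [Fin.le_def] at hij
    split_ifs <;> simp <;> omega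
  · intro c
    fin_cases c
    · exact ⟨⟨0, by omega⟩, by simp [twoBlocks, ha]⟩
    · exact ⟨⟨a, by omega⟩, by simp [twoBlocks]⟩
  · intro u hu
    refine LinearMap.ext fun x => ?_
    obtain ⟨w, rfl⟩ := Submodule.mkQ_surjective _ x
    rw [coinvariantsRep_mk, Module.End.one_apply, ← sub_eq_zero, ← map_sub, Submodule.mkQ_apply,
      Submodule.Quotient.mk_eq_zero]
    refine Submodule.subset_span ⟨u, fun i j hij => ?_, w, rfl⟩
    rw [← twoBlocks_lt] at hij
    rcases (not_lt.1 hij).lt_or_eq with h | h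
    · rw [u.2 h, one_apply_ne]
      rintro rfl
      exact lt_irrefl _ h
    · exact hu i j h.symm
  · rintro g _ ⟨w, rfl⟩
    exact ⟨η g w, hΦ g w⟩
  · let f : LinearMap.range Φ →ₗ[R] V :=
      ((LinearMap.ker Φ).liftQ π hker).comp Φ.quotKerEquivRange.symm.toLinearMap
    have hf : ∀ w, f ⟨Φ w, w, rfl⟩ = π w := fun w => by
      have : Φ.quotKerEquivRange.symm ⟨Φ w, w, rfl⟩ = (LinearMap.ker Φ).mkQ w := by
        rw [LinearEquiv.symm_apply_eq]; rfl
      change (LinearMap.ker Φ).liftQ π hker (Φ.quotKerEquivRange.symm ⟨Φ w, w, rfl⟩) = _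
      rw [this]; rfl
    refine ⟨f, fun v => ?_, ?_⟩
    · obtain ⟨w, rfl⟩ := hsurj v
      exact ⟨_, hf w⟩
    · rintro g ⟨_, w, rfl⟩
      rw [hf, ← hπ, ← hf]
      congr 1
      exact Subtype.ext (hΦ g w).symm

end Supercuspidal

section CyclicComparison

variable {R : Type} [Field R] {G : Type} [Group G] {E V : Type} [AddCommGroup E] [Module R E]
  [AddCommGroup V] [Module R V]

lemma Representation.asAlgebraHom_mem (η : Representation R G E) {W : Submodule R E}
    (hW : ∀ g, ∀ w ∈ W, η g w ∈ W) (f : MonoidAlgebra R G) {w : E} (hw : w ∈ W) :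
    η.asAlgebraHom f w ∈ W := by
  induction f using MonoidAlgebra.induction_on with
  | of g => rw [Representation.asAlgebraHom_of]; exact hW g w hw
  | add f f' hf hf' => rw [map_add]; exact W.add_mem hf hf'
  | smul r f hf => rw [map_smul]; exact W.smul_mem r hf

/-- The submodule generated by a vector of a representation. -/
noncomputable def Representation.cyclicSpan (η : Representation R G E) (m : E) : Submodule R E :=
  LinearMap.range (η.asAlgebraHom.toLinearMap.flip m)

lemma Representation.mem_cyclicSpan (η : Representation R G E) {m x : E} :
    x ∈ η.cyclicSpan m ↔ ∃ f, η.asAlgebraHom f m = x := Iff.rfl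

lemma Representation.apply_mem_cyclicSpan (η : Representation R G E) (m : E) (g : G) {x : E}
    (hx : x ∈ η.cyclicSpan m) : η g x ∈ η.cyclicSpan m := by
  obtain ⟨f, rfl⟩ := η.mem_cyclicSpan.1 hx
  refine ⟨MonoidAlgebra.of R G g * f, ?_⟩
  change η.asAlgebraHom (_ * f) m = _
  rw [map_mul, Representation.asAlgebraHom_of, Module.End.mul_apply]

lemma Representation.self_mem_cyclicSpan (η : Representation R G E) (m : E) :
    m ∈ η.cyclicSpan m := ⟨1, by change η.asAlgebraHom 1 m = _; rw [map_one, Module.End.one_apply]⟩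

lemma IsIrreducibleRep.cyclicSpan_eq_top {ρ : Representation R G V} (hirr : IsIrreducibleRep ρ)
    {v : V} (hv : v ≠ 0) : ρ.cyclicSpan v = ⊤ := by
  refine (hirr.2 _ fun g x hx => ρ.apply_mem_cyclicSpan v g hx).resolve_left fun h => hv ?_
  rw [← Submodule.mem_bot R, ← h]
  exact ρ.self_mem_cyclicSpan v

/-- If an element of the group algebra acts compatibly on a cyclic representation and on an
irreducible one, then the irreducible representation is the cosocle of the cyclic one. -/
theorem IsIrreducibleRep.exists_cosocle_map {ρ : Representation R G V} (hirr : IsIrreducibleRep ρ)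
    (η : Representation R G E) {m₀ : E} {v₀ : V} (hgen : η.cyclicSpan m₀ = ⊤) (hm₀ : m₀ ≠ 0)
    (hv₀ : v₀ ≠ 0) (z : MonoidAlgebra R G) {N : R} (hN : N ≠ 0)
    (hz : ρ.asAlgebraHom z v₀ = N • v₀) (χ : G → R)
    (hη : ∀ g, η.asAlgebraHom z (η g m₀) = χ g • m₀)
    (hρ : ∀ g, ρ.asAlgebraHom z (ρ g v₀) = χ g • v₀) :
    ∃ π : E →ₗ[R] V, (∀ g w, π (η g w) = ρ g (π w)) ∧ Function.Surjective π ∧ π m₀ = v₀ ∧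
      (∀ W : Submodule R E, (∀ g, ∀ w ∈ W, η g w ∈ W) → W ≠ ⊤ → W ≤ LinearMap.ker π) ∧
      ∀ w, π w = 0 → η.asAlgebraHom z w = 0 := by
  have hc : ∀ f : MonoidAlgebra R G, ∃ c : R, η.asAlgebraHom z (η.asAlgebraHom f m₀) = c • m₀ ∧
      ρ.asAlgebraHom z (ρ.asAlgebraHom f v₀) = c • v₀ := by
    intro f
    induction f using MonoidAlgebra.induction_on with
    | of g => exact ⟨χ g, by rw [Representation.asAlgebraHom_of, hη],
        by rw [Representation.asAlgebraHom_of, hρ]⟩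
    | add f f' hf hf' =>
      obtain ⟨c, h1, h2⟩ := hf
      obtain ⟨c', h1', h2'⟩ := hf'
      exact ⟨c + c', by rw [map_add, LinearMap.add_apply, map_add, h1, h1', add_smul],
        by rw [map_add, LinearMap.add_apply, map_add, h2, h2', add_smul]⟩
    | smul r f hf =>
      obtain ⟨c, h1, h2⟩ := hf
      exact ⟨r * c, by rw [map_smul, LinearMap.smul_apply, map_smul, h1, smul_smul],
        by rw [map_smul, LinearMap.smul_apply, map_smul, h2, smul_smul]⟩
  let a : MonoidAlgebra R G →ₗ[R] E := η.asAlgebraHom.toLinearMap.flip m₀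
  let b : MonoidAlgebra R G →ₗ[R] V := ρ.asAlgebraHom.toLinearMap.flip v₀
  have ha : Function.Surjective a := LinearMap.range_eq_top.1 hgen
  have hamul : ∀ g f, a (MonoidAlgebra.of R G g * f) = η g (a f) := fun g f => by
    change η.asAlgebraHom (_ * f) m₀ = _
    rw [map_mul, Representation.asAlgebraHom_of, Module.End.mul_apply]; rfl
  have hbmul : ∀ g f, b (MonoidAlgebra.of R G g * f) = ρ g (b f) := fun g f => by
    change ρ.asAlgebraHom (_ * f) v₀ = _
    rw [map_mul, Representation.asAlgebraHom_of, Module.End.mul_apply]; rfl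
  have hker : LinearMap.ker a ≤ LinearMap.ker b := by
    intro f hf
    by_contra hbf
    rw [LinearMap.mem_ker] at hf hbf
    obtain ⟨f', hf'⟩ : v₀ ∈ ρ.cyclicSpan (b f) := by rw [hirr.cyclicSpan_eq_top hbf]; trivial
    obtain ⟨c, h1, h2⟩ := hc (f' * f)
    rw [map_mul, Module.End.mul_apply] at h1 h2
    change η.asAlgebraHom z (η.asAlgebraHom f' (a f)) = _ at h1
    change ρ.asAlgebraHom z (ρ.asAlgebraHom f' (b f)) = _ at h2
    change ρ.asAlgebraHom f' (b f) = v₀ at hf'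
    rw [hf, map_zero, map_zero] at h1
    rw [hf', hz, (smul_eq_zero.1 h1.symm).resolve_right hm₀, zero_smul] at h2
    exact (smul_ne_zero hN hv₀) h2
  let π : E →ₗ[R] V := ((LinearMap.ker a).liftQ b hker).comp
    (a.quotKerEquivOfSurjective ha).symm.toLinearMap
  have hπ : ∀ f, π (a f) = b f := fun f => by
    change (LinearMap.ker a).liftQ b hker ((a.quotKerEquivOfSurjective ha).symm (a f)) = _
    have : (a.quotKerEquivOfSurjective ha).symm (a f) = (LinearMap.ker a).mkQ f := by
      rw [LinearEquiv.symm_apply_eq]; rfl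
    rw [this]; rfl
  have hπeq : ∀ g w, π (η g w) = ρ g (π w) := fun g w => by
    obtain ⟨f, rfl⟩ := ha w
    rw [← hamul, hπ, hπ, hbmul]
  have hb : Function.Surjective b := LinearMap.range_eq_top.1 (hirr.cyclicSpan_eq_top hv₀)
  refine ⟨π, hπeq, fun v => ?_, ?_, fun W hW hWtop w hw => ?_, fun w hw => ?_⟩
  · obtain ⟨f, rfl⟩ := hb v
    exact ⟨a f, hπ f⟩
  · have h1 : a 1 = m₀ := by
      change η.asAlgebraHom 1 m₀ = _; rw [map_one, Module.End.one_apply]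
    have h2 : b 1 = v₀ := by
      change ρ.asAlgebraHom 1 v₀ = _; rw [map_one, Module.End.one_apply]
    rw [← h1, hπ, h2]
  · by_contra hne
    have htop : W.map π = ⊤ := by
      refine (hirr.2 (W.map π) ?_).resolve_left fun h => hne ?_
      · rintro g _ ⟨x, hx, rfl⟩
        exact ⟨η g x, hW g x hx, hπeq g x⟩
      · rw [LinearMap.mem_ker, ← Submodule.mem_bot R, ← h]
        exact ⟨w, hw, rfl⟩
    obtain ⟨w₁, hw₁, hv₁⟩ : v₀ ∈ W.map π := by rw [htop]; trivial
    obtain ⟨f, rfl⟩ := ha w₁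
    obtain ⟨c, h1, h2⟩ := hc f
    change ρ.asAlgebraHom z (b f) = _ at h2
    rw [hπ] at hv₁
    rw [hv₁, hz] at h2
    obtain rfl : N = c := smul_left_injective R hv₀ h2
    have h3 : N • m₀ ∈ W := h1 ▸ η.asAlgebraHom_mem hW z hw₁
    refine hWtop (eq_top_iff.2 ?_)
    rw [← hgen]
    rintro _ ⟨f, rfl⟩
    exact η.asAlgebraHom_mem hW f ((W.smul_mem_iff hN).1 h3)
  · obtain ⟨f, rfl⟩ := ha w
    obtain ⟨c, h1, h2⟩ := hc f
    rw [hπ] at hw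
    change ρ.asAlgebraHom z (b f) = _ at h2
    change η.asAlgebraHom z (a f) = _ at h1
    rw [hw, map_zero] at h2
    rw [h1, (smul_eq_zero.1 h2.symm).resolve_right hv₀, zero_smul]

end CyclicComparison

section Coefficients

lemma exists_cyclotomic_coefficients (p : ℕ) [Fact p.Prime] (R : Type) [Field R] [IsAlgClosed R]
    (hp : (p : R) ≠ 0) : ∃ (A : Type) (_ : CommRing A) (_ : IsDomain A) (i : A →+* ℂ) (j : A →+* R)
      (ζ : A), Function.Injective i ∧ ζ ^ p = 1 ∧ j ζ ≠ 1 := by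
  have hp1 := (Fact.out : p.Prime)
  have hprim := Complex.isPrimitiveRoot_exp p hp1.ne_zero
  set z := Complex.exp (2 * Real.pi * Complex.I / p)
  have hint : IsIntegral ℤ z := hprim.isIntegral hp1.pos
  obtain ⟨w, hw⟩ := IsAlgClosed.exists_root (Polynomial.cyclotomic p R) (by
    rw [Polynomial.degree_cyclotomic, Nat.totient_prime hp1]
    have := hp1.two_le
    exact_mod_cast (by omega : p - 1 ≠ 0))
  have hw1 : w ≠ 1 := by
    rintro rfl
    rw [Polynomial.IsRoot, Polynomial.eval_one_cyclotomic_prime] at hw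
    exact hp hw
  have hev : (minpoly ℤ z).eval₂ (Int.castRingHom R) w = 0 := by
    rw [← Polynomial.cyclotomic_eq_minpoly hprim hp1.pos, Polynomial.eval₂_eq_eval_map,
      Polynomial.map_cyclotomic]
    exact hw
  let e := minpoly.equivAdjoin hint
  let j : AdjoinRoot (minpoly ℤ z) →+* R := AdjoinRoot.lift (Int.castRingHom R) w hev
  refine ⟨Algebra.adjoin ℤ {z}, inferInstance, inferInstance,
    (Algebra.adjoin ℤ {z}).val.toRingHom, j.comp e.symm.toRingEquiv.toRingHom,
    ⟨z, Algebra.self_mem_adjoin_singleton ℤ z⟩, Subtype.val_injective,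
    Subtype.ext hprim.pow_eq_one, ?_⟩
  have h1 : e (AdjoinRoot.root _) = ⟨z, Algebra.self_mem_adjoin_singleton ℤ z⟩ := by
    apply Subtype.ext
    change ((AdjoinRoot.Minpoly.toAdjoin ℤ z (AdjoinRoot.root _) : Algebra.adjoin ℤ {z}) : ℂ) = z
    simp
  change j (e.symm _) ≠ 1
  rw [← h1, AlgEquiv.symm_apply_apply]
  change AdjoinRoot.lift (Int.castRingHom R) w hev (AdjoinRoot.root _) ≠ 1
  rwa [AdjoinRoot.lift_root]

variable {k₀ k : Type} [Field k₀] [Field k] [Algebra k₀ k]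

lemma exists_addMonoidHom_zmod (p : ℕ) [Fact p.Prime] [CharP k p]
    (hquad : Module.finrank k₀ k = 2) :
    ∃ f : k →+ ZMod p, (∀ x, f (algebraMap k₀ k x) = 0) ∧ Function.Surjective f := by
  let _ : Algebra (ZMod p) k := ZMod.algebra k p
  let S : Submodule (ZMod p) k := AddSubgroup.toZModSubmodule p (algebraMap k₀ k).range.toAddSubgroup
  have hS : S < ⊤ := by
    refine lt_top_iff_ne_top.2 fun h => ?_
    have hsurj : Function.Surjective (algebraMap k₀ k) := fun x => by
      have : x ∈ S := by rw [h]; trivial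
      exact this
    have h1 : Module.finrank k₀ k = 1 := by
      rw [← Module.finrank_self k₀]
      exact (LinearEquiv.ofBijective (Algebra.linearMap k₀ k)
        ⟨(algebraMap k₀ k).injective, hsurj⟩).finrank_eq.symm
    omega
  obtain ⟨f, hf, hle⟩ := Submodule.exists_le_ker_of_lt_top S hS
  refine ⟨f.toAddMonoidHom, fun x => hle ⟨x, rfl⟩, ?_⟩
  exact LinearMap.surjective hf

/-- Existence of a nontrivial additive character, trivial on the small field, with values in a
subring of `ℂ` that also maps to `R`. -/
lemma exists_addChar (p : ℕ) [Fact p.Prime] [CharP k p] (hquad : Module.finrank k₀ k = 2)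
    (R : Type) [Field R] [IsAlgClosed R] (hp : (p : R) ≠ 0) :
    ∃ (A : Type) (_ : CommRing A) (_ : IsDomain A) (i : A →+* ℂ) (j : A →+* R) (ψ : AddChar k A),
      Function.Injective i ∧ (∀ x, ψ (algebraMap k₀ k x) = 1) ∧ (∃ x, j (ψ x) ≠ 1) ∧
      ∀ x, starRingEnd ℂ (i (ψ x)) = i (ψ (-x)) := by
  obtain ⟨A, _, _, i, j, ζ, hi, hζ, hj⟩ := exists_cyclotomic_coefficients p R hp
  obtain ⟨f, hf, hfs⟩ := exists_addMonoidHom_zmod (k₀ := k₀) (k := k) p hquad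
  let ψ : AddChar k A := (AddChar.zmodChar p hζ).compAddMonoidHom f
  have hψ : ∀ x, ψ x = ζ ^ (f x).val := fun x => rfl
  refine ⟨A, _, inferInstance, i, j, ψ, hi, fun x => ?_, ?_, fun x => ?_⟩
  · rw [hψ, hf, ZMod.val_zero, pow_zero]
  · obtain ⟨x, hx⟩ := hfs 1
    refine ⟨x, ?_⟩
    rw [hψ, hx, ZMod.val_one, pow_one]
    exact hj
  · have h1 : i (ψ x) ^ p = 1 := by
      rw [hψ, ← map_pow, ← pow_mul, mul_comm, pow_mul, hζ, one_pow, map_one]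
    have h2 : ‖i (ψ x)‖ = 1 := Complex.norm_eq_one_of_pow_eq_one h1 (Fact.out : p.Prime).ne_zero
    have h3 : i (ψ x) * i (ψ (-x)) = 1 := by
      rw [← map_mul, ← AddChar.map_add_eq_mul, add_neg_cancel, AddChar.map_zero_eq_one, map_one]
    rw [← Complex.inv_eq_conj h2]
    exact inv_eq_of_mul_eq_one_right h3

variable {A : Type*} [CommRing A] {ψ : AddChar k A}

lemma addChar_aut [Fintype k] (hquad : Module.finrank k₀ k = 2) {σ : k ≃ₐ[k₀] k} (hσ : σ ≠ AlgEquiv.refl)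
    (hψ : ∀ x, ψ (algebraMap k₀ k x) = 1) (x : k) : ψ (σ x) = ψ (-x) := by
  have h : σ (x + σ x) = x + σ x := by rw [map_add, aut_sq_of_finrank_two hquad, add_comm]
  obtain ⟨y, hy⟩ := mem_range_of_fixed hquad σ hσ h
  have h1 : σ x = -x + algebraMap k₀ k y := by rw [hy]; ring
  rw [h1, AddChar.map_add_eq_mul, hψ, mul_one]

lemma exists_addChar_mul_ne_one (hquad : Module.finrank k₀ k = 2)
    (hψ : ∀ x, ψ (algebraMap k₀ k x) = 1) (hψ1 : ∃ x, ψ x ≠ 1) {a : k}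
    (ha : a ∉ Set.range (algebraMap k₀ k)) : ∃ u : k₀, ψ (a * algebraMap k₀ k u) ≠ 1 := by
  have hli : LinearIndependent k₀ ![(1 : k), a] := by
    rw [LinearIndependent.pair_iff]
    intro s t hst
    rcases eq_or_ne t 0 with rfl | ht
    · rw [zero_smul, add_zero, smul_eq_zero] at hst
      exact ⟨hst.resolve_right one_ne_zero, rfl⟩
    · refine absurd ⟨-(t⁻¹ * s), ?_⟩ ha
      have ht' : algebraMap k₀ k t ≠ 0 := by simpa using ht
      rw [Algebra.smul_def, Algebra.smul_def, mul_one] at hst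
      rw [map_neg, map_mul, map_inv₀]
      field_simp
      linear_combination -hst
  have := Module.finite_of_finrank_eq_succ hquad
  have hspan := hli.span_eq_top_of_card_eq_finrank' (by simp [hquad])
  by_contra! h
  obtain ⟨x, hx⟩ := hψ1
  have hxs : x ∈ Submodule.span k₀ (Set.range ![(1 : k), a]) := by rw [hspan]; trivial
  rw [Matrix.range_cons, Matrix.range_cons, Matrix.range_empty, Set.union_empty,
    Set.singleton_union, Submodule.mem_span_pair] at hxs
  obtain ⟨s, t, rfl⟩ := hxs
  apply hx
  rw [Algebra.smul_def, Algebra.smul_def, mul_one, AddChar.map_add_eq_mul, hψ, mul_comm _ a, h,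
    one_mul]

end Coefficients

section IntegralGelfand

open scoped MonoidAlgebra

variable {A R G : Type*} [CommRing A] [CommRing R] [Group G]

lemma pushHom_id_mul (f : A →+* R) (x y : A[G]) :
    pushHom f id (x * y) = pushHom f id x * pushHom f id y := by
  induction x using MonoidAlgebra.induction_linear with
  | zero => simp
  | add x x' hx hx' => simp [add_mul, hx, hx']
  | single g a =>
    induction y using MonoidAlgebra.induction_linear with
    | zero => simp
    | add y y' hy hy' => simp [mul_add, hy, hy']
    | single h b => simp

lemma pushHom_id_of (f : A →+* R) (g : G) :
    pushHom f id (MonoidAlgebra.of A G g) = MonoidAlgebra.of R G g := by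
  simp

lemma coeff_pushHom_id (f : A →+* R) (x : A[G]) (g : G) :
    (pushHom f id x).coeff g = f (x.coeff g) := by
  classical
  induction x using MonoidAlgebra.induction_linear with
  | zero => simp
  | add x x' hx hx' =>
    rw [map_add, MonoidAlgebra.coeff_add, MonoidAlgebra.coeff_add, Finsupp.add_apply,
      Finsupp.add_apply, hx, hx', map_add]
  | single h a =>
    rw [pushHom_single, MonoidAlgebra.coeff_single, MonoidAlgebra.coeff_single,
      Finsupp.single_apply, Finsupp.single_apply, apply_ite f, map_zero, id]

/-- An integral multiple of a Gelfand idempotent. -/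
structure GelfandElement (s : G →* G) (st : G → G) (i : A →+* ℂ) (e : A[G]) (N : ℕ) : Prop where
  injective : Function.Injective i
  ne_zero : N ≠ 0
  map_map : ∀ g, s (s g) = g
  st_mul : ∀ g h, st (g * h) = st h * st g
  map_st : ∀ g, s (st g) = st (s g)
  st_st : ∀ g, st (st g) = g
  mul_self : e * e = (N : A) • e
  conj : pushHom ((starRingEnd ℂ).comp i) (fun g => g⁻¹) e = pushHom i id e
  theta : thetaMap A s e = e
  star : pushHom (RingHom.id A) st e = e
  sandwich : ∀ g, e * MonoidAlgebra.of A G g * e = e * MonoidAlgebra.of A G (st g) * e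

namespace GelfandElement

variable {s : G →* G} {st : G → G} {i : A →+* ℂ} {e : A[G]} {N : ℕ}
  (D : GelfandElement s st i e N)
include D

lemma sandwich' (z : A[G]) : e * z * e = e * pushHom (RingHom.id A) st z * e := by
  induction z using MonoidAlgebra.induction_on with
  | of g =>
    rw [D.sandwich, MonoidAlgebra.of_apply, MonoidAlgebra.of_apply, pushHom_single, map_one]
  | add x y hx hy => rw [map_add, mul_add, mul_add, add_mul, add_mul, hx, hy]
  | smul r x hx =>
    rw [pushHom_smul, RingHom.id_apply, mul_smul_comm, mul_smul_comm, smul_mul_assoc,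
      smul_mul_assoc, hx]

lemma pushHom_sandwich (z : A[G]) : pushHom (RingHom.id A) st (e * z * e) = e * z * e := by
  rw [pushHom_mul _ D.st_mul, pushHom_mul _ D.st_mul, D.star, ← mul_assoc, ← D.sandwich']

omit D in
lemma sandwich_mul_sandwich (z w : A[G]) : e * z * e * (e * w * e) = e * (z * e * e * w) * e := by
  simp only [mul_assoc]

lemma comm (z w : A[G]) : e * z * e * (e * w * e) = e * w * e * (e * z * e) := by
  rw [sandwich_mul_sandwich, ← D.pushHom_sandwich, ← sandwich_mul_sandwich,
    pushHom_mul _ D.st_mul, D.pushHom_sandwich, D.pushHom_sandwich]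

lemma theta_sandwich (g : G) : thetaMap A s (e * MonoidAlgebra.of A G g * e) =
    e * MonoidAlgebra.of A G (s g)⁻¹ * e := by
  rw [GelfandIdempotent.thetaMap_mul, GelfandIdempotent.thetaMap_mul, D.theta,
    GelfandIdempotent.thetaMap_of, mul_assoc]

lemma gelfandIdempotent :
    GelfandIdempotent s st ((N : ℂ)⁻¹ • pushHom i id e) where
  map_map := D.map_map
  st_mul := D.st_mul
  map_st := D.map_st
  st_st := D.st_st
  idem := by
    have hN : (N : ℂ) ≠ 0 := Nat.cast_ne_zero.2 D.ne_zero
    rw [smul_mul_assoc, mul_smul_comm, ← pushHom_id_mul, D.mul_self, pushHom_smul, map_natCast,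
      inv_smul_smul₀ hN]
  conj := by
    rw [conjMap, pushHom_smul, pushHom_pushHom, Function.comp_id, D.conj, map_inv₀, map_natCast]
  theta := by
    rw [thetaMap, pushHom_smul, RingHom.id_apply, pushHom_pushHom]
    congr 1
    nth_rw 2 [← D.theta]
    rw [thetaMap, pushHom_pushHom]
    rfl
  star := by
    rw [pushHom_smul, RingHom.id_apply, pushHom_pushHom]
    congr 1
    nth_rw 2 [← D.star]
    rw [pushHom_pushHom]
    rfl
  sandwich := by
    intro z
    simp only [smul_mul_assoc, mul_smul_comm]
    congr 2
    induction z using MonoidAlgebra.induction_on with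
    | of g =>
      have h := congrArg (pushHom i id) (D.sandwich g)
      simp only [pushHom_id_mul, pushHom_id_of] at h
      rw [h, MonoidAlgebra.of_apply, MonoidAlgebra.of_apply, pushHom_single, map_one]
    | add x y hx hy => rw [map_add, mul_add, mul_add, add_mul, add_mul, hx, hy]
    | smul r x hx =>
      rw [pushHom_smul, RingHom.id_apply, mul_smul_comm, mul_smul_comm, smul_mul_assoc,
        smul_mul_assoc, hx]

lemma mem_sandwich (z : A[G]) : ((N : ℂ)⁻¹ • pushHom i id e) * pushHom i id (e * z * e) *
    ((N : ℂ)⁻¹ • pushHom i id e) = pushHom i id (e * z * e) := by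
  have hN : (N : ℂ) ≠ 0 := Nat.cast_ne_zero.2 D.ne_zero
  have h : e * (e * z * e) * e = (N : A) • (N : A) • (e * z * e) := by
    calc e * (e * z * e) * e = (e * e) * z * (e * e) := by simp only [mul_assoc]
      _ = _ := by rw [D.mul_self, smul_mul_assoc, smul_mul_assoc, mul_smul_comm]
  rw [smul_mul_assoc, smul_mul_assoc, mul_smul_comm, ← pushHom_id_mul, ← pushHom_id_mul, h,
    pushHom_smul, pushHom_smul, map_natCast, inv_smul_smul₀ hN, inv_smul_smul₀ hN]

variable [Fintype G] {X : Type*} [Fintype X] [DecidableEq X] [MulAction G X]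
  (hX : ∀ g : G, Nat.card {y : G // y * s y = g} = Nat.card {x : X // g • x = x})
include hX

lemma permMat_sub_theta (j : A →+* R) (g : G) :
    permMat R G X (pushHom j id (e * MonoidAlgebra.of A G g * e)) =
      permMat R G X (pushHom j id (e * MonoidAlgebra.of A G (s g)⁻¹ * e)) := by
  have h := D.gelfandIdempotent.permMat_sub_theta hX (D.mem_sandwich (MonoidAlgebra.of A G g))
  have h1 : thetaMap ℂ s (pushHom i id (e * MonoidAlgebra.of A G g * e)) =
      pushHom i id (e * MonoidAlgebra.of A G (s g)⁻¹ * e) := by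
    rw [← D.theta_sandwich, thetaMap, pushHom_pushHom, thetaMap, pushHom_pushHom]
    rfl
  rw [h1, ← map_sub, permMat_pushHom] at h
  have h2 : permMat A G X (e * MonoidAlgebra.of A G g * e) =
      permMat A G X (e * MonoidAlgebra.of A G (s g)⁻¹ * e) := by
    rw [← sub_eq_zero, ← map_sub]
    ext x y
    exact D.injective ((congrFun (congrFun h x) y).trans (map_zero i).symm)
  rw [permMat_pushHom, h2, ← permMat_pushHom]

lemma sum_coeff_twisted_eq_zero {z : A[G]} (h0 : permMat A G X (e * z * e) = 0) (g : G) :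
    ∑ x : G, (e * z * e).coeff ((s (st x))⁻¹ * g * x⁻¹) = 0 := by
  have h := D.gelfandIdempotent.sum_coeff_twisted_eq_zero hX (D.mem_sandwich z)
    (by rw [permMat_pushHom, h0]; ext; simp) g
  simp only [coeff_pushHom_id] at h
  rw [← map_sum] at h
  exact D.injective (h.trans (map_zero i).symm)

end GelfandElement

end IntegralGelfand

section GelfandGL

variable {k₀ k : Type} [Field k₀] [Field k] [Fintype k] [Algebra k₀ k] {n : ℕ}

omit [Fintype k] in
lemma glAut_apply (σ : k ≃ₐ[k₀] k) (g : GL (Fin n) k) (i j : Fin n) :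
    (glAut k₀ k σ n g).val i j = σ (g.val i j) := rfl

omit [Fintype k] in
lemma glAut_antiTranspose (σ : k ≃ₐ[k₀] k) (g : GL (Fin n) k) :
    glAut k₀ k σ n (antiTranspose g) = antiTranspose (glAut k₀ k σ n g) := by
  ext i j
  rw [glAut_apply, antiTranspose_apply, antiTranspose_apply, glAut_apply]

omit [Fintype k] in
lemma glAut_mem {σ : k ≃ₐ[k₀] k} {u : GL (Fin n) k} (hu : u ∈ upperUnip k n) :
    glAut k₀ k σ n u ∈ upperUnip k n := by
  intro i j hij
  rw [glAut_apply, hu i j hij, one_apply, apply_ite σ, map_one, map_zero]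

omit [Fintype k] in
lemma superdiag_glAut (σ : k ≃ₐ[k₀] k) (g : GL (Fin n) k) :
    superdiag (glAut k₀ k σ n g).val = σ (superdiag g.val) := by
  simp only [superdiag, map_sum, apply_ite σ, map_zero, glAut_apply]

omit [Fintype k] in
lemma genericChar_inv {A : Type*} [CommRing A] (ψ : AddChar k A) (u : upperUnip k n) :
    genericChar ψ u⁻¹ = ψ (-superdiag (u : GL (Fin n) k).val) := by
  have h1 : ψ (-superdiag (u : GL (Fin n) k).val) * genericChar ψ u = 1 := by
    rw [genericChar_apply, ← AddChar.map_add_eq_mul, neg_add_cancel, AddChar.map_zero_eq_one]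
  have h2 : genericChar ψ u * genericChar ψ u⁻¹ = 1 := by
    rw [← map_mul, mul_inv_cancel, map_one]
  rw [← one_mul (genericChar ψ u⁻¹), ← h1, mul_assoc, h2, mul_one]

theorem gelfandElement_charSum {A : Type*} [CommRing A] [IsDomain A] {i : A →+* ℂ}
    [Fintype (upperUnip k n)] {ψ : AddChar k A} (hquad : Module.finrank k₀ k = 2)
    {σ : k ≃ₐ[k₀] k} (hσ : σ ≠ AlgEquiv.refl) (hi : Function.Injective i)
    (hψ₀ : ∀ x, ψ (algebraMap k₀ k x) = 1) (hψ : ψ ≠ 1)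
    (hconj : ∀ x, starRingEnd ℂ (i (ψ x)) = i (ψ (-x))) :
    GelfandElement (glAut k₀ k σ n) antiTranspose i (charSum (upperUnip k n) (genericChar ψ))
      (Fintype.card (upperUnip k n)) where
  injective := hi
  ne_zero := Fintype.card_ne_zero
  map_map := glAut_glAut hquad σ
  st_mul := antiTranspose_mul
  map_st := glAut_antiTranspose σ
  st_st := antiTranspose_antiTranspose
  mul_self := charSum_mul_charSum _
  conj := by
    rw [pushHom_charSum (genericChar ψ) ((starRingEnd ℂ).comp i) (fun g => g⁻¹)
        (genericChar ((i : A →* ℂ).compAddChar ψ)) inv_inv (fun u => inv_mem) fun u => ?_,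
      pushHom_charSum (genericChar ψ) i id (genericChar ((i : A →* ℂ).compAddChar ψ))
        (fun _ => rfl) (fun _ => id) fun u => ?_]
    · rfl
    · have : (⟨(u : GL (Fin n) k)⁻¹, inv_mem u.2⟩⁻¹ : upperUnip k n) = u := by
        apply Subtype.ext; simp
      rw [this, genericChar_inv, genericChar_apply]
      exact (hconj _).trans (by rw [neg_neg]; rfl)
  theta := by
    refine pushHom_charSum _ _ _ _ (fun g => ?_) (fun u hu => inv_mem (glAut_mem hu)) fun u => ?_
    · rw [map_inv, inv_inv, glAut_glAut hquad]
    · have : (⟨(glAut k₀ k σ n u)⁻¹, inv_mem (glAut_mem u.2)⟩⁻¹ : upperUnip k n) =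
          ⟨glAut k₀ k σ n u, glAut_mem u.2⟩ := by
        apply Subtype.ext; simp
      rw [this, genericChar_inv, genericChar_apply, superdiag_glAut, addChar_aut hquad hσ hψ₀]
      rfl
  star := pushHom_antiTranspose_charSum
  sandwich := charSum_mul_of_mul_charSum hψ

end GelfandGL

section HilbertNinety

variable {k₀ k : Type} [Field k₀] [Field k] [Fintype k] [Algebra k₀ k] {n : ℕ}

/-- Hilbert's Theorem 90 for general linear groups, for a quadratic extension. -/
theorem exists_mul_glAut_inv (hquad : Module.finrank k₀ k = 2) {σ : k ≃ₐ[k₀] k}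
    (hσ : σ ≠ AlgEquiv.refl) {y : GL (Fin n) k} (hy : y * glAut k₀ k σ n y = 1) :
    ∃ a : GL (Fin n) k, y = a * (glAut k₀ k σ n a)⁻¹ := by
  let S : (Fin n → k) → Fin n → k := fun v => y.val *ᵥ (σ ∘ v)
  have hSadd : ∀ v w, S (v + w) = S v + S w := fun v w => by
    change y.val *ᵥ _ = y.val *ᵥ _ + y.val *ᵥ _
    rw [← mulVec_add]
    congr 1
    ext l
    simp
  have hSsmul : ∀ c v, S (c • v) = σ c • S v := fun c v => by
    change y.val *ᵥ _ = _ • y.val *ᵥ _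
    rw [← mulVec_smul]
    congr 1
    ext l
    simp
  have hSS : ∀ v, S (S v) = v := fun v => by
    have h1 : σ ∘ (y.val *ᵥ (σ ∘ v)) = (glAut k₀ k σ n y).val *ᵥ v := by
      ext l
      simp only [Function.comp_apply, mulVec, dotProduct, map_sum, map_mul, glAut_apply,
        aut_sq_of_finrank_two hquad]
    change y.val *ᵥ (σ ∘ (y.val *ᵥ (σ ∘ v))) = v
    rw [h1, mulVec_mulVec, ← GeneralLinearGroup.coe_mul, hy, Units.val_one, one_mulVec]
  obtain ⟨c, hc⟩ : ∃ c, σ c ≠ c := by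
    by_contra! h
    exact hσ (AlgEquiv.ext h)
  let T : Set (Fin n → k) := {v | S v = v}
  have hT : ∀ v, v + S v ∈ T := fun v => by
    change S (v + S v) = v + S v
    rw [hSadd, hSS, add_comm]
  have hS : ∀ v, S v ∈ Submodule.span k T := fun v => by
    have h1 := Submodule.smul_mem _ c (Submodule.subset_span (hT v) : _ ∈ Submodule.span k T)
    have h2 := (Submodule.subset_span (hT (c • v)) : _ ∈ Submodule.span k T)
    have h3 := Submodule.sub_mem _ h1 h2
    have h4 : c • (v + S v) - (c • v + S (c • v)) = (c - σ c) • S v := by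
      rw [hSsmul, smul_add, sub_smul]; abel
    rw [h4] at h3
    exact (Submodule.smul_mem_iff _ (sub_ne_zero.2 hc.symm)).1 h3
  have hspan : Submodule.span k T = ⊤ := eq_top_iff.2 fun v _ => by
    rw [← hSS v]
    exact hS _
  let b := Module.Basis.ofSpan hspan.ge
  have hb : ∀ l, b l ∈ T := fun l => Module.Basis.ofSpan_subset hspan.ge ⟨l, rfl⟩
  let e := b.indexEquiv (Pi.basisFun k (Fin n))
  let b' := b.reindex e
  have hb' : ∀ l, b' l ∈ T := fun l => by
    rw [Module.Basis.reindex_apply]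
    exact hb _
  let M : Matrix (Fin n) (Fin n) k := (Pi.basisFun k (Fin n)).toMatrix b'
  have hM : ∀ i l, M i l = b' l i := fun i l => by simp [M, Module.Basis.toMatrix_apply]
  have hinv : Invertible M := (Pi.basisFun k (Fin n)).invertibleToMatrix b'
  let a : GL (Fin n) k := unitOfInvertible M
  have ha : ∀ i l, a.val i l = b' l i := hM
  refine ⟨a, ?_⟩
  rw [eq_mul_inv_iff_mul_eq]
  ext i l
  have h1 := congrFun (show S (b' l) = b' l from hb' l) i
  rw [ha, ← h1, GeneralLinearGroup.coe_mul, Matrix.mul_apply]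
  simp only [S, mulVec, dotProduct, Function.comp_apply, glAut_apply, ha]

lemma mem_glBase_iff (hquad : Module.finrank k₀ k = 2) {σ : k ≃ₐ[k₀] k}
    (hσ : σ ≠ AlgEquiv.refl) {g : GL (Fin n) k} :
    g ∈ glBase k₀ k n ↔ glAut k₀ k σ n g = g := by
  constructor
  · rintro ⟨h, rfl⟩
    ext i j
    rw [glAut_apply]
    exact σ.commutes _
  · intro hg
    have h : ∀ x : GL (Fin n) k, glAut k₀ k σ n x = x → ∃ M : Matrix (Fin n) (Fin n) k₀,
        M.map (algebraMap k₀ k) = x.val := by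
      intro x hx
      have h1 : ∀ i j, ∃ y, algebraMap k₀ k y = x.val i j := fun i j =>
        mem_range_of_fixed hquad σ hσ (by rw [← glAut_apply, hx])
      choose M hM using h1
      exact ⟨Matrix.of M, by ext i j; exact hM i j⟩
    obtain ⟨M, hM⟩ := h g hg
    obtain ⟨M', hM'⟩ := h g⁻¹ (by rw [map_inv, hg])
    have hinj : Function.Injective fun M : Matrix (Fin n) (Fin n) k₀ => M.map (algebraMap k₀ k) :=
      Matrix.map_injective (algebraMap k₀ k).injective
    refine ⟨⟨M, M', hinj ?_, hinj ?_⟩, Units.ext hM⟩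
    · change (M * M').map _ = (1 : Matrix _ _ k₀).map _
      rw [Matrix.map_mul, hM, hM', ← GeneralLinearGroup.coe_mul, mul_inv_cancel]
      simp
    · change (M' * M).map _ = (1 : Matrix _ _ k₀).map _
      rw [Matrix.map_mul, hM, hM', ← GeneralLinearGroup.coe_mul, inv_mul_cancel]
      simp

lemma card_norm_fibre_eq_card_fixed (hquad : Module.finrank k₀ k = 2) {σ : k ≃ₐ[k₀] k}
    (hσ : σ ≠ AlgEquiv.refl) (g : GL (Fin n) k) :
    Nat.card {y : GL (Fin n) k // y * glAut k₀ k σ n y = g} =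
      Nat.card {x : GL (Fin n) k ⧸ glBase k₀ k n // g • x = x} := by
  rw [card_norm_fibre hquad σ hσ]
  symm
  set s := glAut k₀ k σ n with hs
  have hss : ∀ x, s (s x) = x := glAut_glAut hquad σ
  let F : GL (Fin n) k ⧸ glBase k₀ k n → GL (Fin n) k := Quotient.lift (fun a => a * (s a)⁻¹) (by
    intro a b hab
    have h1 := (mem_glBase_iff hquad hσ).1 (QuotientGroup.leftRel_apply.1 hab)
    rw [map_mul, map_inv, ← hs] at h1
    change a * (s a)⁻¹ = b * (s b)⁻¹
    have h2 : s b = s a * (a⁻¹ * b) := by rw [← h1]; group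
    rw [h2]
    group)
  have hF : ∀ a : GL (Fin n) k, F a = a * (s a)⁻¹ := fun _ => rfl
  have hfix : ∀ (a b : GL (Fin n) k), a * (s a)⁻¹ = b * (s b)⁻¹ →
      (a : GL (Fin n) k ⧸ glBase k₀ k n) = b := by
    intro a b hab
    rw [QuotientGroup.eq, mem_glBase_iff hquad hσ, map_mul, map_inv, ← hs]
    have h2 : s b = (b⁻¹ * a * (s a)⁻¹)⁻¹ := by
      rw [mul_assoc, hab]; group
    rw [h2]
    group
  have hact : ∀ a : GL (Fin n) k, F (g • (a : GL (Fin n) k ⧸ glBase k₀ k n)) =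
      g * (a * (s a)⁻¹) * (s g)⁻¹ := fun a => by
    change g * a * (s (g * a))⁻¹ = _
    rw [map_mul]; group
  refine Nat.card_congr (Equiv.ofBijective (fun x => ⟨F x.1, ?_⟩) ⟨?_, ?_⟩)
  · obtain ⟨x, hx⟩ := x
    obtain ⟨a, rfl⟩ := QuotientGroup.mk_surjective x
    constructor
    · rw [hF, map_mul, map_inv, hss]; group
    · have h1 := hact a
      rw [hx, hF] at h1
      change g * F a = F a * s g
      rw [hF]
      nth_rw 2 [h1]
      group
  · rintro ⟨x, hx⟩ ⟨x', hx'⟩ h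
    obtain ⟨a, rfl⟩ := QuotientGroup.mk_surjective x
    obtain ⟨b, rfl⟩ := QuotientGroup.mk_surjective x'
    exact Subtype.ext (hfix a b (congrArg Subtype.val h))
  · rintro ⟨y, hy, hgy⟩
    obtain ⟨a, rfl⟩ := exists_mul_glAut_inv hquad hσ hy
    refine ⟨⟨a, ?_⟩, Subtype.ext (hF a)⟩
    refine hfix (g * a) a ?_
    rw [map_mul, _root_.mul_inv_rev, ← mul_assoc, mul_assoc g, mul_inv_eq_iff_eq_mul]
    exact hgy

end HilbertNinety

section HeckeEigenvector

variable {R : Type} [Field R] {G : Type} [Group G] {V : Type} [AddCommGroup V] [Module R V]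

lemma IsIrreducibleRep.exists_ne_zero {ρ : Representation R G V} (hirr : IsIrreducibleRep ρ) :
    ∃ v : V, v ≠ 0 := by
  by_contra! h
  exact hirr.1 (Submodule.ext fun v => by simp [h v])

lemma IsIrreducibleRep.finiteDimensional [Finite G] {ρ : Representation R G V}
    (hirr : IsIrreducibleRep ρ) : FiniteDimensional R V := by
  obtain ⟨v, hv⟩ := hirr.exists_ne_zero
  have : Module.Finite R (MonoidAlgebra R G) :=
    Module.Finite.equiv (MonoidAlgebra.coeffLinearEquiv (R := R) (S := R) (M := G)).symm
  exact Module.Finite.of_surjective (ρ.asAlgebraHom.toLinearMap.flip v)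
    (LinearMap.range_eq_top.1 (hirr.cyclicSpan_eq_top hv))

/-- A quasi-idempotent whose Hecke algebra is commutative acts on an irreducible representation
with rank at most one. -/
theorem IsIrreducibleRep.exists_eq_smul_of_hecke_comm [IsAlgClosed R] [FiniteDimensional R V]
    {ρ : Representation R G V} (hirr : IsIrreducibleRep ρ) {z : MonoidAlgebra R G} {N : R}
    (hN : N ≠ 0) (hzz : z * z = N • z)
    (hcomm : ∀ a b, z * a * z * (z * b * z) = z * b * z * (z * a * z)) {v₀ : V} (hv₀ : v₀ ≠ 0)
    (hz : ρ.asAlgebraHom z v₀ = N • v₀) :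
    ∃ μ : V →ₗ[R] R, μ v₀ = N ∧ ∀ v, ρ.asAlgebraHom z v = μ v • v₀ := by
  set A := ρ.asAlgebraHom with hA
  have hfix : ∀ v, A z (A z v) = N • A z v := fun v => by
    rw [← Module.End.mul_apply, ← map_mul, hzz, map_smul, LinearMap.smul_apply]
  let W : Submodule R V := LinearMap.range (A z)
  have hv₀W : v₀ ∈ W := ⟨N⁻¹ • v₀, by rw [map_smul, hz, inv_smul_smul₀ hN]⟩
  have hWN : ∀ w ∈ W, A z w = N • w := by
    rintro _ ⟨v, rfl⟩
    exact hfix v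
  have : Nontrivial W := ⟨⟨⟨v₀, hv₀W⟩, 0, fun h => hv₀ (congrArg Subtype.val h)⟩⟩
  have hscal : ∀ a, ∃ c : R, ∀ v, A (z * a * z) (A z v) = c • A z v := by
    intro a
    have hmaps : ∀ w ∈ W, A (z * a * z) w ∈ W := fun w _ => ⟨A (a * z) w, by
      rw [← Module.End.mul_apply, ← map_mul, mul_assoc]⟩
    obtain ⟨c, hc⟩ := Module.End.exists_eigenvalue ((A (z * a * z)).restrict hmaps)
    obtain ⟨⟨w, hwW⟩, hw⟩ := hc.exists_hasEigenvector
    have hw1 : A (z * a * z) w = c • w := congrArg Subtype.val hw.apply_eq_smul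
    have hw0 : w ≠ 0 := fun h => hw.2 (Subtype.ext h)
    refine ⟨c, fun v => ?_⟩
    obtain ⟨f, rfl⟩ : v ∈ ρ.cyclicSpan w := by rw [hirr.cyclicSpan_eq_top hw0]; trivial
    change A (z * a * z) (A z (A f w)) = c • A z (A f w)
    have h1 : A (z * f * z) w = N • A z (A f w) := by
      rw [map_mul, map_mul, Module.End.mul_apply, Module.End.mul_apply, hWN w hwW, map_smul,
        map_smul]
    have h2 := congrArg (fun x => A x w) (hcomm a f)
    simp only [map_mul _ (z * a * z), map_mul _ (z * f * z), Module.End.mul_apply] at h2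
    rw [h1, hw1, map_smul, map_smul, h1, smul_comm c] at h2
    exact smul_right_injective V hN h2
  have hline : ∀ v, ∃ c : R, A z v = c • v₀ := by
    intro v
    obtain ⟨f, rfl⟩ : v ∈ ρ.cyclicSpan v₀ := by rw [hirr.cyclicSpan_eq_top hv₀]; trivial
    obtain ⟨c, hc⟩ := hscal f
    have h1 := hc v₀
    rw [hz, map_smul, map_mul, map_mul, Module.End.mul_apply, Module.End.mul_apply, hz, map_smul,
      map_smul, smul_comm c] at h1
    have h2 := smul_right_injective V hN h1
    refine ⟨N⁻¹ * c, ?_⟩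
    change A z (A f v₀) = _
    rw [mul_smul, ← h2, inv_smul_smul₀ hN]
  obtain ⟨f, hf⟩ := Module.Projective.exists_dual_eq_one R hv₀
  refine ⟨f.comp (A z), ?_, fun v => ?_⟩
  · rw [LinearMap.comp_apply, hz, map_smul, hf, smul_eq_mul, mul_one]
  · obtain ⟨c, hc⟩ := hline v
    rw [LinearMap.comp_apply, hc, map_smul, hf, smul_eq_mul, mul_one]

end HeckeEigenvector

section Support

open scoped TensorProduct

lemma exists_semilinear_ne_zero_of_tensorProduct {S M R K : Type} [CommRing S] [AddCommGroup M]
    [Module S M] [Field R] [Field K] [Algebra S K] (l : K →+* R) [Nontrivial (K ⊗[S] M)] :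
    ∃ Λ : M →+ R, (∀ s m, Λ (s • m) = l (algebraMap S K s) * Λ m) ∧ Λ ≠ 0 := by
  obtain ⟨x, hx⟩ := exists_ne (0 : K ⊗[S] M)
  obtain ⟨f, hf⟩ := Module.Projective.exists_dual_ne_zero K hx
  let ι : M →ₗ[S] K ⊗[S] M := TensorProduct.mk S K M 1
  refine ⟨(l : K →+ R).comp (f.toAddMonoidHom.comp ι.toAddMonoidHom), fun s m => ?_,
    fun h0 => hf ?_⟩
  · change l (f (ι (s • m))) = l (algebraMap S K s) * l (f (ι m))
    rw [map_smul ι, algebra_compatible_smul K s, map_smul, smul_eq_mul, map_mul]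
  · have h : ∀ y, f y = 0 := fun y => by
      induction y with
      | zero => exact map_zero f
      | add x y hx hy => rw [map_add, hx, hy, add_zero]
      | tmul a m =>
        have h1 : f (ι m) = 0 := l.injective ((DFunLike.congr_fun h0 m).trans (map_zero l).symm)
        have h2 : a ⊗ₜ[S] m = a • ι m := by
          simp [ι, TensorProduct.smul_tmul']
        rw [h2, map_smul, h1, smul_zero]
    exact h x

/-- A character of a commutative ring killing the annihilator of a finite module occurs as an
eigencharacter of the ring on the dual of the module. -/
theorem exists_semilinear_ne_zero {S M R : Type} [CommRing S] [AddCommGroup M] [Module S M]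
    [Module.Finite S M] [Field R] (φ : S →+* R) (h : Module.annihilator S M ≤ RingHom.ker φ) :
    ∃ Λ : M →+ R, (∀ s m, Λ (s • m) = φ s * Λ m) ∧ Λ ≠ 0 := by
  have hprime : (RingHom.ker φ).IsPrime := RingHom.ker_isPrime φ
  have hP : (⟨_, hprime⟩ : PrimeSpectrum S) ∈ Module.support S M := by
    rw [Module.mem_support_iff_of_finite]
    exact h
  have hnt := (Module.mem_support_iff_nontrivial_residueField_tensorProduct _).1 hP
  have hl (s : S) : Ideal.ResidueField.lift (RingHom.ker φ) φ le_rfl (fun s hs => IsUnit.mk0 _ hs)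
      (algebraMap S _ s) = φ s := Ideal.ResidueField.lift_algebraMap _ _ _ _ s
  obtain ⟨Λ, h1, h2⟩ := exists_semilinear_ne_zero_of_tensorProduct (S := S) (M := M)
    (Ideal.ResidueField.lift (RingHom.ker φ) φ le_rfl fun s hs => IsUnit.mk0 _ hs)
  exact ⟨Λ, fun s m => by rw [h1, hl], h2⟩

end Support

section RankOne

open scoped MonoidAlgebra

variable {R : Type} [Field R] {G : Type} [Group G] {V : Type} [AddCommGroup V] [Module R V]

/-- The representation generated by a vector. -/
noncomputable def Representation.cyclicRep (η : Representation R G V) (m : V) :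
    Representation R G (η.cyclicSpan m) :=
  η.subrepresentation (η.cyclicSpan m) fun g _ hx => η.apply_mem_cyclicSpan m g hx

lemma Representation.coe_asAlgebraHom_subrepresentation (η : Representation R G V)
    (W : Submodule R V) (hW : ∀ g, W ≤ W.comap (η g)) (f : R[G]) (w : W) :
    ((η.subrepresentation W hW).asAlgebraHom f w : V) = η.asAlgebraHom f w := by
  induction f using MonoidAlgebra.induction_on with
  | of g => rw [Representation.asAlgebraHom_of, Representation.asAlgebraHom_of]; rfl
  | add f f' hf hf' =>
    rw [map_add, map_add, LinearMap.add_apply, LinearMap.add_apply, ← hf, ← hf']; rfl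
  | smul r f hf =>
    rw [map_smul, map_smul, LinearMap.smul_apply, LinearMap.smul_apply, ← hf]; rfl

lemma Representation.cyclicSpan_cyclicRep (η : Representation R G V) (m : V) :
    (η.cyclicRep m).cyclicSpan ⟨m, η.self_mem_cyclicSpan m⟩ = ⊤ := by
  refine eq_top_iff.2 ?_
  rintro ⟨_, f, rfl⟩ -
  exact ⟨f, Subtype.ext (η.coe_asAlgebraHom_subrepresentation _ _ _ _)⟩

theorem IsIrreducibleRep.exists_cyclicRep_cosocle_map {E : Type} [AddCommGroup E] [Module R E]
    {ρ : Representation R G V} (hirr : IsIrreducibleRep ρ) (η : Representation R G E) {m₀ : E}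
    {v₀ : V} (hm₀ : m₀ ≠ 0) (hv₀ : v₀ ≠ 0) (z : R[G]) {N : R} (hN : N ≠ 0)
    (hz : ρ.asAlgebraHom z v₀ = N • v₀) (χ : G → R)
    (hη : ∀ g, η.asAlgebraHom z (η g m₀) = χ g • m₀)
    (hρ : ∀ g, ρ.asAlgebraHom z (ρ g v₀) = χ g • v₀) :
    ∃ π : η.cyclicSpan m₀ →ₗ[R] V, (∀ g w, π (η.cyclicRep m₀ g w) = ρ g (π w)) ∧
      Function.Surjective π ∧
      (∀ W : Submodule R (η.cyclicSpan m₀), (∀ g, ∀ w ∈ W, η.cyclicRep m₀ g w ∈ W) → W ≠ ⊤ →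
        W ≤ LinearMap.ker π) ∧
      ∀ w, π w = 0 → (η.cyclicRep m₀).asAlgebraHom z w = 0 := by
  obtain ⟨π, h1, h2, -, h3, h4⟩ := hirr.exists_cosocle_map (η.cyclicRep m₀)
    (η.cyclicSpan_cyclicRep m₀) (fun h0 => hm₀ (congrArg Subtype.val h0)) hv₀ z hN hz χ
    (fun g => Subtype.ext ((η.coe_asAlgebraHom_subrepresentation _ _ _ _).trans (hη g))) hρ
  exact ⟨π, h1, h2, h3, h4⟩

omit [Group G] in
lemma exists_equiv_of_surjective {D : Type} [AddCommGroup D] [Module R D] [FiniteDimensional R D]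
    (hD : Module.finrank R D = Module.finrank R V) {E : Submodule R D} (π : E →ₗ[R] V)
    (hsurj : Function.Surjective π) : ∃ e : V ≃ₗ[R] D, ∀ w, e (π w) = w := by
  have h1 : Module.finrank R V ≤ Module.finrank R E :=
    LinearMap.finrank_le_finrank_of_surjective hsurj
  have h2 : Module.finrank R E ≤ Module.finrank R D := Submodule.finrank_le E
  have : FiniteDimensional R V := Module.Finite.of_surjective π hsurj
  have hinj : Function.Injective π :=
    (LinearMap.injective_iff_surjective_of_finrank_eq_finrank (by omega)).2 hsurj
  have htop : E = ⊤ := Submodule.eq_top_of_finrank_eq (by omega)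
  let e₁ := LinearEquiv.ofBijective π ⟨hinj, hsurj⟩
  refine ⟨e₁.symm ≪≫ₗ LinearEquiv.ofTop E htop, fun w => ?_⟩
  exact congrArg Subtype.val (e₁.symm_apply_apply w)

/-- An element of the group algebra acts through a rank one operator. -/
structure Representation.ActsRankOne (ρ : Representation R G V) (z : R[G]) (N : R) (v₀ : V)
    (μ : V →ₗ[R] R) : Prop where
  ne_zero : N ≠ 0
  apply_vector : μ v₀ = N
  apply_eq : ∀ v, ρ.asAlgebraHom z v = μ v • v₀

namespace Representation.ActsRankOne

variable {ρ : Representation R G V} {z : R[G]} {N : R} {v₀ : V} {μ : V →ₗ[R] R}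
  (h : ρ.ActsRankOne z N v₀ μ)
include h

lemma vector_ne_zero : v₀ ≠ 0 := fun h0 => h.ne_zero (by rw [← h.apply_vector, h0, map_zero])

lemma apply_self : ρ.asAlgebraHom z v₀ = N • v₀ := by rw [h.apply_eq, h.apply_vector]

lemma sandwich_apply (f : R[G]) (v : V) :
    ρ.asAlgebraHom (z * f * z) v = (μ v * μ (ρ.asAlgebraHom f v₀)) • v₀ := by
  rw [map_mul, map_mul, Module.End.mul_apply, Module.End.mul_apply, h.apply_eq v, map_smul,
    map_smul, h.apply_eq, smul_smul]

end Representation.ActsRankOne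

variable {s : G →* G}

/-- The twist of the dual of a representation by an endomorphism of the group. -/
noncomputable def Representation.twistedDual (ρ : Representation R G V) (s : G →* G) :
    Representation R G (Module.Dual R V) := ρ.dual.comp s

lemma Representation.twistedDual_apply (ρ : Representation R G V) (g : G) (ξ : Module.Dual R V)
    (v : V) : ρ.twistedDual s g ξ v = ξ (ρ (s g)⁻¹ v) := rfl

lemma Representation.asAlgebraHom_twistedDual (ρ : Representation R G V) (f : R[G])
    (ξ : Module.Dual R V) (v : V) :
    (ρ.twistedDual s).asAlgebraHom f ξ v = ξ (ρ.asAlgebraHom (thetaMap R s f) v) := by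
  induction f using MonoidAlgebra.induction_on with
  | of g =>
    rw [Representation.asAlgebraHom_of, GelfandIdempotent.thetaMap_of,
      Representation.asAlgebraHom_of, Representation.twistedDual_apply]
  | add f f' hf hf' =>
    rw [map_add, map_add, map_add, LinearMap.add_apply, LinearMap.add_apply, hf, hf',
      LinearMap.add_apply, map_add]
  | smul r f hf =>
    rw [map_smul, pushHom_smul, RingHom.id_apply, map_smul ρ.asAlgebraHom, LinearMap.smul_apply,
      LinearMap.smul_apply, hf,
      LinearMap.smul_apply, map_smul]

variable (hss : ∀ g, s (s g) = g) {ρ : Representation R G V} {z : R[G]} {N : R} {v₀ : V}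
  {μ : V →ₗ[R] R}
include hss

/-- An irreducible representation is twisted-selfdual as soon as its spherical function is
invariant. -/
theorem IsIrreducibleRep.repIso_dual [FiniteDimensional R V] (hirr : IsIrreducibleRep ρ)
    (h : ρ.ActsRankOne z N v₀ μ) (hz : thetaMap R s z = z)
    (hχ : ∀ g, μ (ρ (s g)⁻¹ v₀) = μ (ρ g v₀)) : RepIso (ρ.comp s) ρ.dual := by
  set η : Representation R G (Module.Dual R V) := ρ.twistedDual s with hη
  have hμ0 : μ ≠ 0 := fun h0 => h.ne_zero (by rw [← h.apply_vector, h0]; rfl)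
  have hzμ : ∀ g, η.asAlgebraHom z (η g μ) = μ (ρ g v₀) • μ := by
    intro g
    refine LinearMap.ext fun v => ?_
    rw [Representation.asAlgebraHom_twistedDual, hz]
    change μ (ρ (s g)⁻¹ (ρ.asAlgebraHom z v)) = _
    rw [h.apply_eq, map_smul, map_smul, hχ, LinearMap.smul_apply, smul_eq_mul, smul_eq_mul,
      mul_comm]
  obtain ⟨π, hπ, hsurj, -⟩ := hirr.exists_cyclicRep_cosocle_map η hμ0 h.vector_ne_zero z h.ne_zero
    h.apply_self (fun g => μ (ρ g v₀)) hzμ (fun g => h.apply_eq _)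
  obtain ⟨e, he⟩ := exists_equiv_of_surjective Subspace.dual_finrank_eq π hsurj
  refine ⟨e, fun g v => ?_⟩
  obtain ⟨w, rfl⟩ := hsurj v
  rw [MonoidHom.comp_apply, ← hπ, he, he]
  change ρ.dual (s (s g)) w = _
  rw [hss]

/-- The spherical function of a twisted-selfdual irreducible representation is invariant. -/
theorem Representation.ActsRankOne.apply_theta_eq
    (h : ρ.ActsRankOne z N v₀ μ) (hz : thetaMap R s z = z) (hiso : RepIso (ρ.comp s) ρ.dual)
    (g : G) : μ (ρ (s g)⁻¹ v₀) = μ (ρ g v₀) := by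
  obtain ⟨e, he⟩ := hiso
  have he1 : ∀ (g : G) v, e (ρ g v) = ρ.twistedDual s g (e v) := fun g v => by
    have := he (s g) v
    rwa [MonoidHom.comp_apply, hss] at this
  have he2 : ∀ (f : R[G]) v w, e (ρ.asAlgebraHom f v) w =
      e v (ρ.asAlgebraHom (thetaMap R s f) w) := by
    intro f v w
    rw [← Representation.asAlgebraHom_twistedDual]
    congr 1
    induction f using MonoidAlgebra.induction_on with
    | of g => rw [Representation.asAlgebraHom_of, he1, Representation.asAlgebraHom_of]
    | add f f' hf hf' => rw [map_add, LinearMap.add_apply, map_add, hf, hf', map_add, LinearMap.add_apply]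
    | smul r f hf => rw [map_smul, LinearMap.smul_apply, map_smul, hf, map_smul, LinearMap.smul_apply]
  have h1 : ∀ w, N * e v₀ w = μ w * e v₀ v₀ := fun w => by
    have := he2 z v₀ w
    rwa [hz, h.apply_self, h.apply_eq, map_smul, map_smul, smul_eq_mul, LinearMap.smul_apply,
      smul_eq_mul] at this
  have h0 : e v₀ v₀ ≠ 0 := fun h0 => by
    have h2 : e v₀ = 0 := LinearMap.ext fun w => by
      have := h1 w
      rw [h0, mul_zero] at this
      exact (mul_eq_zero.1 this).resolve_left h.ne_zero
    exact h.vector_ne_zero (e.injective (h2.trans (map_zero e).symm))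
  have h2 := he2 (z * MonoidAlgebra.of R G g) v₀ v₀
  rw [GelfandIdempotent.thetaMap_mul, hz, map_mul, map_mul, Module.End.mul_apply,
    Module.End.mul_apply, h.apply_self, h.apply_eq, Representation.asAlgebraHom_of,
    GelfandIdempotent.thetaMap_of, Representation.asAlgebraHom_of, map_smul, map_smul, map_smul,
    smul_eq_mul, h1, LinearMap.smul_apply, smul_eq_mul] at h2
  exact (mul_right_cancel₀ h0 h2).symm

end RankOne

section Spherical

open scoped MonoidAlgebra

variable {R : Type} [Field R] {G : Type} [Group G]

lemma vecMul_permMat_of {X : Type*} [Fintype X] [DecidableEq X] [MulAction G X] (F : X → R) (g : G)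
    (x : X) : (F ᵥ* permMat R G X (MonoidAlgebra.of R G g)) x = F (g • x) := by
  simp [vecMul, dotProduct, MonoidAlgebra.of_apply, permMat_single]

lemma pushHom_theta (s : G →* G) {A : Type*} [CommRing A] (j : A →+* R) (x : A[G]) :
    thetaMap R s (pushHom j id x) = pushHom j id (thetaMap A s x) := by
  rw [thetaMap, thetaMap, pushHom_pushHom, pushHom_pushHom]
  rfl

namespace GelfandElement

variable {A : Type*} [CommRing A] {s : G →* G} {st : G → G} {i : A →+* ℂ} {e : A[G]} {N : ℕ}
  (D : GelfandElement s st i e N) (j : A →+* R)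
include D

lemma theta_push : thetaMap R s (pushHom j id e) = pushHom j id e := by
  rw [pushHom_theta, D.theta]

lemma mul_self_push : pushHom j id e * pushHom j id e = (N : R) • pushHom j id e := by
  rw [← pushHom_id_mul, D.mul_self, pushHom_smul, map_natCast]

omit D in
lemma push_sandwich (g : G) : pushHom j id (e * MonoidAlgebra.of A G g * e) =
    pushHom j id e * MonoidAlgebra.of R G g * pushHom j id e := by
  rw [pushHom_id_mul, pushHom_id_mul, pushHom_id_of]

lemma sandwich_push (g : G) : pushHom j id e * MonoidAlgebra.of R G g * pushHom j id e =
    pushHom j id e * MonoidAlgebra.of R G (st g) * pushHom j id e := by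
  rw [← push_sandwich, D.sandwich, push_sandwich]

lemma comm_push (a b : R[G]) :
    pushHom j id e * a * pushHom j id e * (pushHom j id e * b * pushHom j id e) =
      pushHom j id e * b * pushHom j id e * (pushHom j id e * a * pushHom j id e) := by
  induction a using MonoidAlgebra.induction_on with
  | of g =>
    induction b using MonoidAlgebra.induction_on with
    | of h =>
      rw [← push_sandwich, ← push_sandwich, ← pushHom_id_mul, D.comm, pushHom_id_mul]
    | add b b' h h' => simp only [mul_add, add_mul, h, h']
    | smul r b h => simp only [mul_smul_comm, smul_mul_assoc, h]
  | add a a' h h' => simp only [mul_add, add_mul, h, h']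
  | smul r a h => simp only [mul_smul_comm, smul_mul_assoc, h]

variable {V : Type} [AddCommGroup V] [Module R V] {ρ : Representation R G V} {v₀ : V}
  {μ : V →ₗ[R] R} (h : ρ.ActsRankOne (pushHom j id e) N v₀ μ)
include h

lemma apply_st (g : G) : μ (ρ (st g) v₀) = μ (ρ g v₀) := by
  have h1 := congrArg (fun x => ρ.asAlgebraHom x v₀) (D.sandwich_push j g)
  simp only [h.sandwich_apply, Representation.asAlgebraHom_of, h.apply_vector] at h1
  exact (mul_left_cancel₀ h.ne_zero (smul_left_injective R h.vector_ne_zero h1)).symm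

/-- The spherical function of a distinguished representation is invariant. -/
theorem apply_theta_eq_of_invariantForm [Fintype G] {H : Subgroup G} [Fintype (G ⧸ H)]
    [DecidableEq (G ⧸ H)] (hH : ∀ x ∈ H, s x = x)
    (hX : ∀ g : G, Nat.card {y : G // y * s y = g} = Nat.card {x : G ⧸ H // g • x = x})
    {l : V →ₗ[R] R} (hl : l ∈ invariantForms ρ (H : Set G)) (hl0 : l v₀ ≠ 0) (g : G) :
    μ (ρ (s g)⁻¹ v₀) = μ (ρ g v₀) := by
  let c : G ⧸ H → R := Quotient.lift (fun g => l (ρ (s g)⁻¹ v₀)) (by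
    intro a b hab
    have hab : a⁻¹ * b ∈ H := QuotientGroup.leftRel_apply.1 hab
    have h1 : (s b)⁻¹ = (a⁻¹ * b)⁻¹ * (s a)⁻¹ := by
      rw [← _root_.mul_inv_rev, ← hH _ hab, ← map_mul, mul_inv_cancel_left]
    change l (ρ (s a)⁻¹ v₀) = l (ρ (s b)⁻¹ v₀)
    rw [h1, map_mul, Module.End.mul_apply, hl _ (H.inv_mem hab)])
  have hc : ∀ w : R[G], (c ᵥ* permMat R G (G ⧸ H) w) (1 : G) =
      l (ρ.asAlgebraHom (thetaMap R s w) v₀) := by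
    intro w
    induction w using MonoidAlgebra.induction_on with
    | of g =>
      rw [vecMul_permMat_of, GelfandIdempotent.thetaMap_of, Representation.asAlgebraHom_of]
      change l (ρ (s (g * 1))⁻¹ v₀) = _
      rw [mul_one]
    | add w w' h h' =>
      rw [map_add, map_add, map_add, vecMul_add, Pi.add_apply, h, h', LinearMap.add_apply, map_add]
    | smul r w h =>
      rw [map_smul, vecMul_smul, Pi.smul_apply, h, pushHom_smul, RingHom.id_apply,
        map_smul ρ.asAlgebraHom, LinearMap.smul_apply, map_smul]
  have h1 := hc (pushHom j id (e * MonoidAlgebra.of A G g * e))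
  rw [D.permMat_sub_theta hX, hc, pushHom_theta, pushHom_theta, D.theta_sandwich, D.theta_sandwich,
    map_inv s, inv_inv, D.map_map, push_sandwich, push_sandwich, h.sandwich_apply, h.sandwich_apply,
    map_smul, map_smul, smul_eq_mul, smul_eq_mul, Representation.asAlgebraHom_of,
    Representation.asAlgebraHom_of, h.apply_vector] at h1
  exact (mul_left_cancel₀ h.ne_zero (mul_right_cancel₀ hl0 h1)).symm

end GelfandElement

end Spherical

section TwistedTrace

lemma sum_map_mul_eq_zero_of_invariant {G Y A R : Type*} [Fintype G] [Nonempty G] [Fintype Y]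
    [CommRing A] [IsDomain A] [CharZero A] [CommRing R] (j : A →+* R) (act : G → Y ≃ Y) (y : Y → A)
    (t : Y → R) (ht : ∀ x g, t (act x g) = t g) (hy : ∀ g, ∑ x, y (act x g) = 0) :
    ∑ g, j (y g) * t g = 0 := by
  classical
  have hq : ∀ q : R, ∑ g with t g = q, y g = 0 := by
    intro q
    have h1 : ∀ x, ∑ g with t g = q, y (act x g) = ∑ g with t g = q, y g := fun x =>
      Finset.sum_equiv (act x) (fun g => by simp [ht]) (fun _ _ => rfl)
    have h2 : ∑ x : G, ∑ g with t g = q, y (act x g) = 0 := by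
      rw [Finset.sum_comm]
      exact Finset.sum_eq_zero fun g _ => hy g
    simp only [h1, Finset.sum_const, Finset.card_univ, nsmul_eq_mul] at h2
    exact (mul_eq_zero.1 h2).resolve_left (Nat.cast_ne_zero.2 Fintype.card_ne_zero)
  rw [← Finset.sum_fiberwise_of_maps_to (t := Finset.univ.image t) (g := t)
    (fun g _ => Finset.mem_image_of_mem t (Finset.mem_univ g))]
  refine Finset.sum_eq_zero fun q _ => ?_
  rw [Finset.sum_congr rfl (g := fun g => j (y g) * q)
    (fun g hg => by rw [(Finset.mem_filter.1 hg).2]), ← Finset.sum_mul, ← map_sum, hq, map_zero,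
    zero_mul]

open scoped MonoidAlgebra

variable {R : Type} [Field R] {G : Type} [Group G] {V : Type} [AddCommGroup V] [Module R V]

lemma Representation.asAlgebraHom_comp (ρ : Representation R G V) (τ : G →* G) (f : R[G]) :
    Representation.asAlgebraHom (ρ.comp τ) f =
      ρ.asAlgebraHom (pushHom (RingHom.id R) τ f) := by
  induction f using MonoidAlgebra.induction_on with
  | of g =>
    rw [Representation.asAlgebraHom_of, MonoidAlgebra.of_apply, pushHom_single, map_one,
      ← MonoidAlgebra.of_apply, Representation.asAlgebraHom_of, MonoidHom.comp_apply]
  | add f f' hf hf' => rw [map_add, map_add, map_add, hf, hf']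
  | smul r f hf =>
    rw [map_smul, pushHom_smul, RingHom.id_apply, map_smul ρ.asAlgebraHom, hf]

lemma Representation.asAlgebraHom_eq_sum [Fintype G] (ρ : Representation R G V) (f : R[G]) :
    ρ.asAlgebraHom f = ∑ g, f.coeff g • ρ g := by
  classical
  induction f using MonoidAlgebra.induction_on with
  | of g =>
    rw [Representation.asAlgebraHom_of, MonoidAlgebra.of_apply, MonoidAlgebra.coeff_single]
    simp [Finsupp.single_apply]
  | add f f' hf hf' =>
    rw [map_add, hf, hf', ← Finset.sum_add_distrib]
    exact Finset.sum_congr rfl fun g _ => by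
      rw [MonoidAlgebra.coeff_add, Finsupp.add_apply, add_smul]
  | smul r f hf =>
    rw [map_smul, hf, Finset.smul_sum]
    exact Finset.sum_congr rfl fun g _ => by
      rw [MonoidAlgebra.coeff_smul, Finsupp.smul_apply, smul_smul, smul_eq_mul]

namespace GelfandElement

variable {A : Type} [CommRing A] {s : G →* G} {st : G → G} {i : A →+* ℂ} {e : A[G]} {N : ℕ}
  (D : GelfandElement s st i e N) (j : A →+* R)
include D

/-- The automorphism of the group underlying the two anti-involutions. -/
def tau : G →* G where
  toFun g := (s (st g))⁻¹
  map_one' := by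
    have h : st 1 = 1 := by simpa using D.st_mul 1 1
    rw [h, map_one, inv_one]
  map_mul' g h := by rw [D.st_mul, map_mul, _root_.mul_inv_rev]

lemma tau_apply (g : G) : D.tau g = (s (st g))⁻¹ := rfl

lemma st_inv (g : G) : st g⁻¹ = (st g)⁻¹ := by
  have h : st 1 = 1 := by simpa using D.st_mul 1 1
  rw [eq_inv_iff_mul_eq_one, ← D.st_mul, mul_inv_cancel, h]

lemma tau_tau (g : G) : D.tau (D.tau g) = g := by
  rw [tau_apply, tau_apply, D.st_inv, map_inv s, inv_inv, ← D.map_st, D.map_map, D.st_st]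

lemma tau_push : pushHom (RingHom.id R) D.tau (pushHom j id e) = pushHom j id e := by
  rw [pushHom_pushHom]
  have h : pushHom j id (thetaMap A s (pushHom (RingHom.id A) st e)) = pushHom j id e := by
    rw [D.star, D.theta]
  rw [thetaMap, pushHom_pushHom, pushHom_pushHom] at h
  exact h

variable {ρ : Representation R G V} {v₀ : V}
  {μ : V →ₗ[R] R} (h : ρ.ActsRankOne (pushHom j id e) N v₀ μ) (hirr : IsIrreducibleRep ρ)
  (hχ : ∀ g, μ (ρ (s g)⁻¹ v₀) = μ (ρ g v₀))
include h hirr hχ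

lemma exists_intertwiner : ∃ T : V →ₗ[R] V, (∀ g v, T (ρ (D.tau g) v) = ρ g (T v)) ∧
    T v₀ = v₀ := by
  have hgen : Representation.cyclicSpan (ρ.comp D.tau) v₀ = ⊤ := by
    refine (hirr.2 _ fun g x hx => ?_).resolve_left fun hb => h.vector_ne_zero ?_
    · have := Representation.apply_mem_cyclicSpan (ρ.comp D.tau) v₀ (D.tau g) hx
      rwa [MonoidHom.comp_apply, D.tau_tau] at this
    · rw [← Submodule.mem_bot R, ← hb]
      exact Representation.self_mem_cyclicSpan _ _
  obtain ⟨T, h1, -, h2, -⟩ := hirr.exists_cosocle_map (ρ.comp D.tau) hgen h.vector_ne_zero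
    h.vector_ne_zero (pushHom j id e) h.ne_zero h.apply_self (fun g => μ (ρ g v₀))
    (fun g => by
      rw [Representation.asAlgebraHom_comp, D.tau_push, h.apply_eq, MonoidHom.comp_apply,
        D.tau_apply, hχ, D.apply_st j h])
    (fun g => h.apply_eq _)
  exact ⟨T, h1, h2⟩

theorem apply_eq_zero_of_permMat_eq_zero [Fintype G] [FiniteDimensional R V]
    {X : Type*} [Fintype X] [DecidableEq X] [MulAction G X]
    (hX : ∀ g : G, Nat.card {y : G // y * s y = g} = Nat.card {x : X // g • x = x})
    {w : A[G]} (h0 : permMat A G X (e * w * e) = 0) :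
    μ (ρ.asAlgebraHom (pushHom j id w) v₀) = 0 := by
  obtain ⟨T, hT, hT0⟩ := D.exists_intertwiner j h hirr hχ
  have : IsDomain A := D.injective.isDomain i
  have : CharZero A := RingHom.charZero i
  let act : G → G ≃ G := fun x => (Equiv.mulLeft (D.tau x)).trans (Equiv.mulRight x⁻¹)
  have h1 := sum_map_mul_eq_zero_of_invariant j act (e * w * e).coeff
    (fun g => LinearMap.trace R V (T * ρ g)) (fun x g => by
      change LinearMap.trace R V (T * ρ (D.tau x * g * x⁻¹)) = _
      have h2 : T * ρ (D.tau x) = ρ x * T := LinearMap.ext fun v => hT x v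
      rw [map_mul ρ, map_mul ρ, ← mul_assoc, ← mul_assoc, h2, LinearMap.trace_mul_comm, mul_assoc,
        ← mul_assoc, ← map_mul ρ, inv_mul_cancel, map_one, one_mul])
    (fun g => D.sum_coeff_twisted_eq_zero hX h0 g)
  have h3 : T * ρ.asAlgebraHom (pushHom j id (e * w * e)) =
      μ.smulRight (μ (ρ.asAlgebraHom (pushHom j id w) v₀) • v₀) := by
    refine LinearMap.ext fun v => ?_
    rw [pushHom_id_mul, pushHom_id_mul, Module.End.mul_apply, h.sandwich_apply, map_smul, hT0,
      LinearMap.smulRight_apply, smul_smul]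
  have h4 : LinearMap.trace R V (T * ρ.asAlgebraHom (pushHom j id (e * w * e))) = 0 := by
    rw [Representation.asAlgebraHom_eq_sum, Finset.mul_sum, map_sum, ← h1]
    refine Finset.sum_congr rfl fun g _ => ?_
    rw [mul_smul_comm, map_smul, smul_eq_mul, coeff_pushHom_id]
  rw [h3, LinearMap.trace_smulRight, map_smul, smul_eq_mul, h.apply_vector] at h4
  exact (mul_eq_zero.1 h4).resolve_right h.ne_zero

end GelfandElement

end TwistedTrace

section Eigencharacter

lemma exists_eigencharacter {S R V : Type*} [Ring S] [Field R] [AddCommGroup V] [Module R V]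
    (B : S →+* Module.End R V) {v₀ : V} (hv₀ : v₀ ≠ 0) (h : ∀ s, ∃ c : R, B s v₀ = c • v₀) :
    ∃ φ : S →+* R, ∀ s, B s v₀ = φ s • v₀ := by
  choose c hc using h
  have inj := smul_left_injective R hv₀
  refine ⟨{ toFun := c, map_one' := inj ?_, map_mul' := fun s t => inj ?_, map_zero' := inj ?_,
            map_add' := fun s t => inj ?_ }, hc⟩
  · simp [← hc]
  · change c (s * t) • v₀ = (c s * c t) • v₀
    rw [← hc, map_mul, Module.End.mul_apply, hc t, map_smul, hc s, smul_smul, mul_comm]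
  · simp [← hc]
  · simp [← hc, add_smul]

lemma exists_vecMul_eq_smul {A S R X : Type} [CommRing A] [CommRing S] [Algebra A S] [Field R]
    [Fintype X] [DecidableEq X] (P : S →ₐ[A] Matrix X X A) (φ : S →+* R)
    (hφ : ∀ s, P s = 0 → φ s = 0) :
    ∃ F : X → R, F ≠ 0 ∧ ∀ s, F ᵥ* (P s).map (φ.comp (algebraMap A S)) = φ s • F := by
  let f : S →+* Module.End A (X → A) := (Matrix.toLinAlgEquiv'.toAlgHom.comp P).toRingHom
  let _ : Module S (X → A) := Module.compHom _ f
  have hsmul : ∀ (s : S) (m : X → A), s • m = P s *ᵥ m := fun s m => rfl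
  have : IsScalarTower A S (X → A) := ⟨fun a s m => by
    rw [hsmul, hsmul, map_smul, smul_mulVec]⟩
  have : Module.Finite S (X → A) := Module.Finite.of_restrictScalars_finite A S (X → A)
  obtain ⟨Λ, h1, h2⟩ := exists_semilinear_ne_zero (M := X → A) φ (fun s hs => by
    refine hφ s ?_
    rw [Module.mem_annihilator] at hs
    refine Matrix.toLinAlgEquiv'.injective ?_
    rw [map_zero]
    exact LinearMap.ext fun m => hs m)
  have hA : ∀ (a : A) m, Λ (a • m) = φ (algebraMap A S a) * Λ m := fun a m => by
    rw [← h1, algebraMap_smul]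
  have hsum : ∀ m : X → A, Λ m = ∑ x, φ (algebraMap A S (m x)) * Λ (Pi.single x 1) := by
    intro m
    conv_lhs => rw [pi_eq_sum_univ' m]
    rw [map_sum]
    refine Finset.sum_congr rfl fun x _ => ?_
    rw [← hA]
  refine ⟨fun x => Λ (Pi.single x 1), fun h0 => h2 ?_, fun s => funext fun x => ?_⟩
  · refine AddMonoidHom.ext fun m => ?_
    rw [hsum, AddMonoidHom.zero_apply]
    exact Finset.sum_eq_zero fun x _ => by rw [congrFun h0 x, Pi.zero_apply, mul_zero]
  · rw [Pi.smul_apply, smul_eq_mul, ← h1, hsmul, hsum]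
    simp only [vecMul, dotProduct, Matrix.map_apply, RingHom.comp_apply, mulVec_single_one,
      Matrix.col_apply]
    exact Finset.sum_congr rfl fun y _ => mul_comm _ _

lemma exists_commRing_of_adjoin {A B : Type} [CommRing A] [Ring B] [Algebra A B] {t : Set B}
    (ht : ∀ a ∈ t, ∀ b ∈ t, a * b = b * a) :
    ∃ (S : Type) (_ : CommRing S) (_ : Algebra A S) (ι : S →ₐ[A] B),
      ∀ x, x ∈ Algebra.adjoin A t ↔ ∃ y, ι y = x := by
  let _ : CommRing (Algebra.adjoin A t) := { (Algebra.adjoin A t).toRing with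
    mul_comm := fun x y =>
      have := Algebra.isMulCommutative_adjoin A ht
      mul_comm' x y }
  refine ⟨Algebra.adjoin A t, inferInstance, (Algebra.adjoin A t).algebra, (Algebra.adjoin A t).val,
    fun x => ⟨fun hx => ⟨⟨x, hx⟩, rfl⟩, ?_⟩⟩
  rintro ⟨y, rfl⟩
  exact y.2

open scoped MonoidAlgebra

variable {R : Type} [Field R] {G : Type} [Group G] {V : Type} [AddCommGroup V] [Module R V]

namespace GelfandElement

variable {A : Type} [CommRing A] {s : G →* G} {st : G → G} {i : A →+* ℂ} {e : A[G]} {N : ℕ}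
  (D : GelfandElement s st i e N) (j : A →+* R) {ρ : Representation R G V} {v₀ : V}
  {μ : V →ₗ[R] R} (h : ρ.ActsRankOne (pushHom j id e) N v₀ μ) (hirr : IsIrreducibleRep ρ)
  (hχ : ∀ g, μ (ρ (s g)⁻¹ v₀) = μ (ρ g v₀))
include D h hirr hχ

/-- The permutation module carries the eigencharacter of the Hecke algebra attached to a
representation with invariant spherical function. -/
theorem exists_vecMul_permMat_eq_smul [Fintype G] [FiniteDimensional R V]
    {X : Type} [Fintype X] [DecidableEq X] [MulAction G X]
    (hX : ∀ g : G, Nat.card {y : G // y * s y = g} = Nat.card {x : X // g • x = x}) :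
    ∃ F : X → R, F ≠ 0 ∧ ∀ g, F ᵥ* permMat R G X
      (pushHom j id e * MonoidAlgebra.of R G g * pushHom j id e) = ((N : R) * μ (ρ g v₀)) • F := by
  obtain ⟨S, _, _, ι, hι⟩ := exists_commRing_of_adjoin (A := A)
    (t := Set.range fun g => e * MonoidAlgebra.of A G g * e) (by
      rintro _ ⟨g, rfl⟩ _ ⟨g', rfl⟩
      exact D.comm _ _)
  let pj : A[G] →+* R[G] :=
    { pushHom j id with
      map_one' := by
        change pushHom j id 1 = 1
        rw [← map_one (MonoidAlgebra.of A G), pushHom_id_of, map_one]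
      map_mul' := pushHom_id_mul j }
  have hpj : ∀ x, pj x = pushHom j id x := fun _ => rfl
  let B : S →+* Module.End R V := (ρ.asAlgebraHom.toRingHom.comp pj).comp ι.toRingHom
  have hB : ∀ x : S, B x = ρ.asAlgebraHom (pushHom j id (ι x)) := fun _ => rfl
  have hBg : ∀ g, ρ.asAlgebraHom (pushHom j id (e * MonoidAlgebra.of A G g * e)) v₀ =
      ((N : R) * μ (ρ g v₀)) • v₀ := fun g => by
    rw [push_sandwich, h.sandwich_apply, h.apply_vector, Representation.asAlgebraHom_of]
  have hBa : ∀ a : A, ρ.asAlgebraHom (pushHom j id (algebraMap A A[G] a)) v₀ = j a • v₀ :=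
    fun a => by
    rw [Algebra.algebraMap_eq_smul_one, pushHom_smul, ← hpj, map_one, map_smul, map_one,
      LinearMap.smul_apply, Module.End.one_apply]
  obtain ⟨φ, hφ⟩ := exists_eigencharacter B h.vector_ne_zero (by
    intro y
    rw [hB]
    have hx := (hι (ι y)).2 ⟨y, rfl⟩
    generalize ι y = x at hx
    induction hx using Algebra.adjoin_induction with
    | mem x hx =>
      obtain ⟨g, rfl⟩ := hx
      exact ⟨_, hBg g⟩
    | algebraMap a => exact ⟨_, hBa a⟩
    | add x y _ _ hx hy =>
      obtain ⟨c, hc⟩ := hx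
      obtain ⟨d, hd⟩ := hy
      exact ⟨c + d, by rw [map_add, map_add, LinearMap.add_apply, hc, hd, add_smul]⟩
    | mul x y _ _ hx hy =>
      obtain ⟨c, hc⟩ := hx
      obtain ⟨d, hd⟩ := hy
      exact ⟨d * c, by
        rw [pushHom_id_mul, map_mul, Module.End.mul_apply, hd, map_smul, hc, smul_smul]⟩)
  have inj := smul_left_injective R h.vector_ne_zero
  have hφa : φ.comp (algebraMap A S) = j := RingHom.ext fun a => inj (by
    change φ (algebraMap A S a) • v₀ = j a • v₀
    rw [← hφ, hB, AlgHom.commutes, hBa])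
  obtain ⟨F, hF0, hF⟩ := exists_vecMul_eq_smul ((permMat A G X).comp ι) φ (fun x hx => by
    have h0 : permMat A G X (e * ι x * e) = 0 := by
      have hx : permMat A G X (ι x) = 0 := hx
      rw [map_mul, map_mul, hx, mul_zero, zero_mul]
    have h1 := D.apply_eq_zero_of_permMat_eq_zero j h hirr hχ hX h0
    rw [← hB, hφ, map_smul, h.apply_vector, smul_eq_mul] at h1
    exact (mul_eq_zero.1 h1).resolve_right h.ne_zero)
  refine ⟨F, hF0, fun g => ?_⟩
  obtain ⟨y, hy⟩ := (hι _).1 (Algebra.subset_adjoin ⟨g, rfl⟩)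
  have hφg : φ y = (N : R) * μ (ρ g v₀) := inj (by
    change φ y • v₀ = ((N : R) * μ (ρ g v₀)) • v₀
    rw [← hφ, hB, hy]
    exact hBg g)
  have h1 := hF y
  rw [hφa, hφg, AlgHom.comp_apply, hy] at h1
  rw [← push_sandwich, permMat_pushHom]
  exact h1

end GelfandElement

end Eigencharacter

section PermutationRepresentation

open scoped MonoidAlgebra

variable {R : Type} [Field R] {G : Type} [Group G] {V : Type} [AddCommGroup V] [Module R V]

/-- The permutation representation on functions, twisted by an endomorphism of the group. -/
def permRep (R : Type) [Field R] (X : Type) [MulAction G X] (s : G →* G) :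
    Representation R G (X → R) where
  toFun g := LinearMap.funLeft R R fun x => (s g)⁻¹ • x
  map_one' := by ext; simp
  map_mul' g h := LinearMap.ext fun F => funext fun x => by
    change F ((s (g * h))⁻¹ • x) = F ((s h)⁻¹ • (s g)⁻¹ • x)
    rw [map_mul, _root_.mul_inv_rev, mul_smul]

variable {X : Type} [MulAction G X] {s : G →* G}

lemma permRep_apply (g : G) (F : X → R) (x : X) : permRep R X s g F x = F ((s g)⁻¹ • x) := rfl

lemma asAlgebraHom_permRep_theta [Fintype X] [DecidableEq X] (hss : ∀ g, s (s g) = g) (w : R[G])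
    (F : X → R) :
    (permRep R X s).asAlgebraHom (thetaMap R s w) F = F ᵥ* permMat R G X w := by
  induction w using MonoidAlgebra.induction_on with
  | of g =>
    ext x
    rw [vecMul_permMat_of, GelfandIdempotent.thetaMap_of, Representation.asAlgebraHom_of,
      permRep_apply, map_inv s, hss, inv_inv]
  | add w w' h h' =>
    rw [map_add, map_add, map_add, vecMul_add, LinearMap.add_apply, h, h']
  | smul r w h =>
    rw [map_smul (permMat R G X), vecMul_smul, pushHom_smul, RingHom.id_apply,
      map_smul (permRep R X s).asAlgebraHom, LinearMap.smul_apply, h]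

lemma invariantForms_ne_bot_of_injective {ρ : Representation R G V} {H : Subgroup G}
    (hss : ∀ g, s (s g) = g) (hH : ∀ x ∈ H, s x = x) {F : G ⧸ H → R} (hF : F ≠ 0)
    (π : (permRep R (G ⧸ H) s).cyclicSpan F →ₗ[R] V)
    (hπ : ∀ g w, π ((permRep R (G ⧸ H) s).cyclicRep F g w) = ρ g (π w))
    (hsurj : Function.Surjective π) (hinj : Function.Injective π) :
    invariantForms ρ (H : Set G) ≠ ⊥ := by
  let η := permRep R (G ⧸ H) s
  let E := LinearEquiv.ofBijective π ⟨hinj, hsurj⟩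
  let l : V →ₗ[R] R := (LinearMap.proj ((1 : G) : G ⧸ H)).comp
    ((η.cyclicSpan F).subtype.comp E.symm.toLinearMap)
  have hl : ∀ w, l (π w) = (w : G ⧸ H → R) (1 : G) := fun w => by
    change (E.symm (E w) : G ⧸ H → R) (1 : G) = _
    rw [E.symm_apply_apply]
  have hmem : l ∈ invariantForms ρ (H : Set G) := by
    intro g hg v
    obtain ⟨w, rfl⟩ := hsurj v
    rw [← hπ, hl, hl]
    change (w : G ⧸ H → R) ((s g)⁻¹ • ((1 : G) : G ⧸ H)) = _
    rw [hH g hg]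
    have h1 : (((g⁻¹ * 1 : G)) : G ⧸ H) = (1 : G) := QuotientGroup.eq.2 (by simpa using hg)
    exact congrArg (w : G ⧸ H → R) h1
  intro hbot
  rw [hbot, Submodule.mem_bot] at hmem
  refine hF (funext fun x => ?_)
  induction x using QuotientGroup.induction_on with
  | H g =>
    have h1 := hl ⟨_, η.apply_mem_cyclicSpan F (s g)⁻¹ (η.self_mem_cyclicSpan F)⟩
    rw [hmem, LinearMap.zero_apply] at h1
    change 0 = F ((s (s g)⁻¹)⁻¹ • ((1 : G) : G ⧸ H)) at h1
    rw [map_inv s, hss, inv_inv] at h1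
    change F ((g : G) : G ⧸ H) = 0
    rw [h1]
    congr 1
    exact (congrArg _ (mul_one g)).symm

namespace GelfandElement

variable {A : Type} [CommRing A] {st : G → G} {i : A →+* ℂ} {e : A[G]} {N : ℕ}
  (D : GelfandElement s st i e N) (j : A →+* R) {ρ : Representation R G V} {v₀ : V}
  {μ : V →ₗ[R] R} (h : ρ.ActsRankOne (pushHom j id e) N v₀ μ) (hirr : IsIrreducibleRep ρ)
  (hχ : ∀ g, μ (ρ (s g)⁻¹ v₀) = μ (ρ g v₀))
include D h hirr hχ

/-- An irreducible representation with invariant spherical function is the cosocle of a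
subrepresentation of the permutation representation. -/
theorem exists_permRep_cosocle_map [Fintype G] [FiniteDimensional R V] [Fintype X] [DecidableEq X]
    (hX : ∀ g : G, Nat.card {y : G // y * s y = g} = Nat.card {x : X // g • x = x}) :
    ∃ F : X → R, F ≠ 0 ∧ ∃ π : (permRep R X s).cyclicSpan F →ₗ[R] V,
      (∀ g w, π ((permRep R X s).cyclicRep F g w) = ρ g (π w)) ∧ Function.Surjective π ∧
      (∀ W : Submodule R ((permRep R X s).cyclicSpan F),
        (∀ g, ∀ w ∈ W, (permRep R X s).cyclicRep F g w ∈ W) → W ≠ ⊤ → W ≤ LinearMap.ker π) ∧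
      ∀ w, π w = 0 → ((permRep R X s).cyclicRep F).asAlgebraHom (pushHom j id e) w = 0 := by
  obtain ⟨F, hF0, hF⟩ := D.exists_vecMul_permMat_eq_smul j h hirr hχ hX
  set z := pushHom j id e with hz
  set η := permRep R X s
  have hzgz : ∀ g, η.asAlgebraHom (z * MonoidAlgebra.of R G g * z) F =
      ((N : R) * μ (ρ g v₀)) • F := by
    intro g
    have h1 : z * MonoidAlgebra.of R G g * z =
        thetaMap R s (z * MonoidAlgebra.of R G (s g)⁻¹ * z) := by
      rw [GelfandIdempotent.thetaMap_mul, GelfandIdempotent.thetaMap_mul, hz, D.theta_push,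
        GelfandIdempotent.thetaMap_of, map_inv s, D.map_map, inv_inv, mul_assoc]
    rw [h1, asAlgebraHom_permRep_theta D.map_map, hF, hχ]
  have hzF : η.asAlgebraHom z F = (N : R) • F := by
    have h1 := hzgz 1
    rw [map_one, mul_one, hz, D.mul_self_push, map_smul, LinearMap.smul_apply, map_one,
      Module.End.one_apply, h.apply_vector, mul_smul] at h1
    exact smul_right_injective _ h.ne_zero h1
  refine ⟨F, hF0, hirr.exists_cyclicRep_cosocle_map η hF0 h.vector_ne_zero z h.ne_zero h.apply_self
    (fun g => μ (ρ g v₀)) (fun g => ?_) (fun g => h.apply_eq _)⟩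
  have h1 := hzgz g
  rw [map_mul, map_mul, Module.End.mul_apply, Module.End.mul_apply, hzF, map_smul, map_smul,
    mul_smul, Representation.asAlgebraHom_of] at h1
  exact smul_right_injective _ h.ne_zero h1

end GelfandElement

end PermutationRepresentation

section Whittaker

open scoped MonoidAlgebra

section CharSum

variable {R : Type} [Field R] {G : Type} [Group G] {V : Type} [AddCommGroup V] [Module R V]
  (ρ : Representation R G V) {N : Subgroup G} [Fintype N] {χ : N →* R} {v : V}

lemma asAlgebraHom_charSum_of_forall (hv : ∀ u : N, ρ u v = χ u • v) :
    ρ.asAlgebraHom (charSum N χ) v = (Fintype.card N : R) • v := by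
  rw [charSum_eq, map_sum, LinearMap.sum_apply, Finset.sum_congr rfl (g := fun _ => v)
    (fun u _ => ?_), Finset.sum_const, Finset.card_univ, Nat.cast_smul_eq_nsmul]
  rw [map_smul, LinearMap.smul_apply, Representation.asAlgebraHom_of, hv, smul_smul, ← map_mul,
    inv_mul_cancel, map_one, one_smul]

end CharSum

variable {k : Type} [Field k] [Fintype k] {n : ℕ} {R : Type} [Field R] {V : Type} [AddCommGroup V]
  [Module R V] {ρ : Representation R (GL (Fin n) k) V} {ψ : AddChar k R}

lemma IsCuspidal.eq_zero_of_whittaker (hcusp : IsCuspidal k ρ) (hψ : ψ ≠ 1)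
    (hk : (Fintype.card k : R) ≠ 0)
    (h : ∀ v, (∀ u : upperUnip k n, ρ u v = genericChar ψ u • v) → v = 0) (v : V) : v = 0 := by
  have htop := eq_top_of_whittaker_mem hψ hk k hcusp ⊥
    (fun c a v _ ⟨i, _, hi⟩ => absurd ⟨a i, rfl⟩ hi)
    (fun g _ v hv => by
      rw [Submodule.mem_bot] at hv ⊢
      rw [← Module.End.one_apply (R := R) v, ← map_one ρ, ← inv_mul_cancel g, map_mul,
        Module.End.mul_apply, hv, map_zero])
    (fun v hv => (Submodule.mem_bot R).2 (h v hv))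
  rw [← Submodule.mem_bot R, htop]
  trivial

lemma IsCuspidal.injective_of_asAlgebraHom_eq_zero [Fintype (upperUnip k n)] {E : Type}
    [AddCommGroup E] [Module R E] {η : Representation R (GL (Fin n) k) E} (hcusp : IsCuspidal k η)
    (hψ : ψ ≠ 1) (hk : (Fintype.card k : R) ≠ 0) (hN : (Fintype.card (upperUnip k n) : R) ≠ 0)
    (π : E →ₗ[R] V) (hπ : ∀ g w, π (η g w) = ρ g (π w))
    (hz : ∀ w, π w = 0 → η.asAlgebraHom (charSum (upperUnip k n) (genericChar ψ)) w = 0) :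
    Function.Injective π := by
  rw [← LinearMap.ker_eq_bot]
  let κ : Representation R (GL (Fin n) k) (LinearMap.ker π) :=
    η.subrepresentation (LinearMap.ker π) fun g w hw => by
      rw [Submodule.mem_comap, LinearMap.mem_ker, hπ, LinearMap.mem_ker.1 hw, map_zero]
  have hκ : IsCuspidal k κ := fun a b ha hb hab v hv =>
    Subtype.ext (hcusp a b ha hb hab v fun g hg => congrArg Subtype.val (hv g hg))
  refine (Submodule.eq_bot_iff _).2 fun w hw => ?_
  refine congrArg Subtype.val (hκ.eq_zero_of_whittaker hψ hk (fun v hv => ?_) ⟨w, hw⟩)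
  have h1 := asAlgebraHom_charSum_of_forall η (v := (v : E))
    (fun u => congrArg Subtype.val (hv u))
  rw [hz v v.2] at h1
  exact Subtype.ext ((smul_eq_zero.1 h1.symm).resolve_left hN)

omit [Fintype k] in
lemma pushHom_charSum_genericChar [Fintype (upperUnip k n)] {A : Type} [CommRing A] (j : A →+* R)
    (ψ : AddChar k A) : pushHom j id (charSum (upperUnip k n) (genericChar ψ)) =
      charSum (upperUnip k n) (genericChar (j.toMonoidHom.compAddChar ψ)) :=
  pushHom_charSum _ j id _ (fun _ => rfl) (fun _ h => h) fun u => by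
    rw [genericChar_apply, genericChar_apply]
    rfl

end Whittaker

section RankOneSubmodule

lemma rank_eq_one_iff_of_functional {R E : Type} [Field R] [AddCommGroup E] [Module R E]
    (W : Submodule R E) (ev : E →ₗ[R] R) (h : ∀ l ∈ W, ev l = 0 → l = 0) :
    W ≠ ⊥ ↔ Module.rank R W = 1 := by
  constructor
  · intro hne
    refine le_antisymm ?_ ?_
    · have hf : Function.Injective (ev.comp W.subtype) := LinearMap.ker_eq_bot.1
        (LinearMap.ker_eq_bot'.2 fun l hl0 => Subtype.ext (h l l.2 hl0))
      simpa using LinearMap.rank_le_of_injective (ev.comp W.subtype) hf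
    · rw [Cardinal.one_le_iff_ne_zero]
      exact fun h0 => hne (Submodule.rank_eq_zero.1 h0)
  · rintro h1 rfl
    rw [rank_bot] at h1
    exact zero_ne_one h1

end RankOneSubmodule

section Distinction

open scoped MonoidAlgebra

variable {k₀ k : Type} [Field k₀] [Field k] [Fintype k] [Algebra k₀ k] {n : ℕ} {R : Type} [Field R]
  {V : Type} [AddCommGroup V] [Module R V] {ρ : Representation R (GL (Fin n) k) V}
  {ψ : AddChar k R} {N : R} {v₀ : V} {μ : V →ₗ[R] R} [Fintype (upperUnip k n)]

/-- On a cuspidal representation with a unique Whittaker line, an invariant form is determined by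
its value on this line. -/
lemma invariantForm_eq_zero (hquad : Module.finrank k₀ k = 2) (hcusp : IsCuspidal k ρ)
    (hψ₀ : ∀ x, ψ (algebraMap k₀ k x) = 1) (hψ : ψ ≠ 1) (hk : (Fintype.card k : R) ≠ 0)
    (hN : (Fintype.card (upperUnip k n) : R) ≠ 0)
    (h : ρ.ActsRankOne (charSum (upperUnip k n) (genericChar ψ)) N v₀ μ) {l : V →ₗ[R] R}
    (hl : l ∈ invariantForms ρ (glBase k₀ k n : Set (GL (Fin n) k))) (h0 : l v₀ = 0) : l = 0 := by
  rw [← LinearMap.ker_eq_top]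
  refine eq_top_of_whittaker_mem hψ hk k₀ hcusp _ (fun c a v hv ⟨i, hic, hi⟩ => ?_)
    (fun g hg v hv => by rwa [LinearMap.mem_ker, hl g hg] at hv) (fun v hv => ?_)
  · obtain ⟨u, hu⟩ := exists_addChar_mul_ne_one hquad hψ₀ (by
      by_contra! hc
      exact hψ (DFunLike.ext _ _ hc)) hi
    have h1 := hv (Pi.single i (algebraMap k₀ k u))
    rw [dotProduct_single] at h1
    have hmem : (unipCol c (Pi.single i (algebraMap k₀ k u)) : GL (Fin n) k) ∈ glBase k₀ k n := by
      refine ⟨(unipCol c (Pi.single i u) : GL (Fin n) k₀), ?_⟩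
      ext x y
      change algebraMap k₀ k ((unipCol c (Pi.single i u) : GL (Fin n) k₀).val x y) = _
      rw [unipCol_val, unipCol_val, Matrix.add_apply, Matrix.add_apply, vecMulVec_apply,
        vecMulVec_apply, one_apply, one_apply]
      simp only [Pi.single_apply]
      split_ifs <;> simp
    have h2 := hl _ hmem v
    rw [h1, map_smul, smul_eq_mul] at h2
    by_contra hlv
    exact hu (mul_right_cancel₀ hlv (h2.trans (one_mul _).symm))
  · have h1 := asAlgebraHom_charSum_of_forall ρ hv
    rw [h.apply_eq] at h1
    have h2 := congrArg l h1
    rw [map_smul, h0, smul_zero, map_smul] at h2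
    exact (smul_eq_zero.1 h2.symm).resolve_left hN

end Distinction

lemma natCast_ne_zero_of_ringChar_ne (p : ℕ) [Fact p.Prime] (R : Type*) [Field R]
    (h : ringChar R ≠ p) : (p : R) ≠ 0 := by
  intro h0
  rcases (Nat.dvd_prime Fact.out).1 (ringChar.dvd h0) with h1 | h1
  · exact CharP.ringChar_ne_one h1
  · exact h h1

lemma natCast_card_ne_zero_of_charP (p : ℕ) [Fact p.Prime] (k : Type*) [Field k] [Fintype k]
    [CharP k p] (R : Type*) [Field R] (hp : (p : R) ≠ 0) : (Fintype.card k : R) ≠ 0 := by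
  obtain ⟨m, -, hm⟩ := FiniteField.card k p
  rw [hm, Nat.cast_pow]
  exact pow_ne_zero _ hp

/-- For `n` odd and `ρ` a supercuspidal irreducible representation of
`GL n k`:  σ-selfdual ↔ `GL n k₀`-distinguished ↔ the space of invariant forms is
one-dimensional. -/
theorem supercuspidal_odd_distinction_criterion
    (p : ℕ) [Fact p.Prime]
    (k₀ k : Type) [Field k₀] [Field k] [Fintype k₀] [Fintype k]
    [CharP k p] [Algebra k₀ k] (hquad : Module.finrank k₀ k = 2)
    (σ : k ≃ₐ[k₀] k) (hσ : σ ≠ AlgEquiv.refl)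
    (R : Type) [Field R] [IsAlgClosed R] (hchar : ringChar R ≠ p)
    (n : ℕ) (hn : Odd n) (hn1 : 1 ≤ n) (V : Type) [AddCommGroup V] [Module R V]
    (ρ : Representation R (GL (Fin n) k) V)
    (hirr : IsIrreducibleRep ρ) (hsc : IsSupercuspidal k ρ) :
    (RepIso (ρ.comp (glAut k₀ k σ n)) ρ.dual ↔
        invariantForms ρ (glBase k₀ k n : Set (GL (Fin n) k)) ≠ ⊥) ∧
      (invariantForms ρ (glBase k₀ k n : Set (GL (Fin n) k)) ≠ ⊥ ↔
        Module.rank R ↥(invariantForms ρ (glBase k₀ k n : Set (GL (Fin n) k))) = 1) := by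
  classical
  have hp := natCast_ne_zero_of_ringChar_ne p R hchar
  have hk := natCast_card_ne_zero_of_charP p k R hp
  have hN := natCast_card_ne_zero_of_isPGroup p (isPGroup_upperUnip (k := k) (n := n) p) R hp
  have : FiniteDimensional R V := hirr.finiteDimensional
  obtain ⟨A, _, _, i, j, ψ, hi, hψ₀, ⟨x, hx⟩, hconj⟩ :=
    exists_addChar (k₀ := k₀) (k := k) p hquad R hp
  have hψ : ψ ≠ 1 := fun h => hx (by rw [h, AddChar.one_apply, map_one])
  set ψR : AddChar k R := j.toMonoidHom.compAddChar ψ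
  have hψR₀ : ∀ x, ψR (algebraMap k₀ k x) = 1 := fun x => by
    change j (ψ (algebraMap k₀ k x)) = 1
    rw [hψ₀, map_one]
  have hψR : ψR ≠ 1 := fun h => hx (DFunLike.congr_fun h x)
  have D := gelfandElement_charSum (n := n) hquad hσ hi hψ₀ hψ hconj
  have hz := pushHom_charSum_genericChar (n := n) j ψ
  have hX := card_norm_fibre_eq_card_fixed (n := n) hquad hσ
  have hH : ∀ g ∈ glBase k₀ k n, glAut k₀ k σ n g = g := fun g hg =>
    (mem_glBase_iff hquad hσ).1 hg
  have hcusp : IsCuspidal k ρ := IsSupercuspidal.isCuspidal (η := ρ) p hp hsc LinearMap.id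
    (fun _ _ => rfl) Function.surjective_id
    (fun W hW hWtop => ((hirr.2 W hW).resolve_right hWtop).le.trans bot_le)
  obtain ⟨v₀, hv₀, hv₀0⟩ : ∃ v, (∀ u : upperUnip k n, ρ u v = genericChar ψR u • v) ∧ v ≠ 0 := by
    by_contra! hc
    obtain ⟨v, hv⟩ := hirr.exists_ne_zero
    exact hv (hcusp.eq_zero_of_whittaker hψR hk hc v)
  obtain ⟨μ, hμ₀, hμ⟩ := hirr.exists_eq_smul_of_hecke_comm hN (D.mul_self_push j) (D.comm_push j)
    hv₀0 (by rw [hz]; exact asAlgebraHom_charSum_of_forall ρ hv₀)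
  have h : ρ.ActsRankOne (pushHom j id (charSum (upperUnip k n) (genericChar ψ)))
      (Fintype.card (upperUnip k n)) v₀ μ := ⟨hN, hμ₀, hμ⟩
  have hforms : ∀ l ∈ invariantForms ρ (glBase k₀ k n : Set (GL (Fin n) k)), l v₀ = 0 → l = 0 :=
    fun l hl hl0 => invariantForm_eq_zero hquad hcusp hψR₀ hψR hk hN (hz ▸ h) hl hl0
  refine ⟨⟨fun hiso => ?_, fun hne => ?_⟩,
    rank_eq_one_iff_of_functional _ (LinearMap.applyₗ v₀) hforms⟩
  · have hχ := h.apply_theta_eq D.map_map (D.theta_push j) hiso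
    obtain ⟨F, hF, π, hπ, hsurj, hmax, hker⟩ := D.exists_permRep_cosocle_map j h hirr hχ hX
    have hcuspE := IsSupercuspidal.isCuspidal _ p hp hsc π hπ hsurj hmax
    exact invariantForms_ne_bot_of_injective D.map_map hH hF π hπ hsurj
      (hcuspE.injective_of_asAlgebraHom_eq_zero hψR hk hN π hπ (by rwa [hz] at hker))
  · obtain ⟨l, hl, hl0⟩ := Submodule.exists_mem_ne_zero_of_ne_bot hne
    exact IsIrreducibleRep.repIso_dual D.map_map hirr h (D.theta_push j)
      (D.apply_theta_eq_of_invariantForm j h hH hX hl fun h0 => hl0 (hforms l hl h0))
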